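/- arXiv:2312.05564 — 5 statements merged into one kernel-verified Lean document; each statement's English description precedes it below -/
import Mathlib

section
/- Let G be a finite connected simple graph with minimum degree at least 2 and maximum degree Δ which has connectivity 1, i.e. G has a cut vertex (a vertex whose deletion disconnects G). Then M'_D(G) ≤ ⌈√Δ⌉ + 5; that is, G has an edge coloring with ⌈√Δ⌉ + 5 colors that is both a majority edge coloring and a distinguishing edge coloring. -/
open SimpleGraph

/-- Majority edge coloring. -/
def IsMajorityEdgeColoring {V : Type*} [Fintype V] [DecidableEq V]
    (G : SimpleGraph V) [DecidableRel G.Adj] {k : ℕ} (c : Sym2 V → Fin k) : Prop :=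
  ∀ u : V, ∀ α : Fin k,
    2 * ((G.neighborFinset u).filter (fun v => c s(u, v) = α)).card ≤ G.degree u

/-- Distinguishing edge coloring. -/
def IsDistinguishingEdgeColoring {V : Type*} (G : SimpleGraph V) {k : ℕ}
    (c : Sym2 V → Fin k) : Prop :=
  ∀ φ : G ≃g G, (∀ u v : V, G.Adj u v → c s(φ u, φ v) = c s(u, v)) → ∀ x : V, φ x = x

set_option linter.unusedSectionVars false


/-- A rooted spanning tree, given by a parent function and a depth function. -/
structure PT {V : Type*} (G : SimpleGraph V) where
  r : V
  p : V → V
  d : V → ℕ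
  pr : p r = r
  dr : d r = 0
  adj : ∀ x, x ≠ r → G.Adj x (p x)
  dp : ∀ x, x ≠ r → d x = d (p x) + 1

namespace PT
variable {V : Type*} {G : SimpleGraph V} (T : PT G)

/-- `a` is an ancestor of `y` (possibly equal). -/
def anc (a y : V) : Prop := ∃ n : ℕ, T.p^[n] y = a

theorem anc_refl (a : V) : T.anc a a := ⟨0, rfl⟩

theorem anc_p (a : V) : T.anc (T.p a) a := ⟨1, rfl⟩

theorem anc_trans {a b c : V} (h : T.anc a b) (h' : T.anc b c) : T.anc a c := by
  obtain ⟨n, rfl⟩ := h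
  obtain ⟨m, rfl⟩ := h'
  exact ⟨n + m, by rw [Function.iterate_add_apply]⟩

theorem p_iter_r (n : ℕ) : T.p^[n] T.r = T.r := Function.iterate_fixed T.pr n

theorem anc_cases {a y : V} (h : T.anc a y) : a = y ∨ (y ≠ T.r ∧ T.anc a (T.p y)) := by
  obtain ⟨n, rfl⟩ := h
  by_cases hy : y = T.r
  · left; rw [hy]; exact T.p_iter_r n
  · cases n with
    | zero => left; rfl
    | succ n => right; exact ⟨hy, n, rfl⟩

theorem d_p_le (y : V) : T.d (T.p y) ≤ T.d y := by
  by_cases hy : y = T.r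
  · rw [hy, T.pr]
  · rw [T.dp y hy]; omega

theorem d_iter_le (y : V) (n : ℕ) : T.d (T.p^[n] y) ≤ T.d y := by
  induction n with
  | zero => exact le_rfl
  | succ n ih => rw [Function.iterate_succ_apply']; exact (T.d_p_le _).trans ih

theorem anc_d_le {a y : V} (h : T.anc a y) : T.d a ≤ T.d y := by
  obtain ⟨n, rfl⟩ := h
  exact T.d_iter_le y n

theorem anc_d_lt {a y : V} (h : T.anc a y) (hne : a ≠ y) : T.d a < T.d y := by
  rcases T.anc_cases h with h | ⟨h1, h2⟩
  · exact absurd h hne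
  · have := T.anc_d_le h2
    have := T.dp y h1
    omega

theorem anc_antisymm {a y : V} (h : T.anc a y) (h' : T.anc y a) : a = y := by
  by_contra hne
  have := T.anc_d_lt h hne
  have := T.anc_d_le h'
  omega

theorem anc_total {a b y : V} (h : T.anc a y) (h' : T.anc b y) : T.anc a b ∨ T.anc b a := by
  obtain ⟨n, rfl⟩ := h
  obtain ⟨m, rfl⟩ := h'
  rcases le_total n m with hnm | hnm
  · right; refine ⟨m - n, ?_⟩
    rw [← Function.iterate_add_apply]; congr 2; omega
  · left; refine ⟨n - m, ?_⟩
    rw [← Function.iterate_add_apply]; congr 2; omega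

theorem anc_eq_of_d {a b y : V} (h : T.anc a y) (h' : T.anc b y) (hd : T.d a = T.d b) : a = b := by
  by_contra hne
  rcases T.anc_total h h' with h1 | h1
  · have := T.anc_d_lt h1 hne; omega
  · have := T.anc_d_lt h1 (Ne.symm hne); omega

theorem eq_r_of_d {y : V} (h : T.d y = 0) : y = T.r := by
  by_contra hne
  have := T.dp y hne
  omega

theorem anc_r (y : V) : T.anc T.r y := by
  obtain ⟨n, hn⟩ : ∃ n, T.d y = n := ⟨_, rfl⟩
  induction n generalizing y with
  | zero => rw [T.eq_r_of_d hn]; exact T.anc_refl _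
  | succ n ih =>
    have hy : y ≠ T.r := by rintro rfl; rw [T.dr] at hn; omega
    have := T.dp y hy
    exact T.anc_trans (ih (T.p y) (by omega)) (T.anc_p y)

theorem anc_r_iff {a : V} (h : T.anc a T.r) : a = T.r := T.anc_antisymm h (T.anc_r a)

theorem p_ne {x : V} (hx : x ≠ T.r) : T.p x ≠ x := (T.adj x hx).ne'

/-- the child of `a` towards `y` -/
theorem exists_child {a y : V} (h : T.anc a y) (hne : a ≠ y) :
    ∃ x, x ≠ T.r ∧ T.p x = a ∧ T.anc x y := by
  obtain ⟨n, hn⟩ : ∃ n, T.d y = n := ⟨_, rfl⟩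
  induction n generalizing y with
  | zero =>
    have := T.anc_d_lt h hne; omega
  | succ n ih =>
    rcases T.anc_cases h with h1 | ⟨h1, h2⟩
    · exact absurd h1 hne
    · by_cases hp : a = T.p y
      · exact ⟨y, h1, hp.symm, T.anc_refl y⟩
      · have := T.dp y h1
        obtain ⟨x, hx1, hx2, hx3⟩ := ih h2 hp (by omega)
        exact ⟨x, hx1, hx2, T.anc_trans hx3 (T.anc_p y)⟩

theorem d_lt_card [Fintype V] (y : V) : T.d y < Fintype.card V := by
  have key : ∀ n ≤ T.d y, T.d (T.p^[n] y) = T.d y - n := by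
    intro n hn
    induction n with
    | zero => rfl
    | succ n ih =>
      have ih := ih (by omega)
      rw [Function.iterate_succ_apply']
      have hne : T.p^[n] y ≠ T.r := by
        intro h; rw [h, T.dr] at ih; omega
      have := T.dp _ hne
      omega
  have hinj : Function.Injective (fun i : Fin (T.d y + 1) => T.p^[(i : ℕ)] y) := by
    intro i j hij
    have hi := key i (by omega)
    have hj := key j (by omega)
    simp only at hij
    rw [hij] at hi
    ext; omega
  have := Fintype.card_le_of_injective _ hinj
  simpa using this

/-- recursion along the tree -/
theorem exists_rec {β : Type*} (b0 : β) (g : V → β → β) :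
    ∃ f : V → β, f T.r = b0 ∧ ∀ x, x ≠ T.r → f x = g x (f (T.p x)) := by
  let F : ℕ → V → β := fun n => Nat.rec (fun _ => b0) (fun _ ih x => g x (ih (T.p x))) n
  refine ⟨fun x => F (T.d x) x, ?_, ?_⟩
  · simp only [T.dr]; rfl
  · intro x hx
    simp only [T.dp x hx]; rfl

end PT

open Classical in
/-- Re-hanging. -/
theorem exists_rehang {V : Type*} [Fintype V] {G : SimpleGraph V} (T : PT G) {u v : V}
    (huv : G.Adj u v) (h1 : ¬ T.anc u v) (h2 : ¬ T.anc v u) (hd : T.d u ≤ T.d v) :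
    ∃ T' : PT G, ∑ x, T.d x < ∑ x, T'.d x := by
  have hur : u ≠ T.r := by rintro rfl; exact h1 (T.anc_r v)
  let d' : V → ℕ := fun y => if T.anc u y then T.d y + (T.d v + 1 - T.d u) else T.d y
  let p' : V → V := fun y => if y = u then v else T.p y
  refine ⟨⟨T.r, p', d', ?_, ?_, ?_, ?_⟩, ?_⟩
  · simp only [p']; rw [if_neg hur.symm]; exact T.pr
  · simp only [d']; rw [if_neg, T.dr]; intro h; exact hur (T.anc_r_iff h)
  · intro x hx
    simp only [p']
    split_ifs with h
    · rw [h]; exact huv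
    · exact T.adj x hx
  · intro x hx
    simp only [p', d']
    by_cases h : x = u
    · subst h
      rw [if_pos (T.anc_refl _), if_pos rfl, if_neg h1]; omega
    · have hiff : T.anc u x ↔ T.anc u (T.p x) := by
        constructor
        · intro h'
          rcases T.anc_cases h' with h' | h'
          · exact absurd h'.symm h
          · exact h'.2
        · intro h'; exact T.anc_trans h' (T.anc_p x)
      rw [if_neg h]
      have := T.dp x hx
      by_cases h' : T.anc u x
      · rw [if_pos h', if_pos (hiff.1 h')]; omega
      · rw [if_neg h', if_neg (fun h'' => h' (hiff.2 h''))]; omega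
  · apply Finset.sum_lt_sum
    · intro i _
      simp only [d']; split_ifs <;> omega
    · refine ⟨u, Finset.mem_univ _, ?_⟩
      simp only [d']; rw [if_pos (T.anc_refl _)]; omega

theorem exists_PT {V : Type*} [Fintype V] {G : SimpleGraph V} (hG : G.Connected) :
    Nonempty (PT G) := by
  classical
  obtain ⟨r⟩ := hG.nonempty
  have : ∀ x, ∃ y, (x = r → y = r) ∧ (x ≠ r → G.Adj x y ∧ G.dist x r = G.dist y r + 1) := by
    intro x
    by_cases hx : x = r
    · exact ⟨r, by simp, fun h => absurd hx h⟩
    · obtain ⟨w, hw⟩ := hG.exists_walk_length_eq_dist x r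
      cases w with
      | nil => exact absurd rfl hx
      | cons h w =>
        rename_i y
        refine ⟨y, fun h => absurd h hx, fun _ => ⟨h, ?_⟩⟩
        have h1 := SimpleGraph.dist_le w
        have h2 : G.dist x r ≤ G.dist x y + G.dist y r := hG.dist_triangle
        rw [SimpleGraph.dist_eq_one_iff_adj.2 h] at h2
        simp only [SimpleGraph.Walk.length_cons] at hw
        omega
  choose p hp using this
  exact ⟨⟨r, p, fun x => G.dist x r, (hp r).1 rfl, by simp, fun x hx => ((hp x).2 hx).1,
    fun x hx => ((hp x).2 hx).2⟩⟩

/-- Existence of normal (depth first search) spanning trees. -/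
theorem exists_normal {V : Type*} [Fintype V] {G : SimpleGraph V} (hG : G.Connected) :
    ∃ T : PT G, ∀ u v, G.Adj u v → T.anc u v ∨ T.anc v u := by
  classical
  let S : Set ℕ := {n | ∃ T : PT G, ∑ x, T.d x = n}
  have hS : S.Nonempty := by
    obtain ⟨T⟩ := exists_PT hG
    exact ⟨_, T, rfl⟩
  have hb : BddAbove S := by
    refine ⟨∑ _x : V, Fintype.card V, ?_⟩
    rintro n ⟨T, rfl⟩
    exact Finset.sum_le_sum (fun x _ => (T.d_lt_card x).le)
  obtain ⟨T, hT⟩ := Nat.sSup_mem hS hb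
  refine ⟨T, ?_⟩
  have main : ∀ u v, G.Adj u v → T.d u ≤ T.d v → T.anc u v ∨ T.anc v u := by
    intro u v huv hd
    by_contra hcon
    push Not at hcon
    obtain ⟨T', hT'⟩ := exists_rehang T huv hcon.1 hcon.2 hd
    have := le_csSup hb ⟨T', rfl⟩
    omega
  intro u v huv
  rcases le_total (T.d u) (T.d v) with h | h
  · exact main u v huv h
  · exact (main v u huv.symm h).symm


namespace PT
variable {V : Type*} {G : SimpleGraph V} (T : PT G)

/-- leaf of the tree -/
def Leaf (y : V) : Prop := ∀ x, x ≠ T.r → T.p x ≠ y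

theorem Leaf.anc_eq {T : PT G} {y w : V} (h : T.Leaf y) (hw : T.anc y w) : w = y := by
  by_contra hne
  obtain ⟨x, h1, h2, -⟩ := T.exists_child hw (Ne.symm hne)
  exact h x h1 h2

theorem d_iter (y : V) (n : ℕ) : T.d (T.p^[n] y) = T.d y - n := by
  induction n with
  | zero => rfl
  | succ n ih =>
    rw [Function.iterate_succ_apply']
    by_cases hne : T.p^[n] y = T.r
    · rw [hne, T.pr, T.dr]; rw [hne, T.dr] at ih; omega
    · have := T.dp _ hne
      omega

theorem not_anc_p {x : V} (hx : x ≠ T.r) : ¬ T.anc x (T.p x) := by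
  intro h
  have := T.anc_d_le h
  have := T.dp x hx
  omega

end PT

/-- The combinatorial data used to define the colouring. -/
structure CD {V : Type*} (G : SimpleGraph V) extends PT G where
  normal : ∀ u v, G.Adj u v → toPT.anc u v ∨ toPT.anc v u
  ex : V → V
  ex_leaf : ∀ a, toPT.Leaf a → ex a = a
  ex_ne : ∀ a, ¬ toPT.Leaf a → ex a ≠ r
  p_ex : ∀ a, ¬ toPT.Leaf a → p (ex a) = a
  ex_nl : ∀ a, ¬ toPT.Leaf a → toPT.Leaf (ex a) → ∀ x, x ≠ r → p x = a → toPT.Leaf x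
  low : V → V
  low_adj : ∀ y, toPT.Leaf y → G.Adj y (low y)
  low_ne : ∀ y, toPT.Leaf y → low y ≠ p y
  low_max : ∀ y, toPT.Leaf y → ∀ w, G.Adj y w → w ≠ p y → d w ≤ d (low y)
  root_nl : ¬ toPT.Leaf r
  root_ch : ∀ x, x ≠ r → p x = r → ¬ toPT.Leaf x
  al : V → ℕ
  rank : V → ℕ
  q : V → ℕ
  rank_inj : ∀ x x', x ≠ r → x' ≠ r → ex (p x) ≠ x → ex (p x') ≠ x' → p x = p x' →
    al x = al x' → rank x = rank x' → x = x'
  q_r : q r = 1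
  q_ex : ∀ x, x ≠ r → ex (p x) = x → q x = 1 - q (p x)
  q_ne : ∀ x, x ≠ r → ex (p x) ≠ x → q x = 0

namespace CD
variable {V : Type*} {G : SimpleGraph V} (T : CD G)

/-- Vertices whose only descendant is one leaf, and which are not exempt. -/
def Type2 (x : V) : Prop :=
  x ≠ T.r ∧ T.ex (T.p x) ≠ x ∧ ¬ T.Leaf x ∧ T.Leaf (T.ex x) ∧
    ∀ z, z ≠ T.r → T.p z = x → z = T.ex x

open Classical in
/-- Colour of the tree edge from `x` to its parent. -/
noncomputable def t (x : V) : ℕ :=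
  if T.ex (T.p x) ≠ x then 5 + T.al x
  else if T.Type2 (T.p x) then
    (if T.rank (T.p x) = T.al (T.p x) then 0 else 5 + T.rank (T.p x))
  else if T.Leaf x then 2 else T.q (T.p x)

/-- leaves having a decider edge -/
def LD (y : V) : Prop := T.Leaf y ∧ ¬ T.Type2 (T.p y)

theorem q_le (x : V) : T.q x ≤ 1 := by
  by_cases h : x = T.r
  · rw [h, T.q_r]
  · by_cases h' : T.ex (T.p x) = x
    · rw [T.q_ex x h h']; omega
    · rw [T.q_ne x h h']; omega

theorem t_ne {x : V} (h : T.ex (T.p x) ≠ x) : T.t x = 5 + T.al x := by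
  rw [t, if_pos h]

theorem t_two {x : V} (h : T.ex (T.p x) = x) (h2 : T.Type2 (T.p x)) :
    T.t x = if T.rank (T.p x) = T.al (T.p x) then 0 else 5 + T.rank (T.p x) := by
  classical
  rw [t, if_neg (not_not.2 h), if_pos h2]

theorem t_leaf {x : V} (h : T.ex (T.p x) = x) (h2 : ¬ T.Type2 (T.p x)) (h3 : T.Leaf x) :
    T.t x = 2 := by
  classical
  rw [t, if_neg (not_not.2 h), if_neg h2, if_pos h3]

theorem t_q {x : V} (h : T.ex (T.p x) = x) (h3 : ¬ T.Leaf x) :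
    T.t x = T.q (T.p x) := by
  classical
  rw [t, if_neg (not_not.2 h), if_neg, if_neg h3]
  intro h2
  have := h2.2.2.2.1
  rw [h] at this
  exact h3 this

theorem not_leaf_p {x : V} (hx : x ≠ T.r) : ¬ T.Leaf (T.p x) := fun h => h x hx rfl

theorem ex_p_ex {a : V} (h : ¬ T.Leaf a) : T.ex (T.p (T.ex a)) = T.ex a := by rw [T.p_ex a h]

theorem not_type2_ex {a : V} (h : ¬ T.Type2 a) : ¬ T.Type2 (T.ex a) := by
  by_cases hl : T.Leaf a
  · rw [T.ex_leaf a hl]; exact h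
  · intro h2
    exact h2.2.1 (T.ex_p_ex hl)

theorem d_ex {a : V} (h : ¬ T.Leaf a) : T.d (T.ex a) = T.d a + 1 := by
  have := T.dp _ (T.ex_ne a h)
  rwa [T.p_ex a h] at this

theorem iter_ex (a : V) (n : ℕ) : T.Leaf (T.ex^[n] a) ∨ T.d (T.ex^[n] a) = T.d a + n := by
  induction n with
  | zero => right; rfl
  | succ n ih =>
    rw [Function.iterate_succ_apply']
    by_cases hl : T.Leaf (T.ex^[n] a)
    · left; rw [T.ex_leaf _ hl]; exact hl
    · right
      rw [T.d_ex hl]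
      rcases ih with ih | ih
      · exact absurd ih hl
      · omega

/-- the leaf at the end of the exempt chain -/
def L [Fintype V] (a : V) : V := T.ex^[Fintype.card V] a

theorem leaf_L [Fintype V] (a : V) : T.Leaf (T.L a) := by
  rcases T.iter_ex a (Fintype.card V) with h | h
  · exact h
  · have := T.d_lt_card (T.ex^[Fintype.card V] a)
    omega

theorem anc_ex (a : V) : T.anc a (T.ex a) := by
  by_cases hl : T.Leaf a
  · rw [T.ex_leaf _ hl]; exact T.anc_refl _
  · have := T.anc_p (T.ex a)
    rwa [T.p_ex a hl] at this

end CD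

/-- the colour properties needed for the distinguishing proof -/
structure Good {V : Type*} [Fintype V] {G : SimpleGraph V} (T : CD G) (c : Sym2 V → ℕ) : Prop where
  c1 : ∀ x, x ≠ T.r → c s(x, T.p x) = T.t x
  c2 : ∀ u w, G.Adj u w → T.anc w u → w ≠ T.p u →
    (2 ≤ c s(u, w) ∧ c s(u, w) ≤ 4) ∨ (T.LD u ∧ w = T.low u ∧ 2 ≤ c s(u, w))
  c3 : ∀ w, G.Adj T.r w → c s(T.r, w) ≠ 2
  c4 : ∀ x x', x ≠ T.r → x' ≠ T.r → T.ex (T.p x) ≠ x → T.ex (T.p x') ≠ x' → T.p x = T.p x' →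
    T.al x = T.al x' → ¬ T.Type2 x → ¬ T.Type2 x' → x ≠ x' →
    c s(T.L x, T.low (T.L x)) ≠ c s(T.L x', T.low (T.L x'))

section dist
variable {V : Type*} [Fintype V] {G : SimpleGraph V} {T : CD G} {c : Sym2 V → ℕ}

theorem Good.two_le (h : Good T c) {u w : V} (ha : G.Adj u w) (hw : T.anc w u) (hp : w ≠ T.p u) :
    2 ≤ c s(u, w) := by
  rcases h.c2 u w ha hw hp with h | h
  · exact h.1
  · exact h.2.2

/-- a small colour on a downward edge `v - u` means the edge is the exempt edge -/
theorem Good.small (h : Good T c) {v u : V} (ha : G.Adj u v) (hv : T.anc v u)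
    (hc : c s(u, v) ≤ 1) : u ≠ T.r ∧ T.p u = v ∧ u = T.ex v := by
  have hp : v = T.p u := by
    by_contra hp
    have := h.two_le ha hv hp
    omega
  have hu : u ≠ T.r := by
    rintro rfl
    rw [T.pr] at hp
    exact ha.ne hp.symm
  refine ⟨hu, hp.symm, ?_⟩
  rw [hp, h.c1 u hu] at hc
  by_contra hne
  rw [T.t_ne] at hc
  · omega
  · rw [← hp]; exact Ne.symm hne

theorem Good.LD_two_le (h : Good T c) {y w : V} (hy : T.LD y) (ha : G.Adj y w) :
    2 ≤ c s(y, w) := by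
  rcases T.normal _ _ ha with h1 | h1
  · exact absurd (hy.1.anc_eq h1) ha.ne'
  · by_cases hp : w = T.p y
    · have hr : y ≠ T.r := by rintro rfl; exact T.root_nl hy.1
      rw [hp, h.c1 y hr]
      by_cases he : T.ex (T.p y) = y
      · rw [T.t_leaf he hy.2 hy.1]
      · rw [T.t_ne he]; omega
    · exact h.two_le ha h1 hp

theorem Good.root_unique (h : Good T c) {u : V} (h1 : ∃ w, G.Adj u w ∧ c s(u, w) = 1)
    (h0 : ∀ w, G.Adj u w → c s(u, w) ≠ 0) (h2 : ∀ w, G.Adj u w → c s(u, w) ≠ 2) : u = T.r := by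
  by_contra hu
  obtain ⟨w, ha, hc⟩ := h1
  rcases T.normal _ _ ha with h1 | h1
  · rw [Sym2.eq_swap] at hc
    obtain ⟨hw, hp, he⟩ := h.small ha.symm h1 (by omega)
    have hnl : ¬ T.Leaf u := by rw [← hp]; exact T.not_leaf_p hw
    have hwl : ¬ T.Leaf w := by
      intro hl
      rw [← hp, h.c1 w hw] at hc
      by_cases h2 : T.Type2 (T.p w)
      · rw [T.t_two (by rw [hp]; exact he.symm) h2] at hc
        split_ifs at hc; omega
      · rw [T.t_leaf (by rw [hp]; exact he.symm) h2 hl] at hc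
        omega
    rw [← hp, h.c1 w hw, T.t_q (by rw [hp]; exact he.symm) hwl, hp] at hc
    have hue : T.ex (T.p u) = u := by
      by_contra hne
      rw [T.q_ne u hu hne] at hc; omega
    rw [T.q_ex u hu hue] at hc
    apply h0 (T.p u) (T.adj u hu)
    rw [h.c1 u hu, T.t_q hue hnl]
    omega
  · obtain ⟨-, hp, he⟩ := h.small ha h1 (by omega)
    rw [← hp, h.c1 u hu] at hc
    have hue : T.ex (T.p u) = u := by rw [hp]; exact he.symm
    have hnl : ¬ T.Leaf u := by
      intro hl
      by_cases h2 : T.Type2 (T.p u)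
      · rw [T.t_two hue h2] at hc
        split_ifs at hc; omega
      · rw [T.t_leaf hue h2 hl] at hc
        omega
    rw [T.t_q hue hnl] at hc
    have hq : T.q u = 0 := by rw [T.q_ex u hu hue]; omega
    have hr := T.ex_ne u hnl
    have hpx := T.p_ex u hnl
    have hadj : G.Adj u (T.ex u) := by
      have := T.adj _ hr
      rw [hpx] at this; exact this.symm
    have hcc : c s(u, T.ex u) = T.t (T.ex u) := by
      have := h.c1 _ hr
      rwa [hpx, Sym2.eq_swap] at this
    have hxx := T.ex_p_ex hnl
    have hn2 : ¬ T.Type2 (T.p (T.ex u)) := by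
      rw [hpx]; intro h2; exact h2.2.1 hue
    by_cases hl : T.Leaf (T.ex u)
    · apply h2 _ hadj
      rw [hcc, T.t_leaf hxx hn2 hl]
    · apply h0 _ hadj
      rw [hcc, T.t_q hxx hl, hpx, hq]

theorem Good.root_edge (h : Good T c) : ∃ w, G.Adj T.r w ∧ c s(T.r, w) = 1 := by
  have hr := T.ex_ne _ T.root_nl
  have hp := T.p_ex _ T.root_nl
  refine ⟨T.ex T.r, ?_, ?_⟩
  · have := T.adj _ hr
    rw [hp] at this; exact this.symm
  · have := h.c1 _ hr
    rw [hp, Sym2.eq_swap] at this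
    rw [this, T.t_q (T.ex_p_ex T.root_nl) (T.root_ch _ hr hp), hp, T.q_r]

theorem Good.root_no_zero (h : Good T c) (w : V) (ha : G.Adj T.r w) : c s(T.r, w) ≠ 0 := by
  intro hc
  rw [Sym2.eq_swap] at hc
  obtain ⟨hw, hp, he⟩ := h.small ha.symm (T.anc_r w) (by omega)
  have := h.c1 w hw
  rw [hp, T.t_q (by rw [hp]; exact he.symm) (T.root_ch _ hw hp), hp, T.q_r] at this
  omega

/-- colour preserving automorphisms -/
def CP (c : Sym2 V → ℕ) (φ : G ≃g G) : Prop := ∀ u v, G.Adj u v → c s(φ u, φ v) = c s(u, v)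

theorem CP.symm {φ : G ≃g G} (h : CP c φ) : CP c φ.symm := by
  intro u v ha
  have := h (φ.symm u) (φ.symm v) (φ.symm.map_adj_iff.2 ha)
  simpa using this.symm

theorem Good.fix_root (h : Good T c) {φ : G ≃g G} (hφ : CP c φ) : φ T.r = T.r := by
  have key : ∀ w, G.Adj (φ T.r) w →
      G.Adj T.r (φ.symm w) ∧ c s(φ T.r, w) = c s(T.r, φ.symm w) := by
    intro w hw
    have h1 : G.Adj T.r (φ.symm w) := by
      have := φ.symm.map_adj_iff.2 hw
      simpa using this
    refine ⟨h1, ?_⟩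
    have := hφ _ _ h1
    simpa using this
  apply h.root_unique
  · obtain ⟨w, hw, hc⟩ := h.root_edge
    exact ⟨φ w, φ.map_adj_iff.2 hw, by rw [hφ _ _ hw, hc]⟩
  · intro w hw
    rw [(key w hw).2]; exact h.root_no_zero _ (key w hw).1
  · intro w hw
    rw [(key w hw).2]; exact h.c3 _ (key w hw).1

theorem desc_map (φ : G ≃g G) {a a' : V}
    (hs : ∀ z, T.anc z a' → z ≠ a' → T.anc (φ.symm z) a ∧ φ.symm z ≠ a)
    (ha : T.anc a' (φ a)) : ∀ y, T.anc a y → T.anc a' (φ y) := by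
  intro y hy
  obtain ⟨n, hn⟩ : ∃ n, T.d y = n := ⟨_, rfl⟩
  induction n generalizing y with
  | zero =>
    have := T.eq_r_of_d hn
    subst this
    rw [← T.anc_r_iff hy]; exact ha
  | succ n ih =>
    rcases T.anc_cases hy with h | ⟨h1, h2⟩
    · rw [← h]; exact ha
    · have := T.dp y h1
      have h3 := ih (T.p y) h2 (by omega)
      have hadj := φ.map_adj_iff.2 (T.adj y h1)
      rcases T.normal _ _ hadj with h4 | h4
      · rcases T.anc_total h3 h4 with h5 | h5
        · exact h5
        · by_cases h6 : φ y = a'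
          · rw [h6]; exact T.anc_refl _
          · have := hs _ h5 h6
            rw [RelIso.symm_apply_apply] at this
            exact absurd (T.anc_antisymm this.1 hy) this.2
      · exact T.anc_trans h3 h4

theorem exists_image_child {φ : G ≃g G} {x : V} (hx : x ≠ T.r)
    (H : ∀ z, T.d z < T.d x → φ z = z) :
    ∃ x', x' ≠ T.r ∧ T.p x' = T.p x ∧ ∀ y, T.anc x y → T.anc x' (φ y) := by
  have hd := T.dp x hx
  have hv := H (T.p x) (by omega)
  have hadj := φ.map_adj_iff.2 (T.adj x hx)
  rw [hv] at hadj
  have h1 : T.anc (T.p x) (φ x) := by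
    rcases T.normal _ _ hadj with h | h
    · have h2 := T.anc_d_le h
      have h3 := H (φ x) (by omega)
      have h4 := φ.injective h3
      rw [h4] at h
      exact absurd h (T.not_anc_p hx)
    · exact h
  obtain ⟨x', hx', hp, ha⟩ := T.exists_child h1 hadj.ne'
  refine ⟨x', hx', hp, desc_map φ ?_ ha⟩
  intro z hz hne
  have hdx' := T.dp x' hx'
  rw [hp] at hdx'
  have hzd := T.anc_d_lt hz hne
  have hzf : φ.symm z = z := by
    apply φ.injective
    rw [RelIso.apply_symm_apply, H z (by omega)]
  rw [hzf]
  rcases T.anc_cases hz with h | ⟨-, h⟩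
  · exact absurd h hne
  · rw [hp] at h
    exact ⟨T.anc_trans h (T.anc_p x), by rintro rfl; omega⟩

theorem symm_fix {φ : G ≃g G} {z : V} (h : φ z = z) : φ.symm z = z := by
  apply φ.injective
  rw [RelIso.apply_symm_apply, h]

theorem exists_image_child' {φ : G ≃g G} {x : V} (hx : x ≠ T.r)
    (H : ∀ z, T.d z < T.d x → φ z = z) :
    ∃ x', x' ≠ T.r ∧ T.p x' = T.p x ∧ (∀ y, T.anc x y → T.anc x' (φ y)) ∧
      (∀ y, T.anc x' y → T.anc x (φ.symm y)) := by
  obtain ⟨x', hx', hp, h1⟩ := exists_image_child hx H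
  have hd1 := T.dp x hx
  have hd2 := T.dp x' hx'
  rw [hp] at hd2
  obtain ⟨x'', hx'', hp', h2⟩ := exists_image_child (φ := φ.symm) hx'
    (fun z hz => symm_fix (H z (by omega)))
  have hd3 := T.dp x'' hx''
  rw [hp', hp] at hd3
  refine ⟨x', hx', hp, h1, ?_⟩
  have h3 := h2 (φ x) (h1 x (T.anc_refl x))
  rw [RelIso.symm_apply_apply] at h3
  have := T.anc_eq_of_d h3 (T.anc_refl x) (by omega)
  rw [← this]; exact h2

theorem Good.fix_exempt (h : Good T c) {φ : G ≃g G} (hφ : CP c φ) {x : V} (hx : x ≠ T.r)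
    (H : ∀ z, T.d z < T.d x → φ z = z) (he : T.ex (T.p x) = x) : φ x = x := by
  obtain ⟨x', hx', hp, h1, h2⟩ := exists_image_child' hx H
  have hd1 := T.dp x hx
  have hv := H (T.p x) (by omega)
  have hadj := φ.map_adj_iff.2 (T.adj x hx)
  have hcol := hφ _ _ (T.adj x hx)
  rw [hv] at hadj hcol
  rw [h.c1 x hx] at hcol
  have hanc : T.anc (T.p x) (φ x) := by
    have := T.anc_trans (T.anc_p x') (h1 x (T.anc_refl x))
    rwa [hp] at this
  by_cases hl : T.Leaf x
  · by_cases hT : T.Type2 (T.p x)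
    · have : x' = x := by rw [hT.2.2.2.2 x' hx' hp, he]
      rw [this] at h1
      exact hl.anc_eq (h1 x (T.anc_refl x))
    · have hxl : T.Leaf x' := T.ex_nl (T.p x) (T.not_leaf_p hx) (by rw [he]; exact hl) x' hx' hp
      have h3 := hxl.anc_eq (h1 x (T.anc_refl x))
      rw [h3, ← hp, h.c1 x' hx', T.t_leaf he hT hl] at hcol
      rw [h3]
      by_contra hne
      rw [T.t_ne] at hcol
      · omega
      · rw [hp, he]; exact fun h => hne h.symm
  · rw [T.t_q he hl] at hcol
    have := T.q_le (T.p x)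
    obtain ⟨-, -, h3⟩ := h.small hadj hanc (by omega)
    rw [h3, he]

/-- distinct leaves with the same parent are not adjacent -/
theorem leaf_not_adj {z z' : V} (hz : T.Leaf z) (hz' : T.Leaf z') : ¬ G.Adj z z' := by
  intro ha
  rcases T.normal _ _ ha with h | h
  · exact ha.ne (hz.anc_eq h).symm
  · exact ha.ne (hz'.anc_eq h)

/-- if `ex a` is a leaf then every proper descendant of `a` is a leaf child -/
theorem star_desc {a w : V} (hl : T.Leaf (T.ex a)) (hw : T.anc a w) (hne : w ≠ a) :
    w ≠ T.r ∧ T.p w = a ∧ T.Leaf w := by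
  obtain ⟨x, hx, hp, hxw⟩ := T.exists_child hw hne.symm
  have hnl : ¬ T.Leaf a := by rw [← hp]; exact T.not_leaf_p hx
  have hxl := T.ex_nl a hnl hl x hx hp
  have := hxl.anc_eq hxw
  subst this
  exact ⟨hx, hp, hxl⟩

theorem Good.image_child (h : Good T c) {φ : G ≃g G} (hφ : CP c φ) {x : V} (hx : x ≠ T.r)
    (H : ∀ z, T.d z < T.d x → φ z = z) (he : T.ex (T.p x) ≠ x) :
    φ x ≠ T.r ∧ T.p (φ x) = T.p x ∧ T.ex (T.p x) ≠ φ x ∧ (∀ y, T.anc x y → T.anc (φ x) (φ y)) ∧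
      (∀ y, T.anc (φ x) y → T.anc x (φ.symm y)) := by
  obtain ⟨x', hx', hp, h1, h2⟩ := exists_image_child' hx H
  have hd1 := T.dp x hx
  have hd2 := T.dp x' hx'
  rw [hp] at hd2
  have hv := H (T.p x) (by omega)
  have hadj := φ.map_adj_iff.2 (T.adj x hx)
  have hcol := hφ _ _ (T.adj x hx)
  rw [hv] at hadj hcol
  rw [h.c1 x hx, T.t_ne he] at hcol
  have hx'n : T.ex (T.p x') ≠ x' := by
    intro hex
    have hfix := h.fix_exempt hφ hx' (fun z hz => H z (by omega)) hex
    have h3 := h2 x' (T.anc_refl _)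
    rw [symm_fix hfix] at h3
    have := T.anc_eq_of_d h3 (T.anc_refl x') (by omega)
    subst this
    exact he hex
  have hyx := h1 x (T.anc_refl x)
  suffices hsuff : φ x = x' by
    rw [hsuff]
    refine ⟨hx', hp, ?_, h1, h2⟩
    rw [← hp]; exact hx'n
  by_contra hne
  have hlt := T.anc_d_lt hyx (Ne.symm hne)
  have hyr : φ x ≠ T.r := by
    intro hh; rw [hh, T.dr] at hlt; omega
  have hpy : T.p x ≠ T.p (φ x) := by
    intro hh
    have := T.dp _ hyr
    rw [← hh] at this
    omega
  have hanc : T.anc (T.p x) (φ x) := by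
    have := T.anc_trans (T.anc_p x') hyx
    rwa [hp] at this
  rcases h.c2 _ _ hadj hanc hpy with hh | ⟨hLD, -, -⟩
  · omega
  by_cases hl : T.Leaf x
  · have := hl.anc_eq (h2 x' (T.anc_refl _))
    apply hne
    rw [← this, RelIso.apply_symm_apply]
  by_cases hel : T.Leaf (T.ex x)
  · -- star case
    have hpre : ∀ w, T.anc x' w → w ≠ φ x → T.Leaf (φ.symm w) := by
      intro w hw hwne
      refine (star_desc hel (h2 w hw) ?_).2.2
      intro hh
      apply hwne
      rw [← hh, RelIso.apply_symm_apply]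
    have hnadj : ∀ w w', T.anc x' w → T.anc x' w' → w ≠ φ x → w' ≠ φ x → ¬ G.Adj w w' := by
      intro w w' hw hw' hn hn' ha
      exact leaf_not_adj (hpre w hw hn) (hpre w' hw' hn') (φ.symm.map_adj_iff.2 ha)
    have hpanc : T.anc x' (T.p (φ x)) := by
      rcases T.anc_cases hyx with hh | hh
      · exact absurd hh.symm hne
      · exact hh.2
    have hpe : T.p (φ x) = x' := by
      by_contra hpe
      have hdlt := T.anc_d_lt hpanc (Ne.symm hpe)
      have hpr : T.p (φ x) ≠ T.r := by intro hh; rw [hh, T.dr] at hdlt; omega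
      have hppanc : T.anc x' (T.p (T.p (φ x))) := by
        rcases T.anc_cases hpanc with hh | hh
        · exact absurd hh.symm hpe
        · exact hh.2
      have e1 := T.dp _ hyr
      have e2 := T.dp _ hpr
      refine hnadj _ _ hpanc hppanc ?_ ?_ (T.adj _ hpr)
      · intro hh; rw [hh] at e1; omega
      · intro hh; rw [hh] at e2; omega
    have honly : ∀ w, w ≠ T.r → T.p w = x' → w = φ x := by
      intro w hw hpw
      by_contra hwne
      refine hnadj w x' ?_ (T.anc_refl _) hwne (Ne.symm hne) ?_
      · have := T.anc_p w; rwa [hpw] at this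
      · have := T.adj w hw; rwa [hpw] at this
    have hx'l : ¬ T.Leaf x' := by rw [← hpe]; exact T.not_leaf_p hyr
    have hexx : T.ex x' = φ x := honly _ (T.ex_ne _ hx'l) (T.p_ex _ hx'l)
    apply hLD.2
    rw [hpe]
    refine ⟨hx', hx'n, hx'l, ?_, ?_⟩
    · rw [hexx]; exact hLD.1
    · intro z hz hpz; rw [hexx]; exact honly z hz hpz
  · have hr := T.ex_ne x hl
    have hpx := T.p_ex x hl
    have ha := T.adj _ hr
    rw [hpx] at ha
    have hc := h.c1 _ hr
    rw [hpx, T.t_q (T.ex_p_ex hl) hel, hpx] at hc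
    have hc' := hφ _ _ ha
    have := h.LD_two_le hLD (φ.map_adj_iff.2 ha.symm)
    rw [Sym2.eq_swap] at this
    have := T.q_le x
    omega

/-- Type 2 vertices are mapped to type 2 vertices. -/
theorem type2_image {φ : G ≃g G} {x x' : V} (hxx : φ x = x') (hx' : x' ≠ T.r)
    (he' : T.ex (T.p x') ≠ x')
    (h1 : ∀ y, T.anc x y → T.anc x' (φ y)) (h2 : ∀ y, T.anc x' y → T.anc x (φ.symm y))
    (hT : T.Type2 x) : T.Type2 x' ∧ φ (T.ex x) = T.ex x' := by
  obtain ⟨hx, he, hl, hel, hall⟩ := hT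
  have hdesc : ∀ w, T.anc x' w → w ≠ x' → w = φ (T.ex x) := by
    intro w hw hne
    have h3 := star_desc hel (h2 w hw) (by
      intro hh; apply hne; rw [← hxx, ← hh, RelIso.apply_symm_apply])
    have := hall _ h3.1 h3.2.1
    rw [← this, RelIso.apply_symm_apply]
  have h4 := h1 _ (T.anc_ex x)
  have h5 : φ (T.ex x) ≠ x' := by
    rw [← hxx]
    intro hh
    have := φ.injective hh
    have := T.d_ex hl
    simp_all
  have hchild : ∀ w, w ≠ T.r → T.p w = x' → w = φ (T.ex x) := by
    intro w hw hp
    apply hdesc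
    · rw [← hp]; exact T.anc_p w
    · rw [← hp]; exact (T.p_ne hw).symm
  have hl' : ¬ T.Leaf x' := fun hh => h5 (hh.anc_eq h4)
  have hex := hchild _ (T.ex_ne _ hl') (T.p_ex _ hl')
  refine ⟨⟨hx', he', hl', ?_, ?_⟩, hex.symm⟩
  · intro w hw hp
    have ha1 : T.anc x' w := by
      have := T.anc_p w; rw [hp] at this; exact T.anc_trans (T.anc_ex x') this
    have hd1 := T.dp w hw
    have hd2 := T.d_ex hl'
    rw [hp] at hd1
    have := hdesc w ha1 (by rintro rfl; omega)
    rw [this, ← hex] at hd1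
    omega
  · intro z hz hp
    rw [hex]; exact hchild z hz hp

/-- `φ` maps the path from `a` to the root to the path from `a'` to the root -/
def RelP (T : CD G) (φ : G ≃g G) (a a' : V) : Prop :=
  T.d a = T.d a' ∧ ∀ i, φ (T.p^[i] a) = T.p^[i] a'

theorem RelP.symm {φ : G ≃g G} {a a' : V} (h : RelP T φ a a') : RelP T φ.symm a' a := by
  refine ⟨h.1.symm, fun i => ?_⟩
  rw [← h.2 i, RelIso.symm_apply_apply]

theorem RelP.eq {φ : G ≃g G} {a a' : V} (h : RelP T φ a a') : φ a = a' := h.2 0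

theorem RelP.desc {φ : G ≃g G} {a a' : V} (h : RelP T φ a a') :
    ∀ y, T.anc a y → T.anc a' (φ y) := by
  apply desc_map
  · rintro z ⟨i, rfl⟩ hne
    rw [h.symm.2 i]
    refine ⟨⟨i, rfl⟩, ?_⟩
    intro hh
    apply hne
    rw [← h.2 i, hh, h.eq]
  · rw [h.eq]; exact T.anc_refl _

theorem RelP.leaf {φ : G ≃g G} {a a' : V} (h : RelP T φ a a') (hl : T.Leaf a) : T.Leaf a' := by
  intro x hx hp
  have h1 : T.anc a' x := by rw [← hp]; exact T.anc_p x
  have := hl.anc_eq (h.symm.desc x h1)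
  have h2 : x = a' := by rw [← h.eq, ← this, RelIso.apply_symm_apply]
  exact T.p_ne hx (by rw [hp, h2])

theorem Good.chain (h : Good T c) {φ : G ≃g G} (hφ : CP c φ) {a a' : V} (hR : RelP T φ a a')
    (ht : ¬ T.Type2 a) : RelP T φ (T.ex a) (T.ex a') := by
  by_cases hl : T.Leaf a
  · rw [T.ex_leaf a hl, T.ex_leaf a' (hR.leaf hl)]; exact hR
  have hl' : ¬ T.Leaf a' := fun hh => hl (hR.symm.leaf hh)
  suffices hs : φ (T.ex a) = T.ex a' by
    refine ⟨by rw [T.d_ex hl, T.d_ex hl', hR.1], ?_⟩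
    intro i
    cases i with
    | zero => exact hs
    | succ i =>
      rw [Function.iterate_succ_apply, Function.iterate_succ_apply, T.p_ex _ hl, T.p_ex _ hl']
      exact hR.2 i
  have hr := T.ex_ne a hl
  have hp := T.p_ex a hl
  have ha := T.adj _ hr
  rw [hp] at ha
  have hcol := hφ _ _ ha
  have hc := h.c1 _ hr
  rw [hp] at hc
  rw [hc, hR.eq] at hcol
  have ha' := φ.map_adj_iff.2 ha
  rw [hR.eq] at ha'
  have hanc := hR.desc _ (T.anc_ex a)
  by_cases hel : T.Leaf (T.ex a)
  · rw [T.t_leaf (T.ex_p_ex hl) (by rwa [hp]) hel] at hcol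
    have hyr : φ (T.ex a) ≠ T.r := by
      intro hh
      rw [hh] at hanc ha'
      exact ha'.ne (T.anc_r_iff hanc).symm
    have hpanc : T.anc a' (T.p (φ (T.ex a))) := by
      rcases T.anc_cases hanc with hh | hh
      · exact absurd hh ha'.ne'
      · exact hh.2
    have hpe : T.p (φ (T.ex a)) = a' := by
      by_contra hpe
      have h3 := star_desc hel (hR.symm.desc _ hpanc) (by
        intro hh; apply hpe; have e := congrArg φ hh
        rwa [RelIso.apply_symm_apply, hR.eq] at e)
      have h4 := φ.symm.map_adj_iff.2 (T.adj _ hyr)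
      rw [RelIso.symm_apply_apply] at h4
      exact leaf_not_adj hel h3.2.2 h4
    rw [← hpe, h.c1 _ hyr] at hcol
    by_contra hne
    rw [T.t_ne] at hcol
    · omega
    · rw [hpe]; exact Ne.symm hne
  · rw [T.t_q (T.ex_p_ex hl) hel] at hcol
    have := T.q_le (T.p (T.ex a))
    exact (h.small ha' hanc (by omega)).2.2

theorem RelP.low_le {φ : G ≃g G} {y y' : V} (h : RelP T φ y y') (hl : T.Leaf y) :
    T.d (T.low y) ≤ T.d (T.low y') ∧ T.d (φ (T.low y)) = T.d (T.low y) ∧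
      T.anc (φ (T.low y)) y' := by
  have hl' := h.leaf hl
  have ha := T.low_adj y hl
  have hanc : T.anc (T.low y) y := by
    rcases T.normal _ _ ha with hh | hh
    · exact absurd (hl.anc_eq hh) ha.ne'
    · exact hh
  obtain ⟨i, hi⟩ := hanc
  have hd : T.d (φ (T.low y)) = T.d (T.low y) := by
    rw [← hi, h.2 i, T.d_iter, T.d_iter, h.1]
  refine ⟨?_, hd, ?_⟩
  · rw [← hd]
    apply T.low_max y' hl'
    · have := φ.map_adj_iff.2 ha
      rwa [h.eq] at this
    · intro hh
      have h1 := h.2 1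
      simp only [Function.iterate_one] at h1
      rw [← h1] at hh
      exact T.low_ne y hl (φ.injective hh)
  · rw [← hi, h.2 i]; exact ⟨i, rfl⟩

theorem Good.fix_step (h : Good T c) {φ : G ≃g G} (hφ : CP c φ) {x : V} (hx : x ≠ T.r)
    (H : ∀ z, T.d z < T.d x → φ z = z) : φ x = x := by
  by_cases he : T.ex (T.p x) = x
  · exact h.fix_exempt hφ hx H he
  obtain ⟨hx', hp, he', h1, h2⟩ := h.image_child hφ hx H he
  obtain ⟨x', hxx⟩ : ∃ x', φ x = x' := ⟨_, rfl⟩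
  rw [hxx] at hx' hp he' h1 h2 ⊢
  have he2 : T.ex (T.p x') ≠ x' := by rwa [hp]
  have hd1 := T.dp x hx
  have hd2 := T.dp x' hx'
  rw [hp] at hd2
  have hv := H (T.p x) (by omega)
  have hal : T.al x = T.al x' := by
    have hcol := hφ _ _ (T.adj x hx)
    rw [hv, hxx, h.c1 x hx, T.t_ne he, ← hp, h.c1 x' hx', T.t_ne he2] at hcol
    omega
  have hcolex : T.Type2 x → T.Type2 x' → φ (T.ex x) = T.ex x' → x' = x := by
    intro t1 t2 hee
    have r1 := T.ex_ne _ t1.2.2.1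
    have r2 := T.ex_ne _ t2.2.2.1
    have p1 := T.p_ex _ t1.2.2.1
    have p2 := T.p_ex _ t2.2.2.1
    have hcol := hφ _ _ (T.adj _ r1)
    have c1 := h.c1 _ r1
    have c2 := h.c1 _ r2
    rw [T.t_two (T.ex_p_ex t1.2.2.1) (by rwa [p1]), p1] at c1
    rw [T.t_two (T.ex_p_ex t2.2.2.1) (by rwa [p2]), p2] at c2
    rw [p1, hee, hxx, c1, c2] at hcol
    refine (T.rank_inj x x' hx hx' he he2 hp.symm hal ?_).symm
    split_ifs at hcol <;> omega
  by_cases t1 : T.Type2 x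
  · obtain ⟨t2, hee⟩ := type2_image hxx hx' he2 h1 h2 t1
    exact hcolex t1 t2 hee
  by_cases t2 : T.Type2 x'
  · have := (type2_image (φ := φ.symm) (x := x') (x' := x)
      (by rw [← hxx, RelIso.symm_apply_apply]) hx he h2 (by simpa using h1) t2).1
    exact absurd this t1
  by_contra hne
  have hR : RelP T φ x x' := by
    refine ⟨by omega, fun i => ?_⟩
    cases i with
    | zero => exact hxx
    | succ i =>
      rw [Function.iterate_succ_apply, Function.iterate_succ_apply, hp]
      apply H
      have := T.d_iter_le (T.p x) i
      omega
  have hch : ∀ n, RelP T φ (T.ex^[n] x) (T.ex^[n] x') ∧ ¬ T.Type2 (T.ex^[n] x) := by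
    intro n
    induction n with
    | zero => exact ⟨hR, t1⟩
    | succ n ih =>
      rw [Function.iterate_succ_apply', Function.iterate_succ_apply']
      exact ⟨h.chain hφ ih.1 ih.2, T.not_type2_ex ih.2⟩
  have hRL : RelP T φ (T.L x) (T.L x') := (hch _).1
  have l1 := hRL.low_le (T.leaf_L x)
  have l2 := hRL.symm.low_le (T.leaf_L x')
  have hanc : T.anc (T.low (T.L x')) (T.L x') := by
    have ha := T.low_adj _ (T.leaf_L x')
    rcases T.normal _ _ ha with hh | hh
    · exact absurd ((T.leaf_L x').anc_eq hh) ha.ne'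
    · exact hh
  have hlow : φ (T.low (T.L x)) = T.low (T.L x') :=
    T.anc_eq_of_d l1.2.2 hanc (by omega)
  apply h.c4 x x' hx hx' he he2 hp.symm hal t1 t2 (Ne.symm hne)
  have := hφ _ _ (T.low_adj _ (T.leaf_L x))
  rw [hlow, hRL.eq] at this
  exact this.symm

theorem Good.distinguishing (h : Good T c) {φ : G ≃g G} (hφ : CP c φ) (x : V) : φ x = x := by
  obtain ⟨n, hn⟩ : ∃ n, T.d x = n := ⟨_, rfl⟩
  induction n using Nat.strong_induction_on generalizing x with
  | _ n ih =>
    by_cases hx : x = T.r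
    · rw [hx]; exact h.fix_root hφ
    · exact h.fix_step hφ hx (fun z hz => ih _ (by omega) z rfl)

end dist


section data
variable {V : Type*} [Fintype V] {G : SimpleGraph V}

open Classical in
/-- non-exempt children -/
noncomputable def CD.NE (T : CD G) (v : V) : Finset V :=
  Finset.univ.filter (fun x => x ≠ T.r ∧ T.p x = v ∧ T.ex v ≠ x)

theorem CD.mem_NE (T : CD G) {v x : V} : x ∈ T.NE v ↔ x ≠ T.r ∧ T.p x = v ∧ T.ex v ≠ x := by
  simp [CD.NE]

/-- indexing of the nonexempt children -/
structure IxD (T : CD G) (s : ℕ) (ix : V → ℕ) : Prop where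
  al_r : T.al T.r < s
  al_eq : ∀ x, x ≠ T.r → T.al x = (T.al (T.p x) + 1 + ix x) % s
  ix_inj : ∀ v, Set.InjOn ix (T.NE v)
  ix_lt : ∀ v, ∀ x ∈ T.NE v, ix x < (T.NE v).card
  rank_eq : ∀ x, T.rank x = ix x / s

theorem exists_index (S : Finset V) :
    ∃ f : V → ℕ, Set.InjOn f S ∧ ∀ x ∈ S, f x < S.card := by
  classical
  refine ⟨fun x => if h : x ∈ S then S.equivFin ⟨x, h⟩ else 0, ?_, ?_⟩
  · intro x hx y hy hxy
    have hx' : x ∈ S := hx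
    have hy' : y ∈ S := hy
    simp only [hx', hy', dif_pos] at hxy
    have := S.equivFin.injective (Fin.ext hxy)
    simpa using this
  · intro x hx
    simp only [hx, dif_pos]
    exact Fin.is_lt _

theorem exists_CD [DecidableRel G.Adj] (hG : G.Connected) (hδ : ∀ v, 2 ≤ G.degree v) (s : ℕ)
    (hs : 0 < s) : ∃ (T : CD G) (ix : V → ℕ), IxD T s ix := by
  classical
  obtain ⟨P, hN⟩ := exists_normal hG
  have hex : ∀ a, ∃ b, (P.Leaf a → b = a) ∧ (¬ P.Leaf a → b ≠ P.r ∧ P.p b = a ∧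
      (P.Leaf b → ∀ x, x ≠ P.r → P.p x = a → P.Leaf x)) := by
    intro a
    by_cases hl : P.Leaf a
    · exact ⟨a, fun _ => rfl, fun h => absurd hl h⟩
    · by_cases h2 : ∃ x, x ≠ P.r ∧ P.p x = a ∧ ¬ P.Leaf x
      · obtain ⟨x, h3, h4, h5⟩ := h2
        exact ⟨x, fun h => absurd h hl, fun _ => ⟨h3, h4, fun h => absurd h h5⟩⟩
      · push Not at h2
        have : ∃ x, x ≠ P.r ∧ P.p x = a := by
          by_contra hh
          push Not at hh
          exact hl hh
        obtain ⟨x, h3, h4⟩ := this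
        exact ⟨x, fun h => absurd h hl, fun _ => ⟨h3, h4, fun _ => h2⟩⟩
  choose ex hex1 hex2 using hex
  have hlow : ∀ y, ∃ w, G.Adj y w ∧ w ≠ P.p y ∧ ∀ w', G.Adj y w' → w' ≠ P.p y → P.d w' ≤ P.d w := by
    intro y
    have hne : ((G.neighborFinset y).erase (P.p y)).Nonempty := by
      rw [← Finset.card_pos]
      have := Finset.pred_card_le_card_erase (s := G.neighborFinset y) (a := P.p y)
      have h2 := hδ y
      rw [← G.card_neighborFinset_eq_degree] at h2
      omega
    obtain ⟨w, hw, hmax⟩ := Finset.exists_max_image _ P.d hne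
    simp only [Finset.mem_erase, mem_neighborFinset] at hw hmax
    exact ⟨w, hw.2, hw.1, fun w' h1 h2 => hmax w' ⟨h2, h1⟩⟩
  choose low hl1 hl2 hl3 using hlow
  have hroot : ¬ P.Leaf P.r := by
    intro h
    have h1 := hl1 P.r
    exact h1.ne' (h.anc_eq (P.anc_r _))
  have hrootch : ∀ x, x ≠ P.r → P.p x = P.r → ¬ P.Leaf x := by
    intro x hx hp hl
    have h1 := hl1 x
    rcases hN _ _ h1 with h2 | h2
    · exact h1.ne' (hl.anc_eq h2)
    · rcases P.anc_cases h2 with h3 | ⟨-, h3⟩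
      · exact h1.ne' h3
      · rw [hp] at h3
        exact hl2 x (by rw [hp]; exact P.anc_r_iff h3)
  let NE : V → Finset V := fun v =>
    Finset.univ.filter (fun x => x ≠ P.r ∧ P.p x = v ∧ ex v ≠ x)
  choose f hf1 hf2 using fun v => exists_index (NE v)
  let ix : V → ℕ := fun x => f (P.p x) x
  obtain ⟨al, hal1, hal2⟩ := P.exists_rec (0 : ℕ) (fun x b => (b + 1 + ix x) % s)
  obtain ⟨q, hq1, hq2⟩ := P.exists_rec (1 : ℕ) (fun x b => if ex (P.p x) = x then 1 - b else 0)
  have hmem : ∀ v x, x ∈ NE v ↔ x ≠ P.r ∧ P.p x = v ∧ ex v ≠ x := by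
    intro v x; simp [NE]
  have hinj : ∀ v, Set.InjOn ix (NE v) := by
    intro v x hx y hy hxy
    have hx' := (hmem v x).1 hx
    have hy' := (hmem v y).1 hy
    simp only [ix] at hxy
    rw [hx'.2.1, hy'.2.1] at hxy
    exact hf1 v hx hy hxy
  refine ⟨{
    toPT := P, normal := hN, ex := ex, ex_leaf := hex1, ex_ne := fun a h => (hex2 a h).1,
    p_ex := fun a h => (hex2 a h).2.1, ex_nl := fun a h => (hex2 a h).2.2,
    low := low, low_adj := fun y _ => hl1 y, low_ne := fun y _ => hl2 y, low_max := fun y _ => hl3 y,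
    root_nl := hroot, root_ch := hrootch, al := al, rank := fun x => ix x / s, q := q,
    rank_inj := ?_, q_r := hq1, q_ex := ?_, q_ne := ?_ }, ix, ?_⟩
  · intro x x' hx hx' he he' hp ha hr
    apply hinj (P.p x)
    · exact (hmem _ _).2 ⟨hx, rfl, he⟩
    · exact (hmem _ _).2 ⟨hx', hp.symm, by rw [hp]; exact he'⟩
    · rw [hal2 x hx, hal2 x' hx', ← hp] at ha
      have h1 : ix x % s = ix x' % s := Nat.ModEq.add_left_cancel' _ ha
      rw [← Nat.div_add_mod (ix x) s, ← Nat.div_add_mod (ix x') s, h1]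
      rw [hr]
  · intro x hx he
    rw [hq2 x hx, if_pos he]
  · intro x hx he
    rw [hq2 x hx, if_neg he]
  · refine ⟨?_, ?_, ?_, ?_, ?_⟩
    · simp only [hal1]; exact hs
    · intro x hx; exact hal2 x hx
    · intro v x hx y hy hxy
      exact hinj v ((hmem _ _).2 ((CD.mem_NE _).1 hx)) ((hmem _ _).2 ((CD.mem_NE _).1 hy)) hxy
    · intro v x hx
      have h1 := (CD.mem_NE _).1 hx
      have h2 := hf2 v x ((hmem _ _).2 h1)
      have h3 : P.p x = v := h1.2.1
      simp only [ix]
      rw [h3]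
      convert h2 using 2
      ext z
      rw [CD.mem_NE, hmem]
    · intro x; rfl

end data


/-- counting lemma: no two consecutive integers -/
theorem count_mod_le (n s β b : ℕ) (hs : 2 ≤ s) :
    2 * ((Finset.range n).filter (fun i => (β + 1 + i) % s = b)).card ≤ n + 1 := by
  set S := (Finset.range n).filter (fun i => (β + 1 + i) % s = b) with hS
  have hd : Disjoint S (S.image Nat.succ) := by
    rw [Finset.disjoint_left]
    intro i hi hi'
    rw [Finset.mem_image] at hi'
    obtain ⟨j, hj, rfl⟩ := hi'
    rw [hS, Finset.mem_filter] at hi hj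
    have h : (β + 1 + j) % s = (β + 1 + j + 1) % s := by
      rw [hj.2]; exact hi.2.symm
    have h2 : 0 ≡ 1 [MOD s] := by
      apply Nat.ModEq.add_left_cancel' (β + 1 + j)
      exact h
    have h3 := (Nat.modEq_iff_dvd' (by omega)).1 h2
    have := Nat.le_of_dvd (by omega) h3
    omega
  have hc := Finset.card_union_of_disjoint hd
  rw [Finset.card_image_of_injective _ Nat.succ_injective] at hc
  have hsub : S ∪ S.image Nat.succ ⊆ Finset.range (n + 1) := by
    intro i hi
    rw [Finset.mem_union, Finset.mem_image] at hi
    rcases hi with hi | ⟨j, hj, rfl⟩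
    · have := Finset.mem_range.1 (Finset.mem_filter.1 hi).1
      exact Finset.mem_range.2 (by omega)
    · have := Finset.mem_range.1 (Finset.mem_filter.1 hj).1
      exact Finset.mem_range.2 (by omega)
  have := Finset.card_le_card hsub
  rw [Finset.card_range] at this
  omega

theorem count_mod_le' (n s β : ℕ) (hs : 2 ≤ s) (hβ : β < s) :
    2 * ((Finset.range n).filter (fun i => (β + 1 + i) % s = β)).card ≤ n := by
  cases n with
  | zero => simp
  | succ n =>
    have h := count_mod_le n s (β + 1) β hs
    have : ((Finset.range (n + 1)).filter (fun i => (β + 1 + i) % s = β)).card ≤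
        ((Finset.range n).filter (fun i => (β + 1 + 1 + i) % s = β)).card := by
      apply Finset.card_le_card_of_injOn Nat.pred
      · intro i hi
        rw [Finset.mem_coe, Finset.mem_filter, Finset.mem_range] at hi
        rw [Finset.mem_coe, Finset.mem_filter, Finset.mem_range]
        have h0 : i ≠ 0 := by
          rintro rfl
          have h2 := hi.2
          by_cases hb : β + 1 + 0 < s
          · rw [Nat.mod_eq_of_lt hb] at h2; omega
          · have : β + 1 + 0 = s := by omega
            rw [this, Nat.mod_self] at h2; omega
        obtain ⟨j, rfl⟩ := Nat.exists_eq_succ_of_ne_zero h0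
        refine ⟨by simp; omega, ?_⟩
        have e1 : β + 1 + 1 + Nat.pred j.succ = β + 1 + j.succ := by
          simp only [Nat.pred_succ]; omega
        rw [e1]; exact hi.2
      · intro i hi j hj hij
        have key : ∀ i, i ∈ (Finset.range (n + 1)).filter (fun i => (β + 1 + i) % s = β) → i ≠ 0 := by
          rintro i hi rfl
          have h2 := (Finset.mem_filter.1 hi).2
          by_cases hb : β + 1 + 0 < s
          · rw [Nat.mod_eq_of_lt hb] at h2; omega
          · have : β + 1 + 0 = s := by omega
            rw [this, Nat.mod_self] at h2; omega
        have := key i hi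
        have := key j hj
        simp only [Nat.pred_eq_sub_one] at hij
        omega
    omega

section greedy
variable {V : Type*} [Fintype V] [DecidableEq V] (G : SimpleGraph V) [DecidableRel G.Adj]

/-- number of coloured edges at `u` of colour `a` -/
def cnt (E : Finset (Sym2 V)) (c : Sym2 V → ℕ) (u : V) (a : ℕ) : ℕ :=
  ((G.neighborFinset u).filter (fun w => s(u, w) ∈ E ∧ c s(u, w) = a)).card

/-- partial majority colouring -/
def PM (E : Finset (Sym2 V)) (c : Sym2 V → ℕ) : Prop :=
  ∀ u a, 2 * cnt G E c u a ≤ G.degree u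

/-- saturated colours -/
def Sat (E : Finset (Sym2 V)) (c : Sym2 V → ℕ) (u : V) (X : Finset ℕ) : Finset ℕ :=
  X.filter (fun a => G.degree u < 2 * (cnt G E c u a + 1))

variable {G}

theorem cnt_update {E : Finset (Sym2 V)} {c : Sym2 V → ℕ} {u w : V}
    (he : s(u, w) ∉ E) (a v b) :
    cnt G (insert s(u, w) E) (Function.update c s(u, w) a) v b ≤
      cnt G E c v b + if (v = u ∨ v = w) ∧ a = b then 1 else 0 := by
  unfold cnt
  split_ifs with h
  · obtain ⟨h1, rfl⟩ := h
    have hsub : (G.neighborFinset v).filter (fun x => s(v, x) ∈ insert s(u, w) E ∧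
        Function.update c s(u, w) a s(v, x) = a) ⊆
        insert (if v = u then w else u)
          ((G.neighborFinset v).filter (fun x => s(v, x) ∈ E ∧ c s(v, x) = a)) := by
      intro x hx
      rw [Finset.mem_filter] at hx
      obtain ⟨hx1, hx2, hx3⟩ := hx
      rw [Finset.mem_insert]
      by_cases hxe : s(v, x) = s(u, w)
      · left
        rw [Sym2.eq_iff] at hxe
        split_ifs with hvu
        · subst hvu
          rcases hxe with h | h
          · exact h.2
          · rw [← h.1, h.2]
        · rcases hxe with h | h
          · exact absurd h.1 hvu
          · exact h.2
      · right
        rw [Function.update_of_ne hxe] at hx3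
        rw [Finset.mem_insert] at hx2
        exact Finset.mem_filter.2 ⟨hx1, hx2.resolve_left hxe, hx3⟩
    exact (Finset.card_le_card hsub).trans (Finset.card_insert_le _ _)
  · rw [add_zero]
    apply Finset.card_le_card
    intro x hx
    rw [Finset.mem_filter] at hx
    obtain ⟨hx1, hx2, hx3⟩ := hx
    have hxe : s(v, x) ≠ s(u, w) := by
      intro hxe
      rw [hxe, Function.update_self] at hx3
      rw [Sym2.eq_iff] at hxe
      exact h ⟨hxe.imp And.left And.left, hx3⟩
    rw [Function.update_of_ne hxe] at hx3
    rw [Finset.mem_insert] at hx2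
    exact Finset.mem_filter.2 ⟨hx1, hx2.resolve_left hxe, hx3⟩

theorem PM.insert {E : Finset (Sym2 V)} {c : Sym2 V → ℕ} (h : PM G E c) {u w : V}
    {X : Finset ℕ} {a : ℕ} (he : s(u, w) ∉ E) (ha : a ∈ X) (hu : a ∉ Sat G E c u X)
    (hw : a ∉ Sat G E c w X) :
    PM G (insert s(u, w) E) (Function.update c s(u, w) a) := by
  intro v b
  have h1 := cnt_update (G := G) (c := c) he a v b
  have h2 := h v b
  simp only [Sat, Finset.mem_filter, not_and, not_lt] at hu hw
  have hu := hu ha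
  have hw := hw ha
  split_ifs at h1 with h3
  · obtain ⟨h4, rfl⟩ := h3
    rcases h4 with rfl | rfl <;> omega
  · omega

theorem sat_card (E : Finset (Sym2 V)) (c : Sym2 V → ℕ) (u : V) (X : Finset ℕ) :
    (Sat G E c u X).card * (G.degree u - 1) ≤
      2 * ((G.neighborFinset u).filter (fun w => s(u, w) ∈ E ∧ c s(u, w) ∈ X)).card ∧
    (2 ≤ G.degree u → (Sat G E c u X).card ≤
      ((G.neighborFinset u).filter (fun w => s(u, w) ∈ E ∧ c s(u, w) ∈ X)).card) := by
  have hm : ((G.neighborFinset u).filter (fun w => s(u, w) ∈ E ∧ c s(u, w) ∈ X)).card =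
      ∑ a ∈ X, cnt G E c u a := by
    rw [Finset.card_eq_sum_card_fiberwise (f := fun w => c s(u, w)) (t := X)]
    · apply Finset.sum_congr rfl
      intro a ha
      unfold cnt
      congr 1
      rw [Finset.filter_filter]
      apply Finset.filter_congr
      intro w _
      constructor
      · rintro ⟨⟨h1, -⟩, h3⟩; exact ⟨h1, h3⟩
      · rintro ⟨h1, h3⟩; exact ⟨⟨h1, by rw [h3]; exact ha⟩, h3⟩
    · intro w hw
      exact (Finset.mem_filter.1 hw).2.2
  have hle : ∑ a ∈ Sat G E c u X, cnt G E c u a ≤ ∑ a ∈ X, cnt G E c u a :=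
    Finset.sum_le_sum_of_subset (Finset.filter_subset _ _)
  rw [hm]
  constructor
  · refine le_trans ?_ (Nat.mul_le_mul_left 2 hle)
    rw [Finset.mul_sum, ← smul_eq_mul]
    apply Finset.card_nsmul_le_sum
    intro a ha
    have := (Finset.mem_filter.1 ha).2
    omega
  · intro hd
    refine le_trans ?_ hle
    have := Finset.card_nsmul_le_sum (Sat G E c u X) (fun a => cnt G E c u a) 1 (by
      intro a ha
      have := (Finset.mem_filter.1 ha).2
      show 1 ≤ _
      omega)
    simpa using this

theorem sat_le_two (hδ : ∀ v, 2 ≤ G.degree v) {E : Finset (Sym2 V)} (c : Sym2 V → ℕ) {u w : V}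
    (X : Finset ℕ) (ha : G.Adj u w) (he : s(u, w) ∉ E) :
    (Sat G E c u X).card ≤ 2 ∧ (G.degree u ≤ 2 → (Sat G E c u X).card ≤ 1) := by
  have h1 := sat_card (G := G) E c u X
  have h2 : ((G.neighborFinset u).filter (fun w => s(u, w) ∈ E ∧ c s(u, w) ∈ X)).card + 1 ≤
      G.degree u := by
    rw [← G.card_neighborFinset_eq_degree]
    apply Finset.card_lt_card
    rw [Finset.filter_ssubset]
    exact ⟨w, by simpa using ha, fun h => he h.1⟩
  have h3 := hδ u
  have h4 := h1.2 h3
  constructor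
  · by_contra hh
    have : 3 * (G.degree u - 1) ≤ (Sat G E c u X).card * (G.degree u - 1) :=
      Nat.mul_le_mul_right _ (by omega)
    omega
  · intro; omega

theorem sat_le_one (hδ : ∀ v, 2 ≤ G.degree v) {E : Finset (Sym2 V)} {c : Sym2 V → ℕ} {u w w' : V}
    {X : Finset ℕ} (ha : G.Adj u w) (he : s(u, w) ∉ E) (ha' : G.Adj u w')
    (he' : ¬ (s(u, w') ∈ E ∧ c s(u, w') ∈ X)) (hne : w ≠ w') :
    (Sat G E c u X).card ≤ 1 := by
  have h1 := sat_card (G := G) E c u X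
  have h2 : ((G.neighborFinset u).filter (fun w => s(u, w) ∈ E ∧ c s(u, w) ∈ X)).card + 2 ≤
      G.degree u := by
    rw [← G.card_neighborFinset_eq_degree]
    have hsub : (G.neighborFinset u).filter (fun w => s(u, w) ∈ E ∧ c s(u, w) ∈ X) ⊆
        ((G.neighborFinset u).erase w).erase w' := by
      intro x hx
      obtain ⟨hx1, hx2⟩ := Finset.mem_filter.1 hx
      rw [Finset.mem_erase, Finset.mem_erase]
      refine ⟨?_, ?_, hx1⟩
      · rintro rfl; exact he' hx2
      · rintro rfl; exact he hx2.1
    have h5 := Finset.card_le_card hsub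
    rw [Finset.card_erase_of_mem, Finset.card_erase_of_mem] at h5
    · have : 2 ≤ (G.neighborFinset u).card := by
        rw [G.card_neighborFinset_eq_degree]; exact hδ u
      omega
    · simpa using ha
    · rw [Finset.mem_erase]; exact ⟨hne.symm, by simpa using ha'⟩
  have h3 := hδ u
  by_contra hh
  have : 2 * (G.degree u - 1) ≤ (Sat G E c u X).card * (G.degree u - 1) :=
    Nat.mul_le_mul_right _ (by omega)
  omega

theorem exists_color {X A B C : Finset ℕ} (h : A.card + B.card + C.card < X.card) :
    ∃ a ∈ X, a ∉ A ∧ a ∉ B ∧ a ∉ C := by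
  by_contra hh
  push Not at hh
  have hsub : X ⊆ A ∪ B ∪ C := by
    intro a ha
    rw [Finset.mem_union, Finset.mem_union]
    by_contra h2
    push Not at h2
    exact h2.2 (hh a ha h2.1.1 h2.1.2)
  have h1 := Finset.card_le_card hsub
  have h2 := Finset.card_union_le (A ∪ B) C
  have h3 := Finset.card_union_le A B
  omega

theorem greedy (E F : Finset (Sym2 V)) (Inv : Finset (Sym2 V) → (Sym2 V → ℕ) → Prop)
    {c0 : Sym2 V → ℕ} (h0 : Inv E c0)
    (step : ∀ e ∈ F, ∀ E' c, E ⊆ E' → E' ⊆ E ∪ F → e ∉ E' → Inv E' c →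
      ∃ a, Inv (insert e E') (Function.update c e a)) : ∃ c, Inv (E ∪ F) c := by
  suffices h : ∀ F' ⊆ F, ∃ c, Inv (E ∪ F') c from h F (Finset.Subset.refl _)
  intro F'
  induction F' using Finset.induction_on with
  | empty => intro _; exact ⟨c0, by simpa using h0⟩
  | insert e F' he ih =>
    intro hsub
    obtain ⟨c, hc⟩ := ih (fun x hx => hsub (Finset.mem_insert_of_mem hx))
    rw [Finset.union_insert]
    by_cases hm : e ∈ E ∪ F'
    · rw [Finset.insert_eq_of_mem hm]; exact ⟨c, hc⟩
    · obtain ⟨a, ha⟩ := step e (hsub (Finset.mem_insert_self _ _)) (E ∪ F') c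
        Finset.subset_union_left (Finset.union_subset_union_right
          (fun x hx => hsub (Finset.mem_insert_of_mem hx))) hm hc
      exact ⟨_, ha⟩

end greedy


section tree
variable {V : Type*} [Fintype V] [DecidableEq V] {G : SimpleGraph V} [DecidableRel G.Adj]
variable {T : CD G}

namespace CD

/-- tree edge -/
def Tr (T : CD G) (e : Sym2 V) : Prop := ∃ x, x ≠ T.r ∧ e = s(x, T.p x)

/-- decider edge -/
def Dc (T : CD G) (e : Sym2 V) : Prop := ∃ y, T.LD y ∧ e = s(y, T.low y)

theorem t_R {x : V} (h : 2 ≤ T.t x) (h' : T.t x ≤ 4) :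
    T.ex (T.p x) = x ∧ T.t x = 2 ∧ T.LD x := by
  by_cases he : T.ex (T.p x) = x
  · by_cases hl : T.Leaf x
    · by_cases h2 : T.Type2 (T.p x)
      · rw [T.t_two he h2] at h h'
        split_ifs at h h' <;> omega
      · exact ⟨he, T.t_leaf he h2 hl, hl, h2⟩
    · rw [T.t_q he hl] at h
      have := T.q_le (T.p x)
      omega
  · rw [T.t_ne he] at h'; omega

theorem anc_of_adj_leaf {y w : V} (h : T.Leaf y) (ha : G.Adj y w) : T.anc w y := by
  rcases T.normal _ _ ha with hh | hh
  · exact absurd (h.anc_eq hh) ha.ne'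
  · exact hh

theorem back_not_tree {u w : V} (_ha : G.Adj u w) (hw : T.anc w u) (hp : w ≠ T.p u) :
    ¬ T.Tr s(u, w) := by
  rintro ⟨x, hx, he⟩
  rw [Sym2.eq_iff] at he
  rcases he with ⟨rfl, h⟩ | ⟨h, rfl⟩
  · exact hp h
  · rw [h] at hw; exact T.not_anc_p hx hw

theorem orient {e : Sym2 V} (he : e ∈ G.edgeSet) (hT : ¬ T.Tr e) :
    ∃ u w, e = s(u, w) ∧ G.Adj u w ∧ T.anc w u ∧ w ≠ T.p u := by
  have key : ∀ u w, G.Adj u w → T.anc w u → ¬ T.Tr s(u, w) → w ≠ T.p u := by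
    rintro u w ha hw hT rfl
    by_cases hu : u = T.r
    · subst hu; rw [T.pr] at ha; exact ha.ne rfl
    · exact hT ⟨u, hu, rfl⟩
  induction e using Sym2.ind with
  | _ u w =>
    have ha : G.Adj u w := he
    rcases T.normal _ _ ha with h | h
    · refine ⟨w, u, Sym2.eq_swap, ha.symm, h, key w u ha.symm h ?_⟩
      rwa [Sym2.eq_swap]
    · exact ⟨u, w, rfl, ha, h, key u w ha h hT⟩

theorem tr_inj {x x' : V} (hx : x ≠ T.r) (hx' : x' ≠ T.r) (h : s(x, T.p x) = s(x', T.p x')) :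
    x = x' := by
  rw [Sym2.eq_iff] at h
  rcases h with h | ⟨h1, h2⟩
  · exact h.1
  · have d1 := T.dp x hx
    have d2 := T.dp x' hx'
    rw [h2] at d1
    rw [← h1] at d2
    omega

theorem dec_inj {y y' : V} (hy : T.Leaf y) (hy' : T.Leaf y')
    (h : s(y, T.low y) = s(y', T.low y')) : y = y' := by
  rw [Sym2.eq_iff] at h
  rcases h with h | ⟨h1, h2⟩
  · exact h.1
  · have ha := T.low_adj y hy
    rw [h2] at ha
    exact absurd ha (leaf_not_adj hy hy')

theorem chain_exempt (x : V) (n : ℕ) : ∀ w, T.anc w (T.ex^[n] x) → T.anc x w → w ≠ x →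
    T.ex (T.p w) = w := by
  induction n with
  | zero =>
    intro w h1 h2 hne
    exact absurd (T.anc_antisymm h1 h2) hne
  | succ n ih =>
    intro w h1 h2 hne
    rw [Function.iterate_succ_apply'] at h1
    by_cases hl : T.Leaf (T.ex^[n] x)
    · rw [T.ex_leaf _ hl] at h1; exact ih w h1 h2 hne
    · rcases T.anc_cases h1 with rfl | ⟨-, h3⟩
      · exact T.ex_p_ex hl
      · rw [T.p_ex _ hl] at h3; exact ih w h3 h2 hne

theorem anc_iter_ex (x : V) (n : ℕ) : T.anc x (T.ex^[n] x) := by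
  induction n with
  | zero => exact T.anc_refl _
  | succ n ih =>
    rw [Function.iterate_succ_apply']; exact T.anc_trans ih (T.anc_ex _)

theorem L_inj {x x' : V} (he : T.ex (T.p x) ≠ x) (he' : T.ex (T.p x') ≠ x')
    (h : T.L x = T.L x') : x = x' := by
  by_contra hne
  have h1 : T.anc x (T.L x) := anc_iter_ex x _
  have h2 : T.anc x' (T.L x') := anc_iter_ex x' _
  have h3 := h2
  rw [← h] at h3
  rcases T.anc_total h1 h3 with h4 | h4
  · exact he' (chain_exempt x _ x' h3 h4 (Ne.symm hne))
  · rw [h] at h1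
    exact he (chain_exempt x' _ x h1 h4 hne)

theorem LD_L {x : V} (hx : x ≠ T.r) (he : T.ex (T.p x) ≠ x) (h2 : ¬ T.Type2 x) :
    T.LD (T.L x) := by
  refine ⟨T.leaf_L x, ?_⟩
  have key : ∀ n, ¬ T.Type2 (T.ex^[n] x) ∧ ¬ T.Type2 (T.p (T.ex^[n] x)) := by
    intro n
    induction n with
    | zero => exact ⟨h2, fun h => he (h.2.2.2.2 x hx rfl).symm⟩
    | succ n ih =>
      rw [Function.iterate_succ_apply']
      refine ⟨T.not_type2_ex ih.1, ?_⟩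
      by_cases hl : T.Leaf (T.ex^[n] x)
      · rw [T.ex_leaf _ hl]; exact ih.2
      · rw [T.p_ex _ hl]; exact ih.1
  exact (key _).2

theorem t_ne_t_ex {u : V} (hu : u ≠ T.r) (hl : ¬ T.Leaf u) : T.t u ≠ T.t (T.ex u) := by
  have hp := T.p_ex u hl
  have hxx := T.ex_p_ex hl
  by_cases hel : T.Leaf (T.ex u)
  · by_cases h2 : T.Type2 u
    · rw [T.t_two hxx (by rwa [hp]), hp, T.t_ne h2.2.1]
      split_ifs <;> omega
    · rw [T.t_leaf hxx (by rwa [hp]) hel]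
      intro h
      exact hl (T.t_R (by omega) (by omega)).2.2.1
  · rw [T.t_q hxx hel, hp]
    have := T.q_le u
    by_cases he : T.ex (T.p u) = u
    · rw [T.t_q he hl, T.q_ex u hu he]; omega
    · rw [T.t_ne he]; omega

/-- siblings with the same colour -/
def Sib (T : CD G) (x x' : V) : Prop :=
  x ≠ T.r ∧ x' ≠ T.r ∧ T.ex (T.p x) ≠ x ∧ T.ex (T.p x') ≠ x' ∧ T.p x = T.p x' ∧
    T.al x = T.al x' ∧ ¬ T.Type2 x ∧ ¬ T.Type2 x' ∧ x ≠ x'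

theorem Sib.symm {x x' : V} (h : T.Sib x x') : T.Sib x' x := by
  obtain ⟨h1, h2, h3, h4, h5, h6, h7, h8, h9⟩ := h
  exact ⟨h2, h1, h4, h3, h5.symm, h6.symm, h8, h7, h9.symm⟩

/-- decider edge of the chain starting in `x` -/
def dec (T : CD G) (x : V) : Sym2 V := s(T.L x, T.low (T.L x))

end CD

open CD

/-- the invariant of the construction -/
structure ColInv (T : CD G) (s : ℕ) (E : Finset (Sym2 V)) (c : Sym2 V → ℕ) : Prop where
  tree : ∀ x, x ≠ T.r → s(x, T.p x) ∈ E ∧ c s(x, T.p x) = T.t x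
  pm : PM G E c
  bd : ∀ e ∈ E, c e < s + 5
  b2 : ∀ u w, G.Adj u w → T.anc w u → w ≠ T.p u → s(u, w) ∈ E →
    (2 ≤ c s(u, w) ∧ c s(u, w) ≤ 4) ∨ (T.LD u ∧ w = T.low u ∧ 2 ≤ c s(u, w))
  b3 : ∀ w, G.Adj T.r w → s(T.r, w) ∈ E → c s(T.r, w) ≠ 2
  b4 : ∀ x x', T.Sib x x' → T.dec x ∈ E → T.dec x' ∈ E → c (T.dec x) ≠ c (T.dec x')

theorem ColInv.insert {s : ℕ} {E : Finset (Sym2 V)} {c : Sym2 V → ℕ} (h : ColInv T s E c) {u w : V}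
    (ha : G.Adj u w) (hw : T.anc w u) (hp : w ≠ T.p u) (he : s(u, w) ∉ E) {X : Finset ℕ} {a : ℕ}
    (haX : a ∈ X) (hsu : a ∉ Sat G E c u X) (hsw : a ∉ Sat G E c w X) (hlt : a < s + 5)
    (hcol : (2 ≤ a ∧ a ≤ 4) ∨ (T.LD u ∧ w = T.low u ∧ 2 ≤ a)) (hr : w = T.r → a ≠ 2)
    (hs : ∀ x x', T.Sib x x' → T.dec x = s(u, w) → T.dec x' ∈ E → c (T.dec x') ≠ a) :
    ColInv T s (insert s(u, w) E) (Function.update c s(u, w) a) := by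
  refine ⟨?_, h.pm.insert he haX hsu hsw, ?_, ?_, ?_, ?_⟩
  · intro x hx
    obtain ⟨h1, h2⟩ := h.tree x hx
    refine ⟨Finset.mem_insert_of_mem h1, ?_⟩
    rw [Function.update_of_ne, h2]
    intro hh; rw [hh] at h1; exact he h1
  · intro e hem
    by_cases hee : e = s(u, w)
    · rw [hee, Function.update_self]; exact hlt
    · rw [Function.update_of_ne hee]
      exact h.bd e ((Finset.mem_insert.1 hem).resolve_left hee)
  · intro u' w' ha' hw' hp' hem
    by_cases hee : s(u', w') = s(u, w)
    · rw [hee, Function.update_self]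
      rw [Sym2.eq_iff] at hee
      rcases hee with ⟨rfl, rfl⟩ | ⟨rfl, rfl⟩
      · exact hcol
      · exact absurd (T.anc_antisymm hw hw') ha'.ne
    · rw [Function.update_of_ne hee]
      exact h.b2 _ _ ha' hw' hp' ((Finset.mem_insert.1 hem).resolve_left hee)
  · intro w' ha' hem
    by_cases hee : s(T.r, w') = s(u, w)
    · rw [hee, Function.update_self]
      apply hr
      rw [Sym2.eq_iff] at hee
      rcases hee with ⟨rfl, rfl⟩ | ⟨rfl, rfl⟩
      · exact T.anc_r_iff hw
      · rfl
    · rw [Function.update_of_ne hee]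
      exact h.b3 _ ha' ((Finset.mem_insert.1 hem).resolve_left hee)
  · intro x x' hS h1 h2
    have hinj : T.dec x ≠ T.dec x' := by
      intro hh
      exact hS.2.2.2.2.2.2.2.2 (L_inj hS.2.2.1 hS.2.2.2.1 (dec_inj (T.leaf_L x) (T.leaf_L x') hh))
    by_cases e1 : T.dec x = s(u, w)
    · have e2 : T.dec x' ≠ s(u, w) := fun hh => hinj (e1.trans hh.symm)
      rw [Function.update_of_ne e2, e1, Function.update_self]
      exact (hs x x' hS e1 ((Finset.mem_insert.1 h2).resolve_left e2)).symm
    · rw [Function.update_of_ne e1]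
      have h1' := (Finset.mem_insert.1 h1).resolve_left e1
      by_cases e2 : T.dec x' = s(u, w)
      · rw [e2, Function.update_self]
        exact hs x' x hS.symm e2 h1'
      · rw [Function.update_of_ne e2]
        exact h.b4 x x' hS h1' ((Finset.mem_insert.1 h2).resolve_left e2)

/-- phase 1 step -/
theorem phase1 (hδ : ∀ v, 2 ≤ G.degree v) {s : ℕ} {E : Finset (Sym2 V)} {c : Sym2 V → ℕ}
    (hsub : ∀ e ∈ E, T.Tr e ∨ T.r ∈ e) (h : ColInv T s E c) {e : Sym2 V} (heG : e ∈ G.edgeSet)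
    (heT : ¬ T.Tr e) (heD : ¬ T.Dc e) (her : T.r ∈ e) (heE : e ∉ E) :
    ∃ a, ColInv T s (insert e E) (Function.update c e a) := by
  obtain ⟨u, w, rfl, ha, hw, hp⟩ := orient heG heT
  have hwr : w = T.r := by
    rcases Sym2.mem_iff.1 her with hh | hh
    · rw [← hh] at hw; exact T.anc_r_iff hw
    · exact hh.symm
  subst hwr
  have hre := T.ex_ne _ T.root_nl
  have hrp := T.p_ex _ T.root_nl
  have s1 : (Sat G E c T.r {3, 4}).card ≤ 1 := by
    apply sat_le_one hδ ha.symm (by rwa [Sym2.eq_swap]) (w' := T.ex T.r)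
    · have := T.adj _ hre; rw [hrp] at this; exact this.symm
    · intro hh
      have := (h.tree _ hre).2
      rw [hrp, Sym2.eq_swap] at this
      rw [this, T.t_q (T.ex_p_ex T.root_nl) (T.root_ch _ hre hrp), hrp, T.q_r] at hh
      simp at hh
    · rintro rfl; exact hp hrp.symm
  have s2 : (Sat G E c u {3, 4}).card ≤ 0 := by
    have := (sat_card (G := G) E c u {3, 4}).2 (hδ u)
    refine this.trans (le_of_eq ?_)
    rw [Finset.card_eq_zero, Finset.filter_eq_empty_iff]
    rintro x hx ⟨hx1, hx2⟩
    rcases hsub _ hx1 with ⟨z, hz, hze⟩ | hh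
    · rw [hze, (h.tree z hz).2] at hx2
      simp only [Finset.mem_insert, Finset.mem_singleton] at hx2
      have := (T.t_R (x := z) (by omega) (by omega)).2.1
      omega
    · rcases Sym2.mem_iff.1 hh with hh | hh
      · exact ha.ne hh.symm
      · rw [← hh] at hx1; exact heE hx1
  obtain ⟨a, h1, h2, h3, -⟩ := exists_color (X := {3, 4}) (A := Sat G E c u {3, 4})
    (B := Sat G E c T.r {3, 4}) (C := ∅) (by
      have : ({3, 4} : Finset ℕ).card = 2 := rfl
      rw [this, Finset.card_empty]; omega)
  have h1' := h1
  simp only [Finset.mem_insert, Finset.mem_singleton] at h1'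
  refine ⟨a, h.insert ha hw hp heE h1 h2 h3 (by omega) (Or.inl (by omega)) (by omega) ?_⟩
  intro x x' hS hd
  exact absurd ⟨_, LD_L hS.1 hS.2.2.1 hS.2.2.2.2.2.2.1, hd.symm⟩ heD

/-- phase 2 step -/
theorem phase2 (hδ : ∀ v, 2 ≤ G.degree v) {s : ℕ} {E : Finset (Sym2 V)} {c : Sym2 V → ℕ}
    (hsub : ∀ e ∈ E, T.Dc e → T.Tr e) (h : ColInv T s E c) {e : Sym2 V} (heG : e ∈ G.edgeSet)
    (heT : ¬ T.Tr e) (heD : ¬ T.Dc e) (her : T.r ∉ e) (heE : e ∉ E) :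
    ∃ a, ColInv T s (insert e E) (Function.update c e a) := by
  obtain ⟨u, w, rfl, ha, hw, hp⟩ := orient heG heT
  have hur : u ≠ T.r := by rintro rfl; exact her (Sym2.mem_mk_left _ _)
  have hwr : w ≠ T.r := by rintro rfl; exact her (Sym2.mem_mk_right _ _)
  have s1 : (Sat G E c w (Finset.Icc 2 4)).card ≤ 1 := by
    apply sat_le_one hδ ha.symm (by rwa [Sym2.eq_swap]) (T.adj w hwr)
    · intro hh
      rw [(h.tree w hwr).2, Finset.mem_Icc] at hh
      have := (T.t_R hh.2.1 hh.2.2).2.2.1.anc_eq hw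
      exact ha.ne this
    · rintro rfl
      exact T.not_anc_p hwr hw
  have s2 : (Sat G E c u (Finset.Icc 2 4)).card ≤ 1 := by
    by_cases ht : T.t u ∈ Finset.Icc 2 4
    · rw [Finset.mem_Icc] at ht
      have hLD := (T.t_R ht.1 ht.2).2.2
      apply sat_le_one hδ ha heE (T.low_adj u hLD.1)
      · intro hh
        exact back_not_tree (T.low_adj u hLD.1) (anc_of_adj_leaf hLD.1 (T.low_adj u hLD.1))
          (T.low_ne u hLD.1) (hsub _ hh.1 ⟨u, hLD, rfl⟩)
      · rintro rfl
        exact heD ⟨u, hLD, rfl⟩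
    · apply sat_le_one hδ ha heE (T.adj u hur) _ hp
      intro hh
      rw [(h.tree u hur).2] at hh
      exact ht hh.2
  obtain ⟨a, h1, h2, h3, -⟩ := exists_color (X := Finset.Icc 2 4)
    (A := Sat G E c u (Finset.Icc 2 4)) (B := Sat G E c w (Finset.Icc 2 4)) (C := ∅) (by
      rw [Nat.card_Icc, Finset.card_empty]; omega)
  have h1' := Finset.mem_Icc.1 h1
  refine ⟨a, h.insert ha hw hp heE h1 h2 h3 (by omega) (Or.inl h1') (fun hh => absurd hh hwr) ?_⟩
  intro x x' hS hd
  exact absurd ⟨_, LD_L hS.1 hS.2.2.1 hS.2.2.2.2.2.2.1, hd.symm⟩ heD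

open Classical in
theorem sib_card {s : ℕ} (hrank : ∀ x, x ≠ T.r → T.ex (T.p x) ≠ x → T.rank x < s) (e : Sym2 V)
    (_hs : 0 < s) :
    (Finset.univ.filter (fun x' => ∃ x, T.Sib x x' ∧ T.dec x = e)).card ≤ s - 1 := by
  by_cases hz : ∃ z x', T.Sib z x' ∧ T.dec z = e
  · obtain ⟨z, x0, hz0, hze⟩ := hz
    have key : ∀ x x', T.Sib x x' → T.dec x = e → x = z := by
      intro x x' hS hd
      exact L_inj hS.2.2.1 hz0.2.2.1 (dec_inj (T.leaf_L x) (T.leaf_L z) (hd.trans hze.symm))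
    have hc : ((Finset.range s).erase (T.rank z)).card = s - 1 := by
      rw [Finset.card_erase_of_mem, Finset.card_range]
      exact Finset.mem_range.2 (hrank z hz0.1 hz0.2.2.1)
    rw [← hc]
    apply Finset.card_le_card_of_injOn T.rank
    · intro x' hx'
      rw [Finset.mem_coe, Finset.mem_filter] at hx'
      obtain ⟨-, x, hS, hd⟩ := hx'
      have := key x x' hS hd
      subst this
      rw [Finset.mem_coe, Finset.mem_erase, Finset.mem_range]
      refine ⟨?_, hrank x' hS.2.1 hS.2.2.2.1⟩
      obtain ⟨q1, q2, q3, q4, q5, q6, q7, q8, q9⟩ := hS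
      intro hh
      exact q9 (T.rank_inj x x' q1 q2 q3 q4 q5 q6 hh.symm)
    · intro x' hx' x'' hx'' hr
      rw [Finset.mem_coe, Finset.mem_filter] at hx' hx''
      obtain ⟨-, x, hS, hd⟩ := hx'
      obtain ⟨-, y, hS', hd'⟩ := hx''
      have e1 := key x x' hS hd
      have e2 := key y x'' hS' hd'
      subst e1
      subst e2
      exact T.rank_inj x' x'' hS.2.1 hS'.2.1 hS.2.2.2.1 hS'.2.2.2.1
        (hS.2.2.2.2.1.symm.trans hS'.2.2.2.2.1) (hS.2.2.2.2.2.1.symm.trans hS'.2.2.2.2.2.1) hr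
  · push Not at hz
    rw [Finset.card_eq_zero.2]
    · omega
    · rw [Finset.filter_eq_empty_iff]
      rintro x' - ⟨x, h1, h2⟩
      exact hz x x' h1 h2

open Classical in
/-- phase 3 step -/
theorem phase3 (hδ : ∀ v, 2 ≤ G.degree v) {s : ℕ} (hs : 0 < s)
    (hrank : ∀ x, x ≠ T.r → T.ex (T.p x) ≠ x → T.rank x < s)
    {E : Finset (Sym2 V)} {c : Sym2 V → ℕ} (h : ColInv T s E c) {e : Sym2 V}
    (heD : T.Dc e) (heE : e ∉ E) :
    ∃ a, ColInv T s (insert e E) (Function.update c e a) := by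
  obtain ⟨y, hLD, rfl⟩ := heD
  have ha := T.low_adj y hLD.1
  have hw := anc_of_adj_leaf hLD.1 ha
  have hp := T.low_ne y hLD.1
  obtain ⟨f, hf⟩ : ∃ f, T.low y = f := ⟨_, rfl⟩
  have hcol : ∀ a, 2 ≤ a → (2 ≤ a ∧ a ≤ 4) ∨ (T.LD y ∧ f = T.low y ∧ 2 ≤ a) :=
    fun a ha => Or.inr ⟨hLD, hf.symm, ha⟩
  have hmax := T.low_max y hLD.1
  rw [hf] at ha hw hp heE hmax ⊢
  set X := Finset.Icc 2 (s + 4) with hX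
  have s1 : (Sat G E c f X).card ≤ 1 := by
    obtain ⟨g, hg, hpg, hgy⟩ := T.exists_child hw ha.ne'
    have hfl : ¬ T.Leaf f := by rw [← hpg]; exact T.not_leaf_p hg
    have hgl : ¬ T.Leaf g := by
      intro hh
      have := hh.anc_eq hgy
      rw [this] at hp
      exact hp hpg.symm
    have hel : ¬ T.Leaf (T.ex f) := fun hh => hgl (T.ex_nl f hfl hh g hg hpg)
    have hpe := T.p_ex f hfl
    have hre := T.ex_ne f hfl
    apply sat_le_one hδ ha.symm (by rwa [Sym2.eq_swap]) (w' := T.ex f)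
    · have := T.adj _ hre; rw [hpe] at this; exact this.symm
    · intro hh
      have := (h.tree _ hre).2
      rw [hpe, Sym2.eq_swap] at this
      rw [this, T.t_q (T.ex_p_ex hfl) hel, hX, Finset.mem_Icc] at hh
      have := T.q_le (T.p (T.ex f))
      omega
    · rintro rfl; exact hel hLD.1
  have s2 := sat_le_two hδ c X ha heE
  have hdeg : f = T.r → G.degree y ≤ 2 := by
    rintro rfl
    rw [← G.card_neighborFinset_eq_degree]
    have : G.neighborFinset y ⊆ {T.p y, T.r} := by
      intro w hw
      rw [mem_neighborFinset] at hw
      rw [Finset.mem_insert, Finset.mem_singleton]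
      by_cases hwp : w = T.p y
      · exact Or.inl hwp
      · right
        have := hmax w hw hwp
        rw [T.dr] at this
        exact T.eq_r_of_d (by omega)
    exact (Finset.card_le_card this).trans Finset.card_le_two
  have hsib := sib_card hrank s(y, f) hs
  set B := (Finset.univ.filter (fun x' => ∃ x, T.Sib x x' ∧ T.dec x = s(y, f))).image
    (fun x' => c (T.dec x')) with hB
  have hBc : B.card ≤ s - 1 := Finset.card_image_le.trans hsib
  set B' : Finset ℕ := if f = T.r then {2} else ∅ with hB'
  have hBB : (B ∪ B').card ≤ s - 1 + (if f = T.r then 1 else 0) := by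
    refine (Finset.card_union_le _ _).trans ?_
    have : B'.card = if f = T.r then 1 else 0 := by rw [hB']; split_ifs <;> rfl
    omega
  obtain ⟨a, h1, h2, h3, h4⟩ := exists_color (X := X) (A := Sat G E c y X) (B := Sat G E c f X)
    (C := B ∪ B') (by
      rw [hX, Nat.card_Icc, ← hX]
      split_ifs at hBB with hfr
      · have := s2.2 (hdeg hfr)
        omega
      · omega)
  have h1' := Finset.mem_Icc.1 h1
  rw [Finset.mem_union, not_or] at h4
  refine ⟨a, h.insert ha hw hp heE h1 h2 h3 (by omega) (hcol a h1'.1) ?_ ?_⟩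
  · intro hfr ha2
    apply h4.2
    rw [hB', if_pos hfr, ha2]
    exact Finset.mem_singleton_self _
  · intro x x' hS hd _ hcc
    apply h4.1
    rw [hB, Finset.mem_image]
    exact ⟨x', Finset.mem_filter.2 ⟨Finset.mem_univ _, x, hS, hd⟩, hcc⟩

open Classical in
theorem tree_pm (hδ : ∀ v, 2 ≤ G.degree v) {s : ℕ} (hs : 2 ≤ s) {ix : V → ℕ} (hI : IxD T s ix)
    {c : Sym2 V → ℕ} (hc : ∀ x, x ≠ T.r → c s(x, T.p x) = T.t x) :
    PM G (G.edgeFinset.filter (fun e => T.Tr e)) c := by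
  intro u a
  set K := (T.NE u).filter (fun x => 5 + T.al x = a) with hK
  set A : Finset V := if u ≠ T.r ∧ T.t u = a then {T.p u} else ∅ with hA
  set B : Finset V := if ¬ T.Leaf u ∧ T.t (T.ex u) = a then {T.ex u} else ∅ with hB
  have hsub : (G.neighborFinset u).filter (fun w => s(u, w) ∈ G.edgeFinset.filter (fun e => T.Tr e)
      ∧ c s(u, w) = a) ⊆ A ∪ B ∪ K := by
    intro w hw
    obtain ⟨-, h1, h2⟩ := Finset.mem_filter.1 hw
    obtain ⟨-, x, hx, he⟩ := Finset.mem_filter.1 h1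
    rw [he, hc x hx] at h2
    rw [Finset.mem_union, Finset.mem_union]
    rw [Sym2.eq_iff] at he
    rcases he with ⟨rfl, rfl⟩ | ⟨rfl, rfl⟩
    · left; left
      rw [hA, if_pos ⟨hx, h2⟩]
      exact Finset.mem_singleton_self _
    · by_cases hex : T.ex (T.p w) = w
      · left; right
        rw [hB, if_pos ⟨T.not_leaf_p hx, by rw [hex]; exact h2⟩, hex]
        exact Finset.mem_singleton_self _
      · right
        rw [hK, Finset.mem_filter]
        rw [T.t_ne hex] at h2
        exact ⟨(CD.mem_NE T).2 ⟨hx, rfl, hex⟩, h2⟩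
  have hcnt : cnt G (G.edgeFinset.filter (fun e => T.Tr e)) c u a ≤ A.card + B.card + K.card := by
    unfold cnt
    have h1 := Finset.card_le_card hsub
    have h2 := Finset.card_union_le (A ∪ B) K
    have h3 := Finset.card_union_le A B
    omega
  have hAc : A.card = if u ≠ T.r ∧ T.t u = a then 1 else 0 := by rw [hA]; split_ifs <;> rfl
  have hBc : B.card = if ¬ T.Leaf u ∧ T.t (T.ex u) = a then 1 else 0 := by
    rw [hB]; split_ifs <;> rfl
  -- the count of the class
  have halu : T.al u < s := by
    by_cases hu : u = T.r
    · rw [hu]; exact hI.al_r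
    · rw [hI.al_eq u hu]; exact Nat.mod_lt _ (by omega)
  have hKle : ∀ b, a = 5 + b → K.card ≤ ((Finset.range (T.NE u).card).filter
      (fun i => (T.al u + 1 + i) % s = b)).card := by
    intro b hb
    apply Finset.card_le_card_of_injOn ix
    · intro x hx
      obtain ⟨h1, h2⟩ := Finset.mem_filter.1 hx
      rw [Finset.mem_coe, Finset.mem_filter, Finset.mem_range]
      refine ⟨hI.ix_lt u x h1, ?_⟩
      have h3 := (CD.mem_NE T).1 h1
      have h4 := hI.al_eq x h3.1
      rw [h3.2.1] at h4
      omega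
    · intro x hx y hy hxy
      exact hI.ix_inj u (Finset.mem_filter.1 hx).1 (Finset.mem_filter.1 hy).1 hxy
  have hK0 : a < 5 → K.card = 0 := by
    intro ha
    rw [Finset.card_eq_zero, hK, Finset.filter_eq_empty_iff]
    intro x _; omega
  have hKn : 2 * K.card ≤ (T.NE u).card + 1 := by
    by_cases ha : a < 5
    · rw [hK0 ha]; omega
    · have h1 := hKle (a - 5) (by omega)
      have h2 := count_mod_le (T.NE u).card s (T.al u) (a - 5) hs
      omega
  have hKal : a = 5 + T.al u → 2 * K.card ≤ (T.NE u).card := by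
    intro ha
    have h1 := hKle _ ha
    have h2 := count_mod_le' (T.NE u).card s (T.al u) hs halu
    omega
  have hd := hδ u
  by_cases hl : T.Leaf u
  · have hNE : T.NE u = ∅ := by
      rw [Finset.eq_empty_iff_forall_notMem]
      intro x hx
      have h3 := (CD.mem_NE T).1 hx
      exact hl x h3.1 h3.2.1
    have hK' : K.card = 0 := by rw [hK, hNE]; rfl
    rw [if_neg (fun h => h.1 hl)] at hBc
    split_ifs at hAc <;> omega
  have hexmem : T.ex u ∈ G.neighborFinset u := by
    rw [mem_neighborFinset]
    have := T.adj _ (T.ex_ne u hl)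
    rw [T.p_ex u hl] at this; exact this.symm
  have hNEsub : T.NE u ⊆ G.neighborFinset u := by
    intro x hx
    have h3 := (CD.mem_NE T).1 hx
    rw [mem_neighborFinset]
    have := T.adj _ h3.1
    rw [h3.2.1] at this; exact this.symm
  have hexn : T.ex u ∉ T.NE u := fun hh => ((CD.mem_NE T).1 hh).2.2 rfl
  by_cases hu : u = T.r
  · have hdn : (T.NE u).card + 1 ≤ G.degree u := by
      rw [← G.card_neighborFinset_eq_degree, ← Finset.card_insert_of_notMem hexn]
      exact Finset.card_le_card (Finset.insert_subset hexmem hNEsub)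
    rw [if_neg (fun h => h.1 hu)] at hAc
    by_cases ha : a < 5
    · have := hK0 ha
      split_ifs at hBc <;> omega
    · have : ¬ (T.t (T.ex u) = a) := by
        have hre := T.ex_ne u hl
        have hrp := T.p_ex u hl
        rw [T.t_q (T.ex_p_ex hl) (T.root_ch _ hre (by rw [hrp, hu]))]
        have := T.q_le (T.p (T.ex u))
        omega
      rw [if_neg (fun h => this h.2)] at hBc
      omega
  · have hdn : (T.NE u).card + 2 ≤ G.degree u := by
      have hpn : T.p u ∉ insert (T.ex u) (T.NE u) := by
        have hdu := T.dp u hu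
        rw [Finset.mem_insert]
        rintro (hh | hh)
        · have := T.d_ex hl
          rw [← hh] at this; omega
        · have h3 := (CD.mem_NE T).1 hh
          have := T.dp _ h3.1
          rw [h3.2.1] at this
          omega
      have hpm : T.p u ∈ G.neighborFinset u := by
        rw [mem_neighborFinset]; exact T.adj u hu
      have h1 := Finset.card_le_card
        (Finset.insert_subset hpm (Finset.insert_subset hexmem hNEsub))
      rw [Finset.card_insert_of_notMem hpn, Finset.card_insert_of_notMem hexn,
        G.card_neighborFinset_eq_degree] at h1
      omega
    have hne := t_ne_t_ex hu hl
    by_cases ha : a < 5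
    · have := hK0 ha
      split_ifs at hAc hBc <;> omega
    · by_cases h1 : T.t u = a
      · rw [if_neg (fun h => hne (h1.trans h.2.symm))] at hBc
        rw [if_pos ⟨hu, h1⟩] at hAc
        have hal : a = 5 + T.al u := by
          by_cases he : T.ex (T.p u) = u
          · rw [T.t_q he hl] at h1
            have := T.q_le (T.p u); omega
          · rw [T.t_ne he] at h1; exact h1.symm
        have := hKal hal
        omega
      · rw [if_neg (fun h => h1 h.2)] at hAc
        by_cases h2 : T.t (T.ex u) = a
        · have hT2 : T.Type2 u := by
            by_contra hT2
            by_cases hel : T.Leaf (T.ex u)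
            · rw [T.t_leaf (T.ex_p_ex hl) (by rwa [T.p_ex u hl]) hel] at h2; omega
            · rw [T.t_q (T.ex_p_ex hl) hel] at h2
              have := T.q_le (T.p (T.ex u)); omega
          have hNE : T.NE u = ∅ := by
            rw [Finset.eq_empty_iff_forall_notMem]
            intro x hx
            have h3 := (CD.mem_NE T).1 hx
            exact h3.2.2 (hT2.2.2.2.2 x h3.1 h3.2.1).symm
          have hK' : K.card = 0 := by rw [hK, hNE]; rfl
          split_ifs at hBc <;> omega
        · rw [if_neg (fun h => h2 h.2)] at hBc
          omega

theorem rank_lt {s : ℕ} {ix : V → ℕ} (hI : IxD T s ix) (hΔ : ∀ v, G.degree v ≤ s ^ 2)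
    {x : V} (hx : x ≠ T.r) (he : T.ex (T.p x) ≠ x) : T.rank x < s := by
  have hm : x ∈ T.NE (T.p x) := (CD.mem_NE T).2 ⟨hx, rfl, he⟩
  have h1 := hI.ix_lt _ x hm
  have h2 : (T.NE (T.p x)).card ≤ G.degree (T.p x) := by
    rw [← G.card_neighborFinset_eq_degree]
    apply Finset.card_le_card
    intro z hz
    have h3 := (CD.mem_NE T).1 hz
    rw [mem_neighborFinset]
    have := T.adj _ h3.1
    rw [h3.2.1] at this; exact this.symm
  have h3 := hΔ (T.p x)
  rw [hI.rank_eq]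
  apply Nat.div_lt_of_lt_mul
  rw [← sq]; omega

open Classical in
theorem tree_inv (hδ : ∀ v, 2 ≤ G.degree v) {s : ℕ} (hs : 2 ≤ s) (hΔ : ∀ v, G.degree v ≤ s ^ 2)
    {ix : V → ℕ} (hI : IxD T s ix) :
    ∃ c, ColInv T s (G.edgeFinset.filter (fun e => T.Tr e)) c := by
  obtain ⟨c, hc⟩ : ∃ c : Sym2 V → ℕ, ∀ x, x ≠ T.r → c s(x, T.p x) = T.t x := by
    refine ⟨fun e => if h : T.Tr e then T.t h.choose else 0, ?_⟩
    intro x hx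
    have h : T.Tr s(x, T.p x) := ⟨x, hx, rfl⟩
    simp only [h, dif_pos]
    have h2 := h.choose_spec
    rw [← tr_inj hx h2.1 h2.2]
  have hal : ∀ x, x ≠ T.r → T.al x < s := by
    intro x hx
    rw [hI.al_eq x hx]; exact Nat.mod_lt _ (by omega)
  refine ⟨c, ?_, tree_pm hδ hs hI hc, ?_, ?_, ?_, ?_⟩
  · intro x hx
    refine ⟨?_, hc x hx⟩
    rw [Finset.mem_filter, mem_edgeFinset]
    exact ⟨T.adj x hx, x, hx, rfl⟩
  · intro e he
    obtain ⟨-, x, hx, rfl⟩ := Finset.mem_filter.1 he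
    rw [hc x hx]
    by_cases he : T.ex (T.p x) = x
    · by_cases hl : T.Leaf x
      · by_cases h2 : T.Type2 (T.p x)
        · rw [T.t_two he h2]
          have := rank_lt hI hΔ h2.1 h2.2.1
          split_ifs <;> omega
        · rw [T.t_leaf he h2 hl]; omega
      · rw [T.t_q he hl]
        have := T.q_le (T.p x); omega
    · rw [T.t_ne he]
      have := hal x hx; omega
  · intro u w ha hw hp hem
    exact absurd (Finset.mem_filter.1 hem).2 (back_not_tree ha hw hp)
  · intro w ha hem
    obtain ⟨-, x, hx, he⟩ := Finset.mem_filter.1 hem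
    rw [he, hc x hx]
    intro ht
    have hL := (T.t_R (x := x) (by omega) (by omega)).2.2.1
    rw [Sym2.eq_iff] at he
    rcases he with ⟨h1, -⟩ | ⟨h1, -⟩
    · exact hx h1.symm
    · exact T.root_ch x hx h1.symm hL
  · intro x x' hS hd
    have hl := T.leaf_L x
    exact absurd (Finset.mem_filter.1 hd).2 (back_not_tree (T.low_adj _ hl)
      (anc_of_adj_leaf hl (T.low_adj _ hl)) (T.low_ne _ hl))

open Classical in
theorem full_inv (hδ : ∀ v, 2 ≤ G.degree v) {s : ℕ} (hs : 2 ≤ s) (hΔ : ∀ v, G.degree v ≤ s ^ 2)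
    {ix : V → ℕ} (hI : IxD T s ix) : ∃ c, ColInv T s G.edgeFinset c := by
  obtain ⟨c0, h0⟩ := tree_inv hδ hs hΔ hI
  set E0 := G.edgeFinset.filter (fun e => T.Tr e) with hE0
  set F1 := G.edgeFinset.filter (fun e => ¬ T.Tr e ∧ ¬ T.Dc e ∧ T.r ∈ e) with hF1
  set F2 := G.edgeFinset.filter (fun e => ¬ T.Tr e ∧ ¬ T.Dc e) with hF2
  obtain ⟨c1, h1⟩ := greedy E0 F1 (ColInv T s) h0 (by
    intro e he E' c _ hsub heE hinv
    obtain ⟨he1, he2, he3, he4⟩ := Finset.mem_filter.1 he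
    refine phase1 hδ ?_ hinv (mem_edgeFinset.1 he1) he2 he3 he4 heE
    intro e' he'
    rcases Finset.mem_union.1 (hsub he') with hh | hh
    · exact Or.inl (Finset.mem_filter.1 hh).2
    · exact Or.inr (Finset.mem_filter.1 hh).2.2.2)
  obtain ⟨c2, h2⟩ := greedy (E0 ∪ F1) F2 (ColInv T s) h1 (by
    intro e he E' c hsub' hsub heE hinv
    obtain ⟨he1, he2, he3⟩ := Finset.mem_filter.1 he
    refine phase2 hδ ?_ hinv (mem_edgeFinset.1 he1) he2 he3 ?_ heE
    · intro e' he' hD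
      rcases Finset.mem_union.1 (hsub he') with hh | hh
      · rcases Finset.mem_union.1 hh with hh | hh
        · exact (Finset.mem_filter.1 hh).2
        · exact absurd hD (Finset.mem_filter.1 hh).2.2.1
      · exact absurd hD (Finset.mem_filter.1 hh).2.2
    · intro hr
      exact heE (hsub' (Finset.mem_union_right _ (Finset.mem_filter.2 ⟨he1, he2, he3, hr⟩))))
  obtain ⟨c3, h3⟩ := greedy (E0 ∪ F1 ∪ F2) G.edgeFinset (ColInv T s) h2 (by
    intro e he E' c hsub' hsub heE hinv
    refine phase3 hδ (by omega) (fun x hx hxe => rank_lt hI hΔ hx hxe) hinv ?_ heE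
    by_contra hD
    apply heE
    apply hsub'
    by_cases hT : T.Tr e
    · exact Finset.mem_union_left _ (Finset.mem_union_left _ (Finset.mem_filter.2 ⟨he, hT⟩))
    · exact Finset.mem_union_right _ (Finset.mem_filter.2 ⟨he, hT, hD⟩))
  refine ⟨c3, ?_⟩
  have : E0 ∪ F1 ∪ F2 ∪ G.edgeFinset = G.edgeFinset := by
    apply Finset.union_eq_right.2
    apply Finset.union_subset (Finset.union_subset _ _)
    all_goals exact Finset.filter_subset _ _
  rwa [this] at h3

theorem ColInv.good {s : ℕ} {c : Sym2 V → ℕ} (h : ColInv T s G.edgeFinset c) : Good T c := by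
  refine ⟨fun x hx => (h.tree x hx).2, ?_, ?_, ?_⟩
  · intro u w ha hw hp
    exact h.b2 u w ha hw hp (mem_edgeFinset.2 ha)
  · intro w ha
    exact h.b3 w ha (mem_edgeFinset.2 ha)
  · intro x x' q1 q2 q3 q4 q5 q6 q7 q8 q9
    exact h.b4 x x' ⟨q1, q2, q3, q4, q5, q6, q7, q8, q9⟩
      (mem_edgeFinset.2 (T.low_adj _ (T.leaf_L x))) (mem_edgeFinset.2 (T.low_adj _ (T.leaf_L x')))

end tree

theorem exists_nat_coloring {V : Type*} [Fintype V] [DecidableEq V] (G : SimpleGraph V)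
    [DecidableRel G.Adj] (hG : G.Connected) (hδ : ∀ v, 2 ≤ G.degree v) (s : ℕ) (hs : 2 ≤ s)
    (hΔ : ∀ v, G.degree v ≤ s ^ 2) :
    ∃ c : Sym2 V → ℕ, (∀ e ∈ G.edgeFinset, c e < s + 5) ∧ PM G G.edgeFinset c ∧
      ∀ φ : G ≃g G, CP c φ → ∀ x, φ x = x := by
  obtain ⟨T, ix, hI⟩ := exists_CD hG hδ s (by omega)
  obtain ⟨c, hc⟩ := full_inv hδ hs hΔ hI
  exact ⟨c, hc.bd, hc.pm, fun φ hφ x => hc.good.distinguishing hφ x⟩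

/-- If `G` is a finite connected graph with minimum degree at least `2` which has a cut
vertex (connectivity 1), then `M'_D(G) ≤ ⌈√Δ⌉ + 5`. -/
theorem majority_distinguishing_index_le_of_connectivity_one {V : Type*} [Fintype V]
    [DecidableEq V] (G : SimpleGraph V) [DecidableRel G.Adj]
    (hconn : G.Connected) (hδ : ∀ v : V, 2 ≤ G.degree v)
    (hcut : ∃ v : V, ¬ (G.induce ({v}ᶜ : Set V)).Connected) :
    ∃ c : Sym2 V → Fin (⌈Real.sqrt (G.maxDegree : ℝ)⌉₊ + 5),
      IsMajorityEdgeColoring G c ∧ IsDistinguishingEdgeColoring G c := by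
  obtain ⟨s, hsdef⟩ : ∃ s, ⌈Real.sqrt (G.maxDegree : ℝ)⌉₊ = s := ⟨_, rfl⟩
  rw [hsdef]
  have hΔ' : G.maxDegree ≤ s ^ 2 := by
    have h1 : Real.sqrt (G.maxDegree : ℝ) ≤ s := by rw [← hsdef]; exact Nat.le_ceil _
    have h2 : (G.maxDegree : ℝ) ≤ (s : ℝ) ^ 2 := (Real.sqrt_le_left (Nat.cast_nonneg s)).1 h1
    exact_mod_cast h2
  have hΔ : ∀ v, G.degree v ≤ s ^ 2 := fun v => (G.degree_le_maxDegree v).trans hΔ'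
  have hs : 2 ≤ s := by
    obtain ⟨v⟩ := hconn.nonempty
    have h1 := (hδ v).trans (hΔ v)
    by_contra hlt
    have h2 : s ≤ 1 := by omega
    have h3 : s ^ 2 ≤ 1 ^ 2 := Nat.pow_le_pow_left h2 2
    omega
  obtain ⟨c, hb, hm, hd⟩ := exists_nat_coloring G hconn hδ s hs hΔ
  have hval : ∀ e ∈ G.edgeFinset, ((Fin.ofNat (s + 5) (c e) : Fin (s + 5)) : ℕ) = c e := by
    intro e he
    rw [Fin.val_ofNat]
    exact Nat.mod_eq_of_lt (hb e he)
  refine ⟨fun e => Fin.ofNat (s + 5) (c e), ?_, ?_⟩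
  · intro u α
    refine le_trans (Nat.mul_le_mul_left 2 (Finset.card_le_card ?_)) (hm u (α : ℕ))
    intro w hw
    obtain ⟨h1, h2⟩ := Finset.mem_filter.1 hw
    have he : s(u, w) ∈ G.edgeFinset := mem_edgeFinset.2 ((G.mem_neighborFinset u w).1 h1)
    refine Finset.mem_filter.2 ⟨h1, he, ?_⟩
    rw [← h2, hval _ he]
  · intro φ hφ
    apply hd φ
    intro u v ha
    have h1 := congrArg Fin.val (hφ u v ha)
    rwa [hval _ (mem_edgeFinset.2 (φ.map_adj_iff.2 ha)), hval _ (mem_edgeFinset.2 ha)] at h1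
end

section
/- Let G be a finite simple graph with minimum degree at least 2 and let H be a connected asymmetric spanning subgraph of G. If H has an almost majority edge coloring with a colors, then M'_D(G) ≤ a + 3; that is, G has an edge coloring with a + 3 colors that is both a majority edge coloring and a distinguishing edge coloring. -/
open SimpleGraph

/-- Almost majority edge coloring: the majority condition is required only at vertices of
degree at least 2. -/
def IsAlmostMajorityEdgeColoring {V : Type*} [Fintype V] [DecidableEq V]
    (G : SimpleGraph V) [DecidableRel G.Adj] {k : ℕ} (c : Sym2 V → Fin k) : Prop :=
  ∀ u : V, ∀ α : Fin k, 2 ≤ G.degree u →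
    2 * ((G.neighborFinset u).filter (fun v => c s(u, v) = α)).card ≤ G.degree u

/-- Greedy coloring with three colors for a symmetric conflict relation of degree at most 2. -/
lemma greedy_three {E : Type*} [DecidableEq E] (R : E → E → Prop)
    (hsymm : ∀ e e', R e e' → R e' e) (hirr : ∀ e, ¬ R e e)
    (hdeg : ∀ e, ∃ x y : E, ∀ e', R e e' → e' = x ∨ e' = y) (S : Finset E) :
    ∃ f : E → Fin 3, ∀ e ∈ S, ∀ e' ∈ S, R e e' → f e ≠ f e' := by
  induction S using Finset.induction_on with
  | empty => exact ⟨fun _ => 0, by simp⟩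
  | insert b S hb ih =>
    obtain ⟨f, hf⟩ := ih
    obtain ⟨x, y, hxy⟩ := hdeg b
    obtain ⟨k, hk⟩ : ∃ k : Fin 3, k ≠ f x ∧ k ≠ f y := by
      generalize f x = p
      generalize f y = q
      revert p q
      decide
    have key : ∀ e', R b e' → k ≠ f e' := by
      intro e' h
      rcases hxy e' h with rfl | rfl
      · exact hk.1
      · exact hk.2
    refine ⟨fun e => if e = b then k else f e, ?_⟩
    intro e he e' he' hR
    by_cases h1 : e = b
    · by_cases h2 : e' = b
      · subst h1; subst h2; exact absurd hR (hirr _)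
      · subst h1
        simpa [h2] using key e' hR
    · by_cases h2 : e' = b
      · subst h2
        simpa [h1] using (key e (hsymm _ _ hR)).symm
      · simp only [h1, h2, if_false]
        exact hf e (by simpa [h1] using he) e' (by simpa [h2] using he') hR

lemma exists_index_s6 {V : Type*} [DecidableEq V] (s : Finset V) :
    ∃ q : V → ℕ, (∀ w ∈ s, ∀ w' ∈ s, q w = q w' → w = w') ∧ ∀ w ∈ s, q w < s.card := by
  refine ⟨fun w => if h : w ∈ s then (s.equivFin ⟨w, h⟩ : ℕ) else 0, ?_, ?_⟩
  · intro w hw w' hw' h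
    simp only [hw, hw', dif_pos] at h
    have := s.equivFin.injective (Fin.ext h)
    simpa using this
  · intro w hw
    simp only [hw, dif_pos]
    exact (s.equivFin ⟨w, hw⟩).2

/-- Every finite graph has an edge coloring with three colors such that at each vertex of degree `d`
each color occurs at most `⌈d / 2⌉` times. -/
lemma three_coloring {V : Type*} [Fintype V] [DecidableEq V] (s : V → Finset V) :
    ∃ f : Sym2 V → Fin 3, ∀ u α,
      ((s u).filter (fun v => f s(u, v) = α)).card ≤ ((s u).card + 1) / 2 := by
  classical
  choose q hq hlt using fun u => exists_index_s6 (s u)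
  have partner : ∀ v w, ∃ z, ∀ w', w ∈ s v → w' ∈ s v → w ≠ w' →
      q v w / 2 = q v w' / 2 → w' = z := by
    intro v w
    by_cases hex : ∃ z, w ∈ s v ∧ z ∈ s v ∧ w ≠ z ∧ q v w / 2 = q v z / 2
    · obtain ⟨z, hw, hz, hne, hqz⟩ := hex
      refine ⟨z, fun w' _ hw' hne' hqw => ?_⟩
      apply hq v w' hw' z hz
      have h1 : q v w ≠ q v z := fun h => hne (hq v w hw z hz h)
      have h2 : q v w ≠ q v w' := fun h => hne' (hq v w hw w' hw' h)
      omega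
    · exact ⟨w, fun w' hw hw' hne h => absurd ⟨w', hw, hw', hne, h⟩ hex⟩
  choose z hz using partner
  obtain ⟨f, hf⟩ := greedy_three
    (fun e e' : Sym2 V => ∃ v w w', e = s(v, w) ∧ e' = s(v, w') ∧ w ∈ s v ∧ w' ∈ s v ∧ w ≠ w' ∧
      q v w / 2 = q v w' / 2)
    (by
      rintro e e' ⟨v, w, w', h1, h2, h3, h4, h5, h6⟩
      exact ⟨v, w', w, h2, h1, h4, h3, h5.symm, h6.symm⟩)
    (by
      rintro e ⟨v, w, w', h1, h2, h3, h4, h5, h6⟩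
      exact h5 (Sym2.congr_right.1 (h1.symm.trans h2)))
    (by
      intro e
      induction e using Sym2.ind with
      | _ x y =>
        refine ⟨s(x, z x y), s(y, z y x), ?_⟩
        rintro e' ⟨v, w, w', h1, h2, h3, h4, h5, h6⟩
        have hw := hz v w w' h3 h4 h5 h6
        rcases Sym2.eq_iff.1 h1 with ⟨rfl, rfl⟩ | ⟨rfl, rfl⟩
        · left; rw [h2, hw]
        · right; rw [h2, hw])
    Finset.univ
  refine ⟨f, fun u α => ?_⟩
  have := Finset.card_le_card_of_injOn (s := (s u).filter (fun v => f s(u, v) = α))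
    (t := Finset.range (((s u).card + 1) / 2)) (fun w => q u w / 2)
    (by
      intro w hw
      have hw' := (Finset.mem_filter.1 (Finset.mem_coe.1 hw)).1
      have := hlt u w hw'
      simp only [Finset.coe_range, Set.mem_Iio]
      omega)
    (by
      intro w hw w' hw' h
      by_contra hne
      have h1 := Finset.mem_filter.1 (Finset.mem_coe.1 hw)
      have h2 := Finset.mem_filter.1 (Finset.mem_coe.1 hw')
      exact hf _ (Finset.mem_univ _) _ (Finset.mem_univ _)
        ⟨u, w, w', rfl, rfl, h1.1, h2.1, hne, h⟩ (h1.2.trans h2.2.symm))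
  simpa using this

/-- Let `H` be a connected asymmetric spanning subgraph of a graph `G` with `δ(G) ≥ 2`.
If `H` has an almost majority edge coloring with `a` colors, then `M'_D(G) ≤ a + 3`. -/
theorem majority_distinguishing_of_asymmetric_spanning_subgraph {V : Type*} [Fintype V]
    [DecidableEq V] (G H : SimpleGraph V) [DecidableRel G.Adj] [DecidableRel H.Adj]
    (hsub : H ≤ G) (hδ : ∀ v : V, 2 ≤ G.degree v) (hHconn : H.Connected)
    (hHasym : ∀ φ : H ≃g H, ∀ x : V, φ x = x)
    {a : ℕ} (hH : ∃ cH : Sym2 V → Fin a, IsAlmostMajorityEdgeColoring H cH) :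
    ∃ c : Sym2 V → Fin (a + 3),
      IsMajorityEdgeColoring G c ∧ IsDistinguishingEdgeColoring G c := by
  classical
  obtain ⟨cH, hcH⟩ := hH
  obtain ⟨f, hf⟩ := three_coloring (fun u => G.neighborFinset u \ H.neighborFinset u)
  set c : Sym2 V → Fin (a + 3) :=
    fun e => if e ∈ H.edgeSet then Fin.castAdd 3 (cH e) else Fin.natAdd a (f e) with hc
  have hcin : ∀ u v, H.Adj u v → c s(u, v) = Fin.castAdd 3 (cH s(u, v)) := by
    intro u v h
    simp [hc, h]
  have hcout : ∀ u v, ¬ H.Adj u v → c s(u, v) = Fin.natAdd a (f s(u, v)) := by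
    intro u v h
    simp [hc, h]
  have hadj : ∀ u v, H.Adj u v ↔ (c s(u, v) : ℕ) < a := by
    intro u v
    by_cases h : H.Adj u v
    · simp [hcin u v h, h]
    · simp [hcout u v h, h]
  refine ⟨c, ?_, ?_⟩
  · intro u α
    have hsubN : H.neighborFinset u ⊆ G.neighborFinset u := by
      intro v hv
      simp only [mem_neighborFinset] at hv ⊢
      exact hsub hv
    have hcardF := Finset.card_sdiff_add_card_eq_card hsubN
    simp only [card_neighborFinset_eq_degree] at hcardF
    have hGu := hδ u
    have hHpos : 0 < H.degree u := by
      obtain ⟨v, hv⟩ := (G.degree_pos_iff_exists_adj u).1 (by omega)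
      haveI : Nontrivial V := ⟨u, v, hv.ne⟩
      exact hHconn.preconnected.degree_pos_of_nontrivial u
    induction α using Fin.addCases with
    | left i =>
      have hss : (G.neighborFinset u).filter (fun v => c s(u, v) = Fin.castAdd 3 i) ⊆
          (H.neighborFinset u).filter (fun v => cH s(u, v) = i) := by
        intro v hv
        obtain ⟨_, h2⟩ := Finset.mem_filter.1 hv
        have hA : H.Adj u v := by
          rw [hadj, h2]
          simp
        rw [hcin u v hA] at h2
        simpa [hA] using h2
      have h1 := Finset.card_le_card hss
      have h2 := Finset.card_filter_le (H.neighborFinset u) (fun v => cH s(u, v) = i)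
      rw [card_neighborFinset_eq_degree] at h2
      by_cases h : 2 ≤ H.degree u
      · have := hcH u i h
        omega
      · omega
    | right j =>
      have hss : (G.neighborFinset u).filter (fun v => c s(u, v) = Fin.natAdd a j) ⊆
          (G.neighborFinset u \ H.neighborFinset u).filter (fun v => f s(u, v) = j) := by
        intro v hv
        obtain ⟨h1, h2⟩ := Finset.mem_filter.1 hv
        have hA : ¬ H.Adj u v := by
          rw [hadj, h2]
          simp
        rw [hcout u v hA] at h2
        simp only [mem_neighborFinset] at h1
        simpa [hA, h1] using h2
      have h1 := Finset.card_le_card hss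
      have h2 := hf u j
      omega
  · intro φ hφ x
    refine hHasym ⟨φ.toEquiv, ?_⟩ x
    intro u v
    change H.Adj (φ u) (φ v) ↔ H.Adj u v
    by_cases hG : G.Adj u v
    · rw [hadj, hadj, hφ u v hG]
    · exact ⟨fun h => absurd (φ.map_rel_iff.1 (hsub h)) hG, fun h => absurd (hsub h) hG⟩
end

section
/- Every finite simple graph of minimum degree at least 2 which has a connected asymmetric spanning subgraph admits a majority distinguishing edge coloring with 7 colors; that is, M'_D(G) ≤ 7 for every such graph G. -/
open SimpleGraph

/-- If the total number of coloured items is less than `(p+1) * L`, at most `p` colours are used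
at least `L` times. -/
lemma saturated_card_le {V : Type*} {K : ℕ} (s : Finset V) (f : V → Fin K) (L p : ℕ)
    (h : s.card < (p + 1) * L) :
    (Finset.univ.filter (fun α : Fin K => L ≤ (s.filter (fun x => f x = α)).card)).card ≤ p := by
  classical
  by_contra hcon
  push Not at hcon
  set A := Finset.univ.filter (fun α : Fin K => L ≤ (s.filter (fun x => f x = α)).card) with hA
  have h1 : A.card * L ≤ ∑ α ∈ A, (s.filter (fun x => f x = α)).card := by
    rw [← smul_eq_mul]
    apply Finset.card_nsmul_le_sum
    intro α hα
    exact (Finset.mem_filter.mp hα).2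
  have h2 : ∑ α ∈ A, (s.filter (fun x => f x = α)).card
      ≤ ∑ α : Fin K, (s.filter (fun x => f x = α)).card :=
    Finset.sum_le_sum_of_subset (Finset.subset_univ _)
  have h3 : s.card = ∑ α : Fin K, (s.filter (fun x => f x = α)).card :=
    Finset.card_eq_sum_card_fiberwise (fun x _ => by simp)
  have h4 : (p + 1) * L ≤ A.card * L := Nat.mul_le_mul_right _ hcon
  omega

/-- Greedy colouring of the edges of `S` in order of decreasing weight `w`. -/
lemma greedy_edge_coloring {V : Type*} [Fintype V] [DecidableEq V]
    (S : SimpleGraph V) [DecidableRel S.Adj] (K : ℕ) (hK : 0 < K) (lim : V → ℕ) (w : Sym2 V → ℕ)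
    (h : ∀ u v, S.Adj u v → ∃ p q, p + q < K ∧
      (((S.neighborFinset u).erase v).filter (fun x => w s(u, v) ≤ w s(u, x))).card
        < (p + 1) * lim u ∧
      (((S.neighborFinset v).erase u).filter (fun x => w s(v, u) ≤ w s(v, x))).card
        < (q + 1) * lim v) :
    ∃ c : Sym2 V → Fin K, ∀ u α,
      ((S.neighborFinset u).filter (fun v => c s(u, v) = α)).card ≤ lim u := by
  have key : ∀ T : Finset (Sym2 V), T ⊆ S.edgeFinset → ∃ c : Sym2 V → Fin K, ∀ u α,
      (((S.neighborFinset u).filter (fun v => s(u, v) ∈ T)).filter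
        (fun v => c s(u, v) = α)).card ≤ lim u := by
    intro T
    induction T using Finset.induction_on_min_value w with
    | empty => intro _; exact ⟨fun _ => ⟨0, hK⟩, by simp⟩
    | insert e T heT hmin ih =>
      intro hsub
      obtain ⟨c, hc⟩ := ih (fun x hx => hsub (Finset.mem_insert_of_mem hx))
      have heS : e ∈ S.edgeFinset := hsub (Finset.mem_insert_self _ _)
      induction e using Sym2.ind with
      | _ a b =>
      have hab : S.Adj a b := by simpa using heS
      have hne : a ≠ b := hab.ne
      obtain ⟨p, q, hpq, ha, hb⟩ := h a b hab
      have sat : ∀ a b p, s(a, b) ∉ T → (∀ x ∈ T, w s(a, b) ≤ w x) →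
          (((S.neighborFinset a).erase b).filter (fun x => w s(a, b) ≤ w s(a, x))).card
            < (p + 1) * lim a →
          (Finset.univ.filter (fun α : Fin K => lim a ≤
            (((S.neighborFinset a).filter (fun v => s(a, v) ∈ T)).filter
              (fun x => c s(a, x) = α)).card)).card ≤ p := by
        intro a b p hT hw hlt
        apply saturated_card_le
        refine lt_of_le_of_lt (Finset.card_le_card ?_) hlt
        intro x hx
        rw [Finset.mem_filter] at hx
        rw [Finset.mem_filter, Finset.mem_erase]
        refine ⟨⟨?_, hx.1⟩, hw _ hx.2⟩
        rintro rfl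
        exact hT hx.2
      have s1 := sat a b p heT hmin ha
      have s2 := sat b a q (by rwa [Sym2.eq_swap]) (by rwa [Sym2.eq_swap]) hb
      obtain ⟨α, hα⟩ : ∃ α : Fin K, α ∉
          (Finset.univ.filter (fun α : Fin K => lim a ≤
            (((S.neighborFinset a).filter (fun v => s(a, v) ∈ T)).filter
              (fun x => c s(a, x) = α)).card)) ∪
          (Finset.univ.filter (fun α : Fin K => lim b ≤
            (((S.neighborFinset b).filter (fun v => s(b, v) ∈ T)).filter
              (fun x => c s(b, x) = α)).card)) := by
        by_contra hcon
        push Not at hcon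
        have := Finset.card_le_card (s := (Finset.univ : Finset (Fin K))) (fun x _ => hcon x)
        have h5 := this.trans (Finset.card_union_le _ _)
        rw [Finset.card_univ, Fintype.card_fin] at h5
        omega
      simp only [Finset.mem_union, Finset.mem_filter, Finset.mem_univ, true_and, not_or,
        not_le] at hα
      refine ⟨Function.update c s(a, b) α, ?_⟩
      -- bound at an endpoint
      have endp : ∀ a b, s(a, b) ∉ T →
          (((S.neighborFinset a).filter (fun v => s(a, v) ∈ T)).filter
              (fun x => c s(a, x) = α)).card < lim a →
          ∀ β, (((S.neighborFinset a).filter (fun v => s(a, v) ∈ insert s(a, b) T)).filter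
            (fun v => Function.update c s(a, b) α s(a, v) = β)).card ≤ lim a := by
        intro a b hT hlt β
        by_cases hβ : β = α
        · subst hβ
          refine le_trans (Finset.card_le_card (t := insert b
            (((S.neighborFinset a).filter (fun v => s(a, v) ∈ T)).filter
              (fun x => c s(a, x) = β))) ?_) ((Finset.card_insert_le _ _).trans hlt)
          intro x hx
          rw [Finset.mem_filter, Finset.mem_filter, Finset.mem_insert] at hx
          rw [Finset.mem_insert, Finset.mem_filter, Finset.mem_filter]
          by_cases hxe : s(a, x) = s(a, b)
          · left; exact Sym2.congr_right.mp hxe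
          · right
            rw [Function.update_of_ne hxe] at hx
            exact ⟨⟨hx.1.1, hx.1.2.resolve_left hxe⟩, hx.2⟩
        · refine le_trans (Finset.card_le_card ?_) (hc a β)
          intro x hx
          rw [Finset.mem_filter, Finset.mem_filter, Finset.mem_insert] at hx
          rw [Finset.mem_filter, Finset.mem_filter]
          by_cases hxe : s(a, x) = s(a, b)
          · rw [hxe, Function.update_self] at hx
            exact absurd hx.2.symm hβ
          · rw [Function.update_of_ne hxe] at hx
            exact ⟨⟨hx.1.1, hx.1.2.resolve_left hxe⟩, hx.2⟩
      intro y β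
      by_cases hya : y = a
      · subst hya; exact endp y b heT hα.1 β
      by_cases hyb : y = b
      · subst hyb
        have := endp y a (by rwa [Sym2.eq_swap]) hα.2 β
        rwa [Sym2.eq_swap (a := y) (b := a)] at this
      refine le_trans (Finset.card_le_card ?_) (hc y β)
      intro x hx
      rw [Finset.mem_filter, Finset.mem_filter, Finset.mem_insert] at hx
      rw [Finset.mem_filter, Finset.mem_filter]
      have hxe : s(y, x) ≠ s(a, b) := by
        intro h
        rw [Sym2.eq_iff] at h
        tauto
      rw [Function.update_of_ne hxe] at hx
      exact ⟨⟨hx.1.1, hx.1.2.resolve_left hxe⟩, hx.2⟩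
  obtain ⟨c, hc⟩ := key S.edgeFinset (Finset.Subset.refl _)
  refine ⟨c, fun u α => le_trans (Finset.card_le_card ?_) (hc u α)⟩
  intro x hx
  rw [Finset.mem_filter] at hx
  rw [Finset.mem_filter, Finset.mem_filter]
  exact ⟨⟨hx.1, by simpa using hx.1⟩, hx.2⟩

lemma exists_closer {V : Type*} (H : SimpleGraph V) (hc : H.Connected) (r u : V) (h : u ≠ r) :
    ∃ x, H.Adj u x ∧ H.dist r x < H.dist r u := by
  obtain ⟨p, hp⟩ := hc.exists_walk_length_eq_dist u r
  cases p with
  | nil => exact absurd rfl h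
  | cons hadj tail =>
    refine ⟨_, hadj, ?_⟩
    rw [SimpleGraph.dist_comm, SimpleGraph.dist_comm (u := r) (v := u), ← hp,
      SimpleGraph.Walk.length_cons]
    exact Nat.lt_succ_of_le (SimpleGraph.dist_le tail)

/-- Every graph of minimum degree at least 2 which has a connected asymmetric spanning
subgraph has a majority distinguishing edge 7-coloring. -/
theorem majority_distinguishing_seven_colors {V : Type*} [Fintype V] [DecidableEq V]
    (G : SimpleGraph V) [DecidableRel G.Adj]
    (hδ : ∀ v : V, 2 ≤ G.degree v)
    (hH : ∃ H : SimpleGraph V, H ≤ G ∧ H.Connected ∧ ∀ φ : H ≃g H, ∀ x : V, φ x = x) :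
    ∃ c : Sym2 V → Fin 7,
      IsMajorityEdgeColoring G c ∧ IsDistinguishingEdgeColoring G c := by
  classical
  obtain ⟨H, hle, hconn, hasym⟩ := hH
  have hfilt : ∀ (S : SimpleGraph V) [DecidableRel S.Adj] (w : Sym2 V → ℕ) (u v : V), S.Adj u v →
      (((S.neighborFinset u).erase v).filter (fun x => w s(u, v) ≤ w s(u, x))).card
        + 1 ≤ S.degree u := by
    intro S _ w u v huv
    have h1 := Finset.card_filter_le ((S.neighborFinset u).erase v)
      (fun x => w s(u, v) ≤ w s(u, x))
    have h2 := Finset.card_erase_add_one ((S.mem_neighborFinset u v).mpr huv)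
    rw [SimpleGraph.card_neighborFinset_eq_degree] at h2
    omega
  by_cases hHG : H = G
  · subst hHG
    obtain ⟨c, hc⟩ := greedy_edge_coloring H 7 (by norm_num) (fun v => H.degree v / 2) (fun _ => 0)
      (fun u v huv => ⟨2, 2, by norm_num, by
        have := hfilt H (fun _ => 0) u v huv
        have := hδ u
        show _ < (2 + 1) * (H.degree u / 2)
        omega, by
        have := hfilt H (fun _ => 0) v u huv.symm
        have := hδ v
        show _ < (2 + 1) * (H.degree v / 2)
        omega⟩)
    refine ⟨c, fun u α => ?_, fun φ _ => hasym φ⟩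
    have := hc u α
    have e : ((H.neighborFinset u).filter (fun v => c s(u, v) = α)).card ≤ H.degree u / 2 := by
      convert this
    omega
  -- the proper subgraph case
  obtain ⟨r, s, hrsG, hrsH⟩ : ∃ r s, G.Adj r s ∧ ¬ H.Adj r s := by
    by_contra hcon
    push Not at hcon
    exact hHG (le_antisymm hle (fun a b hab => hcon a b hab))
  have hnt : Nontrivial V := ⟨r, s, hrsG.ne⟩
  have hHpos : ∀ v, 0 < H.degree v := fun v => hconn.preconnected.degree_pos_of_nontrivial v
  set F := G \ H with hF
  have hdeg : ∀ v, G.degree v = H.degree v + F.degree v := by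
    intro v
    rw [← SimpleGraph.card_neighborFinset_eq_degree, ← SimpleGraph.card_neighborFinset_eq_degree,
      ← SimpleGraph.card_neighborFinset_eq_degree, ← Finset.card_union_of_disjoint]
    · congr 1
      ext x
      have := @hle v x
      simp only [SimpleGraph.mem_neighborFinset, Finset.mem_union, hF, SimpleGraph.sdiff_adj]
      tauto
    · rw [Finset.disjoint_left]
      intro x hx hx'
      simp only [SimpleGraph.mem_neighborFinset, hF, SimpleGraph.sdiff_adj] at hx hx'
      exact hx'.2 hx
  have hFr : 0 < F.degree r := by
    rw [SimpleGraph.degree_pos_iff_exists_adj]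
    exact ⟨s, hrsG, hrsH⟩
  obtain ⟨cF, hcF⟩ := greedy_edge_coloring F 3 (by norm_num) (fun v => G.degree v / 2) (fun _ => 0)
    (fun u v huv => ⟨1, 1, by norm_num, by
        have := hfilt F (fun _ => 0) u v huv
        have := hdeg u
        have := hHpos u
        show _ < (1 + 1) * (G.degree u / 2)
        omega, by
        have := hfilt F (fun _ => 0) v u huv.symm
        have := hdeg v
        have := hHpos v
        show _ < (1 + 1) * (G.degree v / 2)
        omega⟩)
  let w : Sym2 V → ℕ := Sym2.lift ⟨fun a b => min (H.dist r a) (H.dist r b),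
    fun a b => min_comm _ _⟩
  have hw : ∀ a b, w s(a, b) = min (H.dist r a) (H.dist r b) := fun a b => rfl
  have weak : ∀ u v, H.Adj u v →
      (((H.neighborFinset u).erase v).filter (fun x => w s(u, v) ≤ w s(u, x))).card
        < (2 + 1) * (G.degree u / 2) := by
    intro u v huv
    have := hfilt H w u v huv
    have := hdeg u
    have := hδ u
    omega
  have strong : ∀ u v, H.Adj u v → H.dist r u ≤ H.dist r v →
      (((H.neighborFinset u).erase v).filter (fun x => w s(u, v) ≤ w s(u, x))).card
        < (1 + 1) * (G.degree u / 2) := by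
    intro u v huv hd
    by_cases hur : u = r
    · subst hur
      have := hfilt H w u v huv
      have := hdeg u
      omega
    · obtain ⟨x, hux, hx⟩ := exists_closer H hconn r u hur
      have hsub : ((H.neighborFinset u).erase v).filter (fun x => w s(u, v) ≤ w s(u, x)) ⊆
          ((H.neighborFinset u).erase v).erase x := by
        intro y hy
        rw [Finset.mem_filter] at hy
        rw [Finset.mem_erase]
        refine ⟨?_, hy.1⟩
        rintro rfl
        have := hy.2
        rw [hw, hw] at this
        omega
      have hxv : x ≠ v := by
        rintro rfl
        omega
      have h1 := Finset.card_le_card hsub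
      have h2 := Finset.card_erase_add_one ((H.mem_neighborFinset u v).mpr huv)
      have h3 := Finset.card_erase_add_one (Finset.mem_erase.mpr
        ⟨hxv, (H.mem_neighborFinset u x).mpr hux⟩)
      rw [SimpleGraph.card_neighborFinset_eq_degree] at h2
      have := hdeg u
      omega
  obtain ⟨cH, hcH⟩ := greedy_edge_coloring H 4 (by norm_num) (fun v => G.degree v / 2) w (by
    intro u v huv
    rcases le_total (H.dist r u) (H.dist r v) with hd | hd
    · exact ⟨1, 2, by norm_num, strong u v huv hd, weak v u huv.symm⟩
    · exact ⟨2, 1, by norm_num, weak u v huv, strong v u huv.symm hd⟩)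
  let c : Sym2 V → Fin 7 := fun e =>
    if e ∈ H.edgeSet then Fin.castLE (by norm_num) (cH e) else Fin.natAdd 4 (cF e)
  have hcHv : ∀ u v, H.Adj u v → (c s(u, v)).val = (cH s(u, v)).val := by
    intro u v huv
    simp [c, huv]
  have hcFv : ∀ u v, ¬ H.Adj u v → (c s(u, v)).val = 4 + (cF s(u, v)).val := by
    intro u v huv
    simp [c, huv]
  have hciff : ∀ u v, H.Adj u v ↔ (c s(u, v)).val < 4 := by
    intro u v
    constructor
    · intro h
      rw [hcHv u v h]
      exact (cH s(u, v)).isLt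
    · intro h
      by_contra hn
      rw [hcFv u v hn] at h
      omega
  refine ⟨c, fun u α => ?_, fun φ hφ => ?_⟩
  · have : ((G.neighborFinset u).filter (fun v => c s(u, v) = α)).card ≤ G.degree u / 2 := by
      by_cases hα : α.val < 4
      · refine le_trans (Finset.card_le_card ?_) (hcH u ⟨α.val, hα⟩)
        intro x hx
        rw [Finset.mem_filter, SimpleGraph.mem_neighborFinset] at hx
        rw [Finset.mem_filter, SimpleGraph.mem_neighborFinset]
        have hux : H.Adj u x := by rw [hciff, hx.2]; exact hα
        refine ⟨hux, Fin.ext ?_⟩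
        rw [← hcHv u x hux, hx.2]
      · refine le_trans (Finset.card_le_card ?_) (hcF u ⟨α.val - 4, by omega⟩)
        intro x hx
        rw [Finset.mem_filter, SimpleGraph.mem_neighborFinset] at hx
        rw [Finset.mem_filter, SimpleGraph.mem_neighborFinset]
        have hux : ¬ H.Adj u x := by rw [hciff, hx.2]; exact hα
        refine ⟨⟨hx.1, hux⟩, Fin.ext ?_⟩
        have := hcFv u x hux
        rw [hx.2] at this
        simp only
        omega
    omega
  · have hpres : ∀ u v, H.Adj (φ u) (φ v) ↔ H.Adj u v := by
      intro u v
      by_cases huv : G.Adj u v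
      · rw [hciff, hciff, hφ u v huv]
      · have h' : ¬ G.Adj (φ u) (φ v) := by rwa [φ.map_adj_iff]
        exact ⟨fun h => absurd (hle h) h', fun h => absurd (hle h) huv⟩
    exact hasym ⟨φ.toEquiv, fun {u v} => hpres u v⟩
end

section
/- If G is a finite traceable simple graph (i.e. G contains a Hamiltonian path) with minimum degree at least 4, then M'_D(G) ≤ 3; that is, G has an edge coloring with 3 colors that is both a majority edge coloring and a distinguishing edge coloring. -/
open SimpleGraph

/-- The set of signed sums of a finite family of integer vectors. -/
def SignedSums {V ι : Type*} (s : Finset ι) (u : ι → V → ℤ) : Set (V → ℤ) :=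
  {d | ∃ f : ι → ℤ, (∀ e, f e = 1 ∨ f e = -1) ∧ ∀ v, d v = ∑ e ∈ s, f e * u e v}

lemma sign_parity {ι : Type*} (s : Finset ι) (f g : ι → ℤ)
    (hf : ∀ e, f e = 1 ∨ f e = -1) : Even (∑ e ∈ s, f e * g e) ↔ Even (∑ e ∈ s, g e) := by
  classical
  induction s using Finset.induction_on with
  | empty => simp
  | insert a s ha ih =>
    rw [Finset.sum_insert ha, Finset.sum_insert ha, Int.even_add, Int.even_add, ih]
    rcases hf a with h | h <;> simp [h]

/-- Merging two vectors: replace `u h` by `u h + t * u k` and drop `k`. -/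
lemma merge_subset {V ι : Type*} [DecidableEq ι] (s : Finset ι) (u : ι → V → ℤ) {h k : ι}
    (hh : h ∈ s) (hk : k ∈ s) (hne : h ≠ k) (t : ℤ) (ht : t = 1 ∨ t = -1) :
    SignedSums (s.erase k) (Function.update u h (fun v => u h v + t * u k v)) ⊆
      SignedSums s u := by
  rintro d ⟨f, hf, hd⟩
  refine ⟨Function.update f k (t * f h), ?_, ?_⟩
  · intro e
    by_cases he : e = k
    · subst he
      rcases ht with rfl | rfl <;> rcases hf h with h1 | h1 <;> simp [h1]
    · simp [he, hf e]
  · intro v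
    rw [hd v, ← Finset.add_sum_erase s _ hk]
    have hh' : h ∈ s.erase k := Finset.mem_erase.2 ⟨hne, hh⟩
    rw [← Finset.add_sum_erase _ _ hh', ← Finset.add_sum_erase (s.erase k) _ hh']
    have : ∑ e ∈ (s.erase k).erase h,
        f e * Function.update u h (fun v => u h v + t * u k v) e v =
        ∑ e ∈ (s.erase k).erase h, Function.update f k (t * f h) e * u e v := by
      refine Finset.sum_congr rfl fun e he => ?_
      simp only [Finset.mem_erase] at he
      simp [he.1, he.2.1]
    rw [this]
    simp [hne]
    ring

lemma merge_norm {V : Type*} [Fintype V] [DecidableEq V] (p q : V → ℤ) (v : V)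
    (hp : ∑ w, |p w| ≤ 2) (hq : ∑ w, |q w| ≤ 2) (hpv : p v ≠ 0) (hqv : q v ≠ 0) :
    ∃ t : ℤ, (t = 1 ∨ t = -1) ∧ ∑ w, |p w + t * q w| ≤ 2 ∧
      |p v + t * q v| = |(|p v| - |q v|)| := by
  have key : ∀ t : ℤ, (t = 1 ∨ t = -1) → |p v + t * q v| = |(|p v| - |q v|)| →
      ∑ w, |p w + t * q w| ≤ 2 := by
    intro t ht h
    rw [← Finset.add_sum_erase _ _ (Finset.mem_univ v)] at hp hq ⊢
    have h2 : ∑ w ∈ Finset.univ.erase v, |p w + t * q w| ≤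
        ∑ w ∈ Finset.univ.erase v, |p w| + ∑ w ∈ Finset.univ.erase v, |q w| := by
      rw [← Finset.sum_add_distrib]
      refine Finset.sum_le_sum fun w _ => ?_
      refine (abs_add_le _ _).trans ?_
      rcases ht with rfl | rfl <;> simp
    have h3 : 0 ≤ ∑ w ∈ Finset.univ.erase v, |p w| := Finset.sum_nonneg fun _ _ => abs_nonneg _
    have h4 : 0 ≤ ∑ w ∈ Finset.univ.erase v, |q w| := Finset.sum_nonneg fun _ _ => abs_nonneg _
    rw [h]
    have := abs_pos.2 hpv
    have := abs_pos.2 hqv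
    rcases abs_cases (|p v| - |q v|) with h5 | h5 <;> omega
  rcases lt_or_gt_of_ne hpv with h1 | h1 <;> rcases lt_or_gt_of_ne hqv with h2 | h2
  · have h : |p v + (-1) * q v| = |(|p v| - |q v|)| := by
      rw [abs_of_neg h1, abs_of_neg h2, ← abs_neg]; congr 1; ring
    exact ⟨-1, Or.inr rfl, key _ (Or.inr rfl) h, h⟩
  · have h : |p v + 1 * q v| = |(|p v| - |q v|)| := by
      rw [abs_of_neg h1, abs_of_pos h2, ← abs_neg]; congr 1; ring
    exact ⟨1, Or.inl rfl, key _ (Or.inl rfl) h, h⟩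
  · have h : |p v + 1 * q v| = |(|p v| - |q v|)| := by
      rw [abs_of_pos h1, abs_of_neg h2]; congr 1; ring
    exact ⟨1, Or.inl rfl, key _ (Or.inl rfl) h, h⟩
  · have h : |p v + (-1) * q v| = |(|p v| - |q v|)| := by
      rw [abs_of_pos h1, abs_of_pos h2]; congr 1; ring
    exact ⟨-1, Or.inr rfl, key _ (Or.inr rfl) h, h⟩

lemma update_norm {V ι : Type*} [Fintype V] [DecidableEq ι] (s : Finset ι) (u : ι → V → ℤ)
    (h k : ι) (r : V → ℤ) (hs : ∀ e ∈ s, ∑ w, |u e w| ≤ 2) (hr : ∑ w, |r w| ≤ 2) :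
    ∀ e ∈ s.erase k, ∑ w, |Function.update u h r e w| ≤ 2 := by
  intro e he
  by_cases h1 : e = h
  · subst h1; simpa using hr
  · simpa [h1] using hs e (Finset.mem_of_mem_erase he)

/-- Every family of vectors of `ℓ¹`-norm at most two has a signed sum bounded by two. -/
lemma exists_small {V ι : Type*} [Fintype V] [DecidableEq V] [DecidableEq ι] (n : ℕ) :
    ∀ (s : Finset ι) (u : ι → V → ℤ), s.card = n → (∀ e ∈ s, ∑ w, |u e w| ≤ 2) →
      ∃ d ∈ SignedSums s u, ∀ v, |d v| ≤ 2 := by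
  induction n with
  | zero =>
    intro s u hs _
    rw [Finset.card_eq_zero] at hs
    subst hs
    exact ⟨fun _ => 0, ⟨fun _ => 1, by simp, by simp⟩, by simp⟩
  | succ n ih =>
    intro s u hs hn
    by_cases hex : ∃ h ∈ s, ∃ k ∈ s, h ≠ k ∧ ∃ v, u h v ≠ 0 ∧ u k v ≠ 0
    · obtain ⟨h, hh, k, hk, hne, v, h1, h2⟩ := hex
      obtain ⟨t, ht, hr, -⟩ := merge_norm _ _ v (hn h hh) (hn k hk) h1 h2
      obtain ⟨d, hd, hb⟩ := ih (s.erase k) (Function.update u h (fun v => u h v + t * u k v))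
        (by rw [Finset.card_erase_of_mem hk, hs]; rfl) (update_norm s u h k _ hn hr)
      exact ⟨d, merge_subset s u hh hk hne t ht hd, hb⟩
    · push Not at hex
      refine ⟨fun v => ∑ e ∈ s, 1 * u e v, ⟨fun _ => 1, by simp, fun v => rfl⟩, fun v => ?_⟩
      simp only [one_mul]
      by_cases hz : ∃ h ∈ s, u h v ≠ 0
      · obtain ⟨h, hh, h0⟩ := hz
        rw [Finset.sum_eq_single_of_mem h hh (fun k hk hkh => hex h hh k hk hkh.symm v h0)]
        exact (Finset.single_le_sum (f := fun w => |u h w|) (fun _ _ => abs_nonneg _)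
          (Finset.mem_univ v)).trans (hn h hh)
      · push Not at hz
        rw [Finset.sum_eq_zero hz]; simp

lemma norm_entry {V : Type*} [Fintype V] [DecidableEq V] (p : V → ℤ) (hp : ∑ w, |p w| ≤ 2)
    (v : V) : |p v| ≤ 2 :=
  (Finset.single_le_sum (f := fun w => |p w|) (fun _ _ => abs_nonneg _)
          (Finset.mem_univ v)).trans hp

lemma norm_entry_one {V : Type*} [Fintype V] [DecidableEq V] (p : V → ℤ) (hp : ∑ w, |p w| ≤ 2)
    (v r : V) (hvr : r ≠ v) (hv : p v ≠ 0) (hr : p r ≠ 0) : |p v| = 1 := by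
  rw [← Finset.add_sum_erase _ _ (Finset.mem_univ v)] at hp
  have := Finset.single_le_sum (f := fun w => |p w|) (fun _ _ => abs_nonneg _)
          (Finset.mem_erase.2 ⟨hvr, Finset.mem_univ r⟩)
  have h1 := abs_pos.2 hv
  have h2 := abs_pos.2 hr
  omega

lemma elim_aux {V ι : Type*} [Fintype V] [DecidableEq V] [DecidableEq ι] (z : V) (n : ℕ) :
    ∀ (s : Finset ι) (u : ι → V → ℤ), s.card = n → (∀ e ∈ s, ∑ w, |u e w| ≤ 2) →
      ∀ g ∈ s, |u g z| = 1 → Even (∑ e ∈ s, u e z) →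
      ∃ (s' : Finset ι) (u' : ι → V → ℤ), (∀ e ∈ s', ∑ w, |u' e w| ≤ 2) ∧
        SignedSums s' u' ⊆ SignedSums s u ∧
        (∀ e ∈ s, u e z = 0 → e ∈ s' ∧ u' e = u e) ∧ ∀ e ∈ s', u' e z = 0 := by
  induction n with
  | zero =>
    intro s u hs _ g hg
    rw [Finset.card_eq_zero] at hs
    simp [hs] at hg
  | succ n ih =>
    intro s u hs hn g hg hg1 hev
    have hg0 : u g z ≠ 0 := by intro h; simp [h] at hg1
    -- the merging step
    have step : ∀ h ∈ s, ∀ k ∈ s, h ≠ k → u h z ≠ 0 → u k z ≠ 0 →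
        ∃ u₁ : ι → V → ℤ, (∀ e ∈ s.erase k, ∑ w, |u₁ e w| ≤ 2) ∧
          SignedSums (s.erase k) u₁ ⊆ SignedSums s u ∧
          (∀ e, e ≠ h → u₁ e = u e) ∧ |u₁ h z| = |(|u h z| - |u k z|)| ∧
          Even (∑ e ∈ s.erase k, u₁ e z) := by
      intro h hh k hk hne h1 h2
      obtain ⟨t, ht, hr, hz⟩ := merge_norm _ _ z (hn h hh) (hn k hk) h1 h2
      have hsub := merge_subset s u hh hk hne t ht
      refine ⟨Function.update u h (fun v => u h v + t * u k v), update_norm s u h k _ hn hr,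
        hsub, fun e he => by simp [he], by simpa using hz, ?_⟩
      obtain ⟨f, hf, hd⟩ := hsub ⟨fun _ => 1, by simp, fun v => rfl⟩
      have := hd z
      simp only [one_mul] at this
      rw [this, sign_parity _ _ _ hf]
      exact hev
    -- absorbing a loop
    have absorb : ∀ k ∈ s, |u k z| = 2 → ∃ (s' : Finset ι) (u' : ι → V → ℤ),
        (∀ e ∈ s', ∑ w, |u' e w| ≤ 2) ∧ SignedSums s' u' ⊆ SignedSums s u ∧
        (∀ e ∈ s, u e z = 0 → e ∈ s' ∧ u' e = u e) ∧ ∀ e ∈ s', u' e z = 0 := by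
      intro k hk hk2
      have hk0 : u k z ≠ 0 := by intro h; simp [h] at hk2
      have hgk : g ≠ k := by rintro rfl; omega
      obtain ⟨u₁, a1, a2, a3, a4, a5⟩ := step g hg k hk hgk hg0 hk0
      obtain ⟨s', u', b1, b2, b3, b4⟩ := ih (s.erase k) u₁
        (by rw [Finset.card_erase_of_mem hk, hs]; rfl) a1 g
        (Finset.mem_erase.2 ⟨hgk, hg⟩) (by rw [a4, hg1, hk2]; norm_num) a5
      refine ⟨s', u', b1, b2.trans a2, ?_, b4⟩
      intro e he he0
      have e1 : e ≠ g := by rintro rfl; exact hg0 he0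
      have e2 : e ≠ k := by rintro rfl; exact hk0 he0
      have := b3 e (Finset.mem_erase.2 ⟨e2, he⟩) (by rw [a3 e e1]; exact he0)
      exact ⟨this.1, this.2.trans (a3 e e1)⟩
    by_cases hloop : ∃ k ∈ s, |u k z| = 2
    · obtain ⟨k, hk, hk2⟩ := hloop
      exact absorb k hk hk2
    push Not at hloop
    have hone : ∀ k ∈ s, u k z ≠ 0 → |u k z| = 1 := by
      intro k hk hk0
      have h1 := norm_entry _ (hn k hk) z
      have h2 := hloop k hk
      have h3 := abs_pos.2 hk0
      omega
    obtain ⟨h, hh, hhg, hh0⟩ : ∃ h ∈ s, h ≠ g ∧ u h z ≠ 0 := by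
      by_contra hcon
      push Not at hcon
      rw [Finset.sum_eq_single_of_mem g hg hcon] at hev
      rw [← even_abs, hg1] at hev
      exact absurd hev (by decide)
    by_cases hthird : ∃ k ∈ s, k ≠ g ∧ k ≠ h ∧ u k z ≠ 0
    · obtain ⟨k, hk, hkg, hkh, hk0⟩ := hthird
      obtain ⟨u₁, a1, a2, a3, a4, a5⟩ := step h hh k hk hkh.symm hh0 hk0
      obtain ⟨s', u', b1, b2, b3, b4⟩ := ih (s.erase k) u₁
        (by rw [Finset.card_erase_of_mem hk, hs]; rfl) a1 g
        (Finset.mem_erase.2 ⟨hkg.symm, hg⟩) (by rw [a3 g hhg.symm, hg1]) a5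
      refine ⟨s', u', b1, b2.trans a2, ?_, b4⟩
      intro e he he0
      have e1 : e ≠ h := by rintro rfl; exact hh0 he0
      have e2 : e ≠ k := by rintro rfl; exact hk0 he0
      have := b3 e (Finset.mem_erase.2 ⟨e2, he⟩) (by rw [a3 e e1]; exact he0)
      exact ⟨this.1, this.2.trans (a3 e e1)⟩
    · push Not at hthird
      obtain ⟨u₁, a1, a2, a3, a4, a5⟩ := step g hg h hh hhg.symm hg0 hh0
      refine ⟨s.erase h, u₁, a1, a2, ?_, ?_⟩
      · intro e he he0
        have e1 : e ≠ g := by rintro rfl; exact hg0 he0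
        have e2 : e ≠ h := by rintro rfl; exact hh0 he0
        exact ⟨Finset.mem_erase.2 ⟨e2, he⟩, a3 e e1⟩
      · intro e he
        rw [Finset.mem_erase] at he
        by_cases e1 : e = g
        · subst e1
          rw [hone e hg hg0, hone h hh hh0] at a4
          simpa using a4
        · rw [a3 e e1]
          exact hthird e he.2 e1 he.1

/-- Elimination of a vertex `z` that has a link to another vertex. -/
lemma elim {V ι : Type*} [Fintype V] [DecidableEq V] [DecidableEq ι] (z r : V) (hrz : r ≠ z)
    (s : Finset ι) (u : ι → V → ℤ) (hn : ∀ e ∈ s, ∑ w, |u e w| ≤ 2)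
    (g : ι) (hg : g ∈ s) (hgz : u g z ≠ 0) (hgr : u g r ≠ 0) :
    ∃ (s' : Finset ι) (u' : ι → V → ℤ), (∀ e ∈ s', ∑ w, |u' e w| ≤ 2) ∧
        SignedSums s' u' ⊆ SignedSums s u ∧
        (∀ e ∈ s, u e z = 0 → e ∈ s' ∧ u' e = u e) ∧
        ∀ d ∈ SignedSums s' u', Even (d z) → d z = 0 := by
  by_cases hev : Even (∑ e ∈ s, u e z)
  · obtain ⟨s', u', a1, a2, a3, a4⟩ := elim_aux z _ s u rfl hn g hg
      (norm_entry_one _ (hn g hg) z r hrz hgz hgr) hev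
    refine ⟨s', u', a1, a2, a3, ?_⟩
    rintro d ⟨f, hf, hd⟩ -
    rw [hd z]
    exact Finset.sum_eq_zero fun e he => by rw [a4 e he, mul_zero]
  · refine ⟨s, u, hn, subset_rfl, fun e he _ => ⟨he, rfl⟩, ?_⟩
    rintro d ⟨f, hf, hd⟩ h
    rw [hd z, sign_parity _ _ _ hf] at h
    exact absurd h hev

lemma edge_sum {V : Type*} [Fintype V] [DecidableEq V] (R : SimpleGraph V) [DecidableRel R.Adj]
    (f : Sym2 V → ℤ) (v : V) :
    ∑ e ∈ R.edgeFinset, f e * (if v ∈ e then 1 else 0) =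
      ∑ w ∈ R.neighborFinset v, f s(v, w) := by
  simp only [mul_ite, mul_one, mul_zero]
  rw [← Finset.sum_filter, ← R.incidenceFinset_eq_filter]
  have : R.incidenceFinset v = (R.neighborFinset v).image (fun w => s(v, w)) := by
    ext e
    induction e using Sym2.ind with
    | _ p q =>
      simp only [mem_incidenceFinset, mk'_mem_incidenceSet_iff, Finset.mem_image,
        mem_neighborFinset, Sym2.eq_iff]
      constructor
      · rintro ⟨h, rfl | rfl⟩
        · exact ⟨q, h, Or.inl ⟨rfl, rfl⟩⟩
        · exact ⟨p, h.symm, Or.inr ⟨rfl, rfl⟩⟩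
      · rintro ⟨w, h, ⟨rfl, rfl⟩ | ⟨rfl, rfl⟩⟩
        · exact ⟨h, Or.inl rfl⟩
        · exact ⟨h.symm, Or.inr rfl⟩
  rw [this, Finset.sum_image]
  intro w _ w' _ h
  exact Sym2.congr_right.1 h

lemma edge_norm {V : Type*} [Fintype V] [DecidableEq V] (e : Sym2 V) :
    ∑ w : V, |(if w ∈ e then (1 : ℤ) else 0)| ≤ 2 := by
  induction e using Sym2.ind with
  | _ p q =>
    calc ∑ w : V, |(if w ∈ s(p, q) then (1 : ℤ) else 0)|
        ≤ ∑ w : V, ((if w = p then (1 : ℤ) else 0) + (if w = q then (1 : ℤ) else 0)) := by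
          refine Finset.sum_le_sum fun w _ => ?_
          simp only [Sym2.mem_iff]
          split_ifs <;> simp_all
      _ ≤ 2 := by rw [Finset.sum_add_distrib]; simp

/-- The family consisting of the edges of a graph and a dummy vector. -/
def famVec {V : Type*} [DecidableEq V] (D : V → ℤ) : Option (Sym2 V) → V → ℤ
  | none => D
  | some e => fun v => if v ∈ e then 1 else 0

lemma core_dummy {V : Type*} [Fintype V] [DecidableEq V] (R : SimpleGraph V) [DecidableRel R.Adj]
    (x y a b : V)
    (hx : ∃ r, R.Adj x r) (hy : ∃ r, R.Adj y r ∧ r ≠ x)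
    (ha : ∃ r, R.Adj a r ∧ r ≠ x ∧ r ≠ y) (hb : ∃ r, R.Adj b r ∧ r ≠ x ∧ r ≠ y ∧ r ≠ a)
    (hxy : x ≠ y) (hax : a ≠ x) (hay : a ≠ y) (hbx : b ≠ x) (hby : b ≠ y) (hba : b ≠ a)
    (D : V → ℤ) (hD : ∑ w, |D w| ≤ 2) :
    ∃ (f : Sym2 V → ℤ) (t : ℤ), (∀ e, f e = 1 ∨ f e = -1) ∧ (t = 1 ∨ t = -1) ∧
      ∀ d : V → ℤ, (∀ v, d v = t * D v + ∑ w ∈ R.neighborFinset v, f s(v, w)) →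
      (∀ v, |d v| ≤ 2) ∧ (Even (d x) → d x = 0) ∧ (Even (d y) → d y = 0) ∧
        (Even (d a) → d a = 0) ∧ (Even (d b) → d b = 0) := by
  obtain ⟨rx, hx⟩ := hx
  obtain ⟨ry, hy, hy1⟩ := hy
  obtain ⟨ra, ha, ha1, ha2⟩ := ha
  obtain ⟨rb, hb, hb1, hb2, hb3⟩ := hb
  have mem : ∀ {p q : V}, R.Adj p q → some s(p, q) ∈ Finset.insertNone R.edgeFinset := by
    intro p q h; simpa using h
  have vec : ∀ p q v : V, famVec D (some s(p, q)) v = if v = p ∨ v = q then 1 else 0 := by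
    intro p q v; simp [famVec]
  have n0 : ∀ e ∈ Finset.insertNone R.edgeFinset, ∑ w, |famVec D e w| ≤ 2 := by
    rintro (_ | e) _
    · exact hD
    · exact edge_norm e
  obtain ⟨s1, u1, n1, sub1, keep1, z1⟩ := elim x rx hx.ne' _ (famVec D) n0 _ (mem hx)
    (by simp [vec]) (by simp [vec])
  have ky1 := keep1 _ (mem hy) (by simp [vec, hxy, hy1.symm])
  have ka1 := keep1 _ (mem ha) (by simp [vec, hax.symm, ha1.symm])
  have kb1 := keep1 _ (mem hb) (by simp [vec, hbx.symm, hb1.symm])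
  obtain ⟨s2, u2, n2, sub2, keep2, z2⟩ := elim y ry hy.ne' s1 u1 n1 _ ky1.1
    (by simp [ky1.2, vec]) (by simp [ky1.2, vec])
  have ka2 := keep2 _ ka1.1 (by simp [ka1.2, vec, hay.symm, ha2.symm])
  have kb2 := keep2 _ kb1.1 (by simp [kb1.2, vec, hby.symm, hb2.symm])
  obtain ⟨s3, u3, n3, sub3, keep3, z3⟩ := elim a ra ha.ne' s2 u2 n2 _ ka2.1
    (by simp [ka2.2, ka1.2, vec]) (by simp [ka2.2, ka1.2, vec])
  have kb3 := keep3 _ kb2.1 (by simp [kb2.2, kb1.2, vec, hba.symm, hb3.symm])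
  obtain ⟨s4, u4, n4, sub4, -, z4⟩ := elim b rb hb.ne' s3 u3 n3 _ kb3.1
    (by simp [kb3.2, kb2.2, kb1.2, vec]) (by simp [kb3.2, kb2.2, kb1.2, vec])
  obtain ⟨d, hd4, hsmall⟩ := exists_small _ s4 u4 rfl n4
  have hd3 := sub4 hd4
  have hd2 := sub3 hd3
  have hd1 := sub2 hd2
  obtain ⟨f, hf, hd⟩ := sub1 hd1
  refine ⟨fun e => f (some e), f none, fun e => hf _, hf _, ?_⟩
  intro d' hd'
  have : d' = d := by
    funext v
    rw [hd' v, hd v, Finset.sum_insertNone, ← edge_sum R (fun e => f (some e)) v]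
    rfl
  subst this
  exact ⟨hsmall, z1 _ hd1, z2 _ hd2, z3 _ hd3, z4 _ hd4⟩

lemma core {V : Type*} [Fintype V] [DecidableEq V] (R : SimpleGraph V) [DecidableRel R.Adj]
    (x y a b : V)
    (hx : ∃ r, R.Adj x r) (hy : ∃ r, R.Adj y r ∧ r ≠ x)
    (ha : ∃ r, R.Adj a r ∧ r ≠ x ∧ r ≠ y) (hb : ∃ r, R.Adj b r ∧ r ≠ x ∧ r ≠ y ∧ r ≠ a)
    (hxy : x ≠ y) (hax : a ≠ x) (hay : a ≠ y) (hbx : b ≠ x) (hby : b ≠ y) (hba : b ≠ a) :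
    ∃ f : Sym2 V → ℤ, (∀ e, f e = 1 ∨ f e = -1) ∧
      (∀ v, |∑ w ∈ R.neighborFinset v, f s(v, w)| ≤ 2) ∧
      |∑ w ∈ R.neighborFinset a, f s(a, w)| ≤ 1 ∧ |∑ w ∈ R.neighborFinset b, f s(b, w)| ≤ 1 ∧
      ∑ w ∈ R.neighborFinset x, f s(x, w) ≠ ∑ w ∈ R.neighborFinset y, f s(y, w) := by
  have par : ∀ f : Sym2 V → ℤ, (∀ e, f e = 1 ∨ f e = -1) → ∀ v,
      (Even (∑ w ∈ R.neighborFinset v, f s(v, w)) ↔ Even (R.degree v)) := by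
    intro f hf v
    have := sign_parity (R.neighborFinset v) (fun w => f s(v, w)) (fun _ => 1) (fun w => hf _)
    simp only [mul_one] at this
    rw [this]
    simp
  have small : ∀ m : ℤ, |m| ≤ 2 → (Even m → m = 0) → |m| ≤ 1 := by
    intro m h1 h2
    rw [abs_le] at *
    by_contra h
    have : m = 2 ∨ m = -2 := by omega
    rcases this with rfl | rfl
    · exact absurd (h2 (by decide)) (by decide)
    · exact absurd (h2 (by decide)) (by decide)
  by_cases hpar : Even (R.degree x) ↔ Even (R.degree y)
  · by_cases hev : Even (R.degree x)
    · have hev' := hpar.1 hev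
      obtain ⟨f, t, hf, ht, H⟩ := core_dummy R x y a b hx hy ha hb hxy hax hay hbx hby hba
        (fun v => if v = x then 2 else 0) (by
          have : ∀ w : V, |(if w = x then (2 : ℤ) else 0)| = if w = x then 2 else 0 := by
            intro w; split_ifs <;> simp
          simp [this])
      obtain ⟨h2, zx, zy, za, zb⟩ := H _ (fun v => rfl)
      simp only [hxy.symm, hax, hbx, if_true, if_false, mul_zero, zero_add] at zx zy za zb
      have hx0 := zx (by rw [Int.even_add, par f hf]; simp [hev])
      have hy0 := zy (by rw [par f hf]; exact hev')
      have ha2 := h2 a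
      have hb2 := h2 b
      simp only [hax, hbx, if_false, mul_zero, zero_add] at ha2 hb2
      refine ⟨f, hf, ?_, small _ ha2 za, small _ hb2 zb, ?_⟩
      · intro v
        by_cases hv : v = x
        · subst hv
          rw [abs_le]
          rcases ht with rfl | rfl <;> constructor <;> linarith
        · simpa [hv] using h2 v
      · rw [hy0]
        rcases ht with rfl | rfl <;> intro h <;> rw [h] at hx0 <;> norm_num at hx0
    · have hev' : ¬ Even (R.degree y) := fun h => hev (hpar.2 h)
      obtain ⟨f, t, hf, ht, H⟩ := core_dummy R x y a b hx hy ha hb hxy hax hay hbx hby hba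
        (fun v => if v = x then 1 else if v = y then -1 else 0) (by
          have : ∀ w : V, |(if w = x then (1 : ℤ) else if w = y then -1 else 0)| ≤
              (if w = x then 1 else 0) + if w = y then 1 else 0 := by
            intro w; split_ifs <;> simp
          refine (Finset.sum_le_sum fun w _ => this w).trans ?_
          rw [Finset.sum_add_distrib]
          simp)
      obtain ⟨h2, zx, zy, za, zb⟩ := H _ (fun v => rfl)
      simp only [hxy.symm, hax, hbx, hay, hby, if_true, if_false, mul_zero, zero_add]
        at zx zy za zb
      have ht' : ¬ Even t := by rcases ht with rfl | rfl <;> decide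
      have hx0 := zx (by rw [Int.even_add, par f hf]; simp [hev, ht'])
      have hy0 := zy (by rw [Int.even_add, par f hf]; simp [hev', ht'])
      have ha2 := h2 a
      have hb2 := h2 b
      simp only [hax, hbx, hay, hby, if_false, mul_zero, zero_add] at ha2 hb2
      refine ⟨f, hf, ?_, small _ ha2 za, small _ hb2 zb, ?_⟩
      · intro v
        by_cases hv : v = x
        · subst hv
          rw [abs_le]
          rcases ht with rfl | rfl <;> constructor <;> linarith
        · by_cases hv' : v = y
          · subst hv'
            rw [abs_le]
            rcases ht with rfl | rfl <;> constructor <;> linarith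
          · simpa [hv, hv'] using h2 v
      · intro h
        rw [h] at hx0
        rcases ht with rfl | rfl <;> linarith
  · obtain ⟨f, t, hf, ht, H⟩ := core_dummy R x y a b hx hy ha hb hxy hax hay hbx hby hba
      (fun _ => 0) (by simp)
    obtain ⟨h2, zx, zy, za, zb⟩ := H _ (fun v => rfl)
    simp only [mul_zero, zero_add] at h2 za zb
    refine ⟨f, hf, h2, small _ (h2 a) za, small _ (h2 b) zb, ?_⟩
    intro h
    apply hpar
    rw [← par f hf x, ← par f hf y, h]

lemma ham_pos {V : Type*} [Fintype V] [DecidableEq V] (G : SimpleGraph V)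
    {u v : V} (p : G.Walk u v) (hp : p.IsHamiltonian) :
    ∃ pos : V → ℕ, Function.Injective pos ∧ (∀ w, pos w < Fintype.card V) ∧
      (∀ i < Fintype.card V, ∃ w, pos w = i) ∧ ∀ w w', pos w + 1 = pos w' → G.Adj w w' := by
  have hlen := hp.length_support
  refine ⟨fun w => (hp.getVertEquiv.symm w : ℕ), ?_, ?_, ?_, ?_⟩
  · intro w w' h
    exact hp.getVertEquiv.symm.injective (Fin.ext h)
  · intro w
    rw [← hlen]
    exact (hp.getVertEquiv.symm w).2
  · intro i hi
    rw [← hlen] at hi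
    exact ⟨hp.getVertEquiv ⟨i, hi⟩, congrArg Fin.val (hp.getVertEquiv.symm_apply_apply ⟨i, hi⟩)⟩
  · intro w w' h
    have h1 : p.getVert (hp.getVertEquiv.symm w : ℕ) = w := hp.getVertEquiv.apply_symm_apply w
    have h2 : p.getVert (hp.getVertEquiv.symm w' : ℕ) = w' := hp.getVertEquiv.apply_symm_apply w'
    have h3 := (hp.getVertEquiv.symm w').2
    have h4 := p.length_support
    simp only at h
    have := p.adj_getVert_succ (i := (hp.getVertEquiv.symm w : ℕ)) (by omega)
    rwa [h, h1, h2] at this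

/-- If `G` is a traceable graph (it has a Hamiltonian path) with minimum degree at least 4,
then `M'_D(G) ≤ 3`. -/
theorem majority_distinguishing_traceable {V : Type*} [Fintype V] [DecidableEq V]
    (G : SimpleGraph V) [DecidableRel G.Adj]
    (htrace : ∃ (u v : V) (p : G.Walk u v), p.IsHamiltonian)
    (hδ : ∀ v : V, 4 ≤ G.degree v) :
    ∃ c : Sym2 V → Fin 3,
      IsMajorityEdgeColoring G c ∧ IsDistinguishingEdgeColoring G c := by
  classical
  obtain ⟨u₀, v₀, p, hp⟩ := htrace
  obtain ⟨pos, hinj, hlt, hsurj, hadj⟩ := ham_pos G p hp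
  set n := Fintype.card V with hn
  have hn5 : 5 ≤ n := by
    have := G.degree_lt_card_verts u₀
    have := hδ u₀
    omega
  -- the path
  let P : SimpleGraph V :=
    { Adj := fun v w => pos v + 1 = pos w ∨ pos w + 1 = pos v
      symm := ⟨fun v w h => h.symm⟩
      loopless := ⟨fun v h => by omega⟩ }
  have hP : ∀ v w, P.Adj v w ↔ (pos v + 1 = pos w ∨ pos w + 1 = pos v) := fun v w => Iff.rfl
  have hPG : ∀ v w, P.Adj v w → G.Adj v w := by
    rintro v w (h | h)
    · exact hadj _ _ h
    · exact (hadj _ _ h).symm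
  obtain ⟨a, ha⟩ := hsurj 0 (by omega)
  obtain ⟨x, hx⟩ := hsurj 1 (by omega)
  obtain ⟨y, hy⟩ := hsurj (n - 2) (by omega)
  obtain ⟨b, hb⟩ := hsurj (n - 1) (by omega)
  have ne : ∀ {v w : V}, pos v ≠ pos w → v ≠ w := fun h h' => h (by rw [h'])
  let R : SimpleGraph V := G \ P
  have hR : ∀ v w, R.Adj v w ↔ G.Adj v w ∧ ¬ P.Adj v w := fun v w => sdiff_adj G P v w
  -- the neighbours on the path
  have hPdeg : ∀ v, P.degree v ≤ 2 ∧ 1 ≤ P.degree v ∧ (v ≠ a → v ≠ b → 2 ≤ P.degree v) ∧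
      (v = a ∨ v = b → P.degree v ≤ 1) := by
    intro v
    have hup : ∀ T : Finset ℕ, (∀ w, P.Adj v w → pos w ∈ T) → P.degree v ≤ T.card := by
      intro T hT
      rw [← card_neighborFinset_eq_degree, ← Finset.card_image_of_injective _ hinj]
      refine Finset.card_le_card fun i hi => ?_
      simp only [Finset.mem_image, mem_neighborFinset] at hi
      obtain ⟨w, hw, rfl⟩ := hi
      exact hT w hw
    have hlow : ∀ T : Finset ℕ, (∀ i ∈ T, i < n ∧ (pos v + 1 = i ∨ i + 1 = pos v)) →
        T.card ≤ P.degree v := by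
      intro T hT
      rw [← card_neighborFinset_eq_degree, ← Finset.card_image_of_injective _ hinj]
      refine Finset.card_le_card fun i hi => ?_
      obtain ⟨h1, h2⟩ := hT i hi
      obtain ⟨w, rfl⟩ := hsurj i h1
      simp only [Finset.mem_image, mem_neighborFinset]
      exact ⟨w, h2, rfl⟩
    have hv := hlt v
    refine ⟨?_, ?_, ?_, ?_⟩
    · refine (hup {pos v + 1, pos v - 1} ?_).trans Finset.card_le_two
      intro w hw
      rw [hP] at hw
      simp only [Finset.mem_insert, Finset.mem_singleton]
      omega
    · by_cases h0 : pos v = 0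
      · have := hlow {1} (by simp; omega)
        simpa using this
      · have := hlow {pos v - 1} (by simp; omega)
        simpa using this
    · intro h1 h2
      have h3 : pos v ≠ 0 := fun h => h1 (hinj (by omega))
      have h4 : pos v ≠ n - 1 := fun h => h2 (hinj (by omega))
      have := hlow {pos v + 1, pos v - 1} (by simp; omega)
      rwa [Finset.card_pair (by omega)] at this
    · rintro (rfl | rfl)
      · refine (hup {1} ?_).trans (by simp)
        intro w hw
        rw [hP] at hw
        simp only [Finset.mem_singleton]
        omega
      · refine (hup {n - 2} ?_).trans (by simp)
        intro w hw
        rw [hP] at hw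
        have := hlt w
        simp only [Finset.mem_singleton]
        omega
  have hdeg : ∀ v, G.degree v = P.degree v + R.degree v := by
    intro v
    rw [← card_neighborFinset_eq_degree, ← card_neighborFinset_eq_degree,
      ← card_neighborFinset_eq_degree, ← Finset.card_union_of_disjoint]
    · congr 1
      ext w
      simp only [Finset.mem_union, mem_neighborFinset, hR]
      constructor
      · intro h; by_cases h' : P.Adj v w <;> simp [h, h']
      · rintro (h | h)
        · exact hPG _ _ h
        · exact h.1
    · rw [Finset.disjoint_left]
      intro w
      simp only [mem_neighborFinset, hR]
      exact fun h h' => h'.2 h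
  have avoid : ∀ v (S : Finset V), S.card < R.degree v → ∃ r, R.Adj v r ∧ r ∉ S := by
    intro v S h
    rw [← card_neighborFinset_eq_degree] at h
    obtain ⟨r, h1, h2⟩ := Finset.exists_mem_notMem_of_card_lt_card h
    exact ⟨r, by simpa using h1, h2⟩
  have hax : R.Adj a x → False := fun h => ((hR _ _).1 h).2 (by rw [hP]; omega)
  have hby : R.Adj b y → False := fun h => ((hR _ _).1 h).2 (by rw [hP]; omega)
  obtain ⟨f, hf, hf2, hfa, hfb, hfxy⟩ := core R x y a b
    (by
      obtain ⟨r, h, -⟩ := avoid x ∅ (by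
        have := hdeg x; have := hδ x; have := hPdeg x; simp; omega)
      exact ⟨r, h⟩)
    (by
      obtain ⟨r, h, h'⟩ := avoid y {x} (by
        have := hdeg y; have := hδ y; have := hPdeg y; simp; omega)
      exact ⟨r, h, by simpa using h'⟩)
    (by
      obtain ⟨r, h, h'⟩ := avoid a {y} (by
        have := hdeg a; have := hδ a; have := hPdeg a; simp; omega)
      refine ⟨r, h, ?_, by simpa using h'⟩
      rintro rfl; exact hax h)
    (by
      obtain ⟨r, h, h'⟩ := avoid b {x, a} (by
        have := hdeg b; have := hδ b; have := (hPdeg b).2.2.2 (Or.inr rfl)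
        have := Finset.card_le_two (a := x) (b := a)
        omega)
      simp only [Finset.mem_insert, Finset.mem_singleton, not_or] at h'
      refine ⟨r, h, h'.1, ?_, h'.2⟩
      rintro rfl; exact hby h)
    (ne (by omega)) (ne (by omega)) (ne (by omega)) (ne (by omega)) (ne (by omega))
    (ne (by omega))
  let c : Sym2 V → Fin 3 := fun e => if e ∈ P.edgeSet then 2 else if f e = 1 then 0 else 1
  have hc2 : ∀ v w, c s(v, w) = 2 ↔ P.Adj v w := by
    intro v w
    simp only [c, mem_edgeSet]
    split_ifs <;> simp_all
  have hc0 : ∀ v w, c s(v, w) = 0 ↔ ¬ P.Adj v w ∧ f s(v, w) = 1 := by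
    intro v w
    simp only [c, mem_edgeSet]
    split_ifs <;> simp_all
  have hc1 : ∀ v w, c s(v, w) = 1 ↔ ¬ P.Adj v w ∧ f s(v, w) = -1 := by
    intro v w
    have := hf s(v, w)
    simp only [c, mem_edgeSet]
    split_ifs with h1 h2
    · simp [h1]
    · simp [h2]
    · simp [h1, this.resolve_left h2]
  let N : V → Fin 3 → ℕ := fun v α => ((G.neighborFinset v).filter (fun w => c s(v, w) = α)).card
  have hN2 : ∀ v, N v 2 = P.degree v := by
    intro v
    rw [← card_neighborFinset_eq_degree]
    simp only [N]
    congr 1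
    ext w
    simp only [Finset.mem_filter, mem_neighborFinset, hc2]
    exact ⟨fun h => h.2, fun h => ⟨hPG _ _ h, h⟩⟩
  have hN0 : ∀ v, N v 0 = ((R.neighborFinset v).filter (fun w => f s(v, w) = 1)).card := by
    intro v
    simp only [N]
    congr 1
    ext w
    simp only [Finset.mem_filter, mem_neighborFinset, hc0, hR]
    tauto
  have hN1 : ∀ v, N v 1 = ((R.neighborFinset v).filter (fun w => ¬ f s(v, w) = 1)).card := by
    intro v
    simp only [N]
    congr 1
    ext w
    simp only [Finset.mem_filter, mem_neighborFinset, hc1, hR]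
    have : f s(v, w) = -1 ↔ ¬ f s(v, w) = 1 := by
      rcases hf s(v, w) with h | h <;> simp [h]
    tauto
  have hsum : ∀ v, N v 0 + N v 1 = R.degree v := by
    intro v
    rw [hN0, hN1, Finset.card_filter_add_card_filter_not, card_neighborFinset_eq_degree]
  have hdiff : ∀ v, ∑ w ∈ R.neighborFinset v, f s(v, w) = (N v 0 : ℤ) - N v 1 := by
    intro v
    rw [hN0, hN1, ← Finset.sum_filter_add_sum_filter_not _ (fun w => f s(v, w) = 1)]
    rw [Finset.sum_congr rfl (g := fun _ => (1 : ℤ))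
      (fun w hw => (Finset.mem_filter.1 hw).2)]
    rw [Finset.sum_congr rfl (g := fun _ => (-1 : ℤ))
      (fun w hw => (hf _).resolve_left (Finset.mem_filter.1 hw).2)]
    simp
    ring
  refine ⟨c, ?_, ?_⟩
  · intro v α
    change 2 * N v α ≤ G.degree v
    have h1 := hsum v
    have h2 := hdiff v
    have h3 := hdeg v
    have h4 := hPdeg v
    have h5 := hδ v
    have h6 := hf2 v
    have h7 := hN2 v
    rw [h2, abs_le] at h6
    have key : 2 * N v 0 ≤ G.degree v ∧ 2 * N v 1 ≤ G.degree v := by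
      by_cases hva : v = a
      · subst hva
        rw [h2, abs_le] at hfa
        omega
      · by_cases hvb : v = b
        · subst hvb
          rw [h2, abs_le] at hfb
          omega
        · have := h4.2.2.1 hva hvb
          omega
    fin_cases α
    · exact key.1
    · exact key.2
    · change 2 * N v 2 ≤ _
      omega
  · intro φ hφ
    have hNφ : ∀ v α, N (φ v) α = N v α := by
      intro v α
      symm
      simp only [N]
      refine Finset.card_bij (fun w _ => φ w) ?_ ?_ ?_
      · intro w hw
        simp only [Finset.mem_filter, mem_neighborFinset] at hw ⊢
        exact ⟨φ.map_adj_iff.2 hw.1, by rw [hφ _ _ hw.1]; exact hw.2⟩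
      · intro w _ w' _ h
        exact φ.injective h
      · intro w hw
        simp only [Finset.mem_filter, mem_neighborFinset] at hw
        obtain ⟨w', rfl⟩ := φ.surjective w
        have hw1 := φ.map_adj_iff.1 hw.1
        refine ⟨w', ?_, rfl⟩
        simp only [Finset.mem_filter, mem_neighborFinset]
        exact ⟨hw1, by rw [← hφ _ _ hw1]; exact hw.2⟩
    have hPφ : ∀ v w, P.Adj v w → P.Adj (φ v) (φ w) := by
      intro v w h
      rw [← hc2, hφ _ _ (hPG _ _ h), hc2]
      exact h
    have hxa : P.Adj a x := by rw [hP]; omega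
    have hφa : φ a = a := by
      by_contra hcon
      by_cases hab : φ a = b
      · have h1 := hPφ _ _ hxa
        rw [hab, hP] at h1
        have h2 := hlt (φ x)
        have h3 : φ x = y := hinj (by omega)
        apply hfxy
        rw [hdiff, hdiff, ← h3, hNφ, hNφ]
      · have h1 := (hPdeg (φ a)).2.2.1 hcon hab
        have h2 := (hPdeg a).2.2.2 (Or.inl rfl)
        rw [← hN2, hNφ, hN2] at h1
        omega
    have main : ∀ i, ∀ v, pos v = i → φ v = v := by
      intro i
      induction i using Nat.strong_induction_on with
      | _ i ih =>
        intro v hv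
        by_cases hi : i = 0
        · have : v = a := hinj (by omega)
          rw [this, hφa]
        · obtain ⟨w, hw⟩ := hsurj (i - 1) (by have := hlt v; omega)
          have hw' := ih (i - 1) (by omega) w hw
          have h1 := hPφ w v (by rw [hP]; omega)
          rw [hw', hP] at h1
          rcases h1 with h1 | h1
          · exact hinj (by omega)
          · have h2 := ih (pos (φ v)) (by omega) (φ v) rfl
            exact φ.injective h2
    exact fun v => main _ v rfl
end

section
/- If G is a finite simple graph of minimum degree at least 2, then the symmetric digraph ↔G obtained from G by replacing each edge uv by the two opposite arcs (u,v) and (v,u) has a majority arc coloring with 3 colors; that is, there is a function c assigning to each ordered pair (u,v) with u adjacent to v in G one of 3 colors such that for every vertex u and every color α, 2·|{v : v adjacent to u and c(v,u) = α}| ≤ deg(u) and 2·|{v : v adjacent to u and c(u,v) = α}| ≤ deg(u). -/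
open SimpleGraph

/-- König: a `k`-regular bipartite multigraph (edge set `S`, ends `f`, `g`) is `k`-edge-colorable. -/
theorem konig_aux {A E : Type*} [Fintype A] [DecidableEq A] [DecidableEq E] (f g : E → A) :
    ∀ (k : ℕ) (S : Finset E), (∀ a, (S.filter (fun x => f x = a)).card = k) →
      (∀ a, (S.filter (fun x => g x = a)).card = k) →
      ∃ c : E → ℕ, (∀ x ∈ S, c x < k) ∧
        ∀ x ∈ S, ∀ y ∈ S, c x = c y → (f x = f y ∨ g x = g y) → x = y := by
  intro k
  induction k with
  | zero =>
    intro S hf _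
    have hS : ∀ x, x ∉ S := by
      intro x hx
      have h := Finset.card_eq_zero.1 (hf (f x))
      have : x ∈ S.filter (fun y => f y = f x) := by simp [hx]
      rw [h] at this
      simp at this
    exact ⟨fun _ => 0, fun x hx => absurd hx (hS x), fun x hx => absurd hx (hS x)⟩
  | succ k ih =>
    intro S hf hg
    let t : A → Finset A := fun a => (S.filter (fun x => f x = a)).image g
    have hall : ∀ T : Finset A, T.card ≤ (T.biUnion t).card := by
      intro T
      have h1 : (S.filter (fun x => f x ∈ T)).card = T.card * (k + 1) := by
        rw [Finset.card_eq_sum_card_fiberwise (f := f) (t := T)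
          (by intro x hx; simpa using (Finset.mem_filter.1 hx).2)]
        rw [Finset.sum_const_nat (m := k + 1)]
        intro a ha
        rw [← hf a, Finset.filter_filter]
        congr 1
        ext x
        simp only [Finset.mem_filter]
        constructor
        · rintro ⟨h, _, h'⟩; exact ⟨h, h'⟩
        · rintro ⟨h, rfl⟩; exact ⟨h, ha, rfl⟩
      have h2 : (S.filter (fun x => f x ∈ T)).card ≤ (T.biUnion t).card * (k + 1) := by
        rw [Finset.card_eq_sum_card_fiberwise (f := g) (t := T.biUnion t)
          (by
            intro x hx
            have hx' := Finset.mem_filter.1 hx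
            simp only [Finset.mem_coe, Finset.mem_biUnion, t, Finset.mem_image, Finset.mem_filter]
            exact ⟨f x, hx'.2, x, ⟨hx'.1, rfl⟩, rfl⟩)]
        apply Finset.sum_le_card_nsmul
        intro b _
        rw [← hg b]
        apply Finset.card_le_card
        apply Finset.filter_subset_filter
        apply Finset.filter_subset
      rw [h1] at h2
      exact Nat.le_of_mul_le_mul_right h2 (Nat.succ_pos k)
    obtain ⟨m, hm, hmt⟩ := (Finset.all_card_le_biUnion_card_iff_exists_injective t).1 hall
    have hex : ∀ a, ∃ x, x ∈ S ∧ f x = a ∧ g x = m a := by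
      intro a
      have := hmt a
      simp only [t, Finset.mem_image, Finset.mem_filter] at this
      obtain ⟨x, ⟨h1, h2⟩, h3⟩ := this
      exact ⟨x, h1, h2, h3⟩
    choose e heS hef heg using hex
    have hsurj : Function.Surjective m := Finite.surjective_of_injective hm
    let S' := S.filter (fun x => x ∉ Finset.univ.image e)
    have hmem : ∀ x, x ∈ S' ↔ x ∈ S ∧ ∀ a, e a ≠ x := by
      intro x; simp [S']
    obtain ⟨c, hc, hcp⟩ := ih S' (by
        intro a
        have : S'.filter (fun x => f x = a) = (S.filter (fun x => f x = a)).erase (e a) := by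
          ext x
          simp only [Finset.mem_filter, Finset.mem_erase, hmem]
          constructor
          · rintro ⟨⟨h1, h2⟩, h3⟩; exact ⟨fun h => h2 a h.symm, h1, h3⟩
          · rintro ⟨h1, h2, h3⟩
            refine ⟨⟨h2, ?_⟩, h3⟩
            rintro b rfl
            rw [hef] at h3
            exact h1 (by rw [h3])
        rw [this, Finset.card_erase_of_mem (by simp [heS, hef]), hf]
        rfl) (by
        intro b
        obtain ⟨a, rfl⟩ := hsurj b
        have : S'.filter (fun x => g x = m a) = (S.filter (fun x => g x = m a)).erase (e a) := by
          ext x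
          simp only [Finset.mem_filter, Finset.mem_erase, hmem]
          constructor
          · rintro ⟨⟨h1, h2⟩, h3⟩; exact ⟨fun h => h2 a h.symm, h1, h3⟩
          · rintro ⟨h1, h2, h3⟩
            refine ⟨⟨h2, ?_⟩, h3⟩
            rintro b rfl
            rw [heg] at h3
            exact h1 (by rw [hm h3])
        rw [this, Finset.card_erase_of_mem (by simp [heS, heg]), hg]
        rfl)
    refine ⟨fun x => if x ∈ Finset.univ.image e then k else c x, ?_, ?_⟩
    · intro x hx
      dsimp only
      split_ifs with h
      · exact Nat.lt_succ_self k
      · exact (hc x (Finset.mem_filter.2 ⟨hx, h⟩)).trans (Nat.lt_succ_self k)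
    · intro x hx y hy hxy hor
      dsimp only at hxy
      split_ifs at hxy with h1 h2 h2
      · obtain ⟨a, _, rfl⟩ := Finset.mem_image.1 h1
        obtain ⟨b, _, rfl⟩ := Finset.mem_image.1 h2
        rw [hef, hef, heg, heg] at hor
        rcases hor with h | h
        · rw [h]
        · rw [hm h]
      · have := hc y (Finset.mem_filter.2 ⟨hy, h2⟩); omega
      · have := hc x (Finset.mem_filter.2 ⟨hx, h1⟩); omega
      · exact hcp x (Finset.mem_filter.2 ⟨hx, h1⟩) y (Finset.mem_filter.2 ⟨hy, h2⟩) hxy hor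

/-- Blockwise injective coloring of a set of size `d ≥ 2` split in blocks of size 3. -/
theorem block_count {V : Type*} (N : Finset V) (d : ℕ) (hd : 2 ≤ d) (i : V → ℕ)
    (hi : ∀ v ∈ N, i v < d) (hinj : ∀ v ∈ N, ∀ w ∈ N, i v / 3 = i w / 3 → v = w) :
    2 * N.card ≤ d := by
  have h : N.card ≤ (Finset.range ((d + 2) / 3)).card := by
    apply Finset.card_le_card_of_injOn (fun v => i v / 3)
    · intro v hv
      have := hi v hv
      simp only [Finset.coe_range, Set.mem_Iio]
      omega
    · intro v hv w hw h
      exact hinj v hv w hw h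
  rw [Finset.card_range] at h
  omega

/-- If `G` has minimum degree at least 2, then the symmetric digraph `↔G` (each edge of `G`
replaced by the two opposite arcs) has a majority arc 3-coloring: for every vertex `u` and
every color `α`, at most half of the arcs entering `u` and at most half of the arcs leaving
`u` have color `α`. -/
theorem majority_arc_coloring_symmetric_digraph {V : Type*} [Fintype V] [DecidableEq V]
    (G : SimpleGraph V) [DecidableRel G.Adj] (hδ : ∀ v : V, 2 ≤ G.degree v) :
    ∃ c : V → V → Fin 3, ∀ u : V, ∀ α : Fin 3,
      2 * ((G.neighborFinset u).filter (fun v => c v u = α)).card ≤ G.degree u ∧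
      2 * ((G.neighborFinset u).filter (fun v => c u v = α)).card ≤ G.degree u := by
  classical
  have hidx : ∀ u, ∃ i : V → ℕ, (∀ v, G.Adj u v → i v < G.degree u) ∧
      ∀ v w, G.Adj u v → G.Adj u w → i v = i w → v = w := by
    intro u
    let q := (G.neighborFinset u).equivFin
    refine ⟨fun v => if h : v ∈ G.neighborFinset u then (q ⟨v, h⟩ : ℕ) else 0, ?_, ?_⟩
    · intro v hv
      have hv' : v ∈ G.neighborFinset u := by simpa using hv
      simp only [hv', dif_pos]
      exact (q ⟨v, hv'⟩).2
    · intro v w hv hw h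
      have hv' : v ∈ G.neighborFinset u := by simpa using hv
      have hw' : w ∈ G.neighborFinset u := by simpa using hw
      simp only [hv', hw', dif_pos] at h
      have := q.injective (Fin.ext h)
      exact congrArg Subtype.val this
  choose idx hlt hinj using hidx
  let n := Fintype.card V
  have hn : ∀ u v, G.Adj u v → idx u v / 3 < n := by
    intro u v h
    have h1 := hlt u v h
    have h2 := G.degree_lt_card_verts u
    simp only [n]
    omega
  let e : {p : V × V // G.Adj p.1 p.2} → ((V × Fin n) × Fin 3) := fun d =>
    ((d.1.1, ⟨idx d.1.1 d.1.2 / 3, hn _ _ d.2⟩), ⟨idx d.1.1 d.1.2 % 3, Nat.mod_lt _ (by norm_num)⟩)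
  have he : Function.Injective e := by
    rintro ⟨⟨u, v⟩, h⟩ ⟨⟨u', v'⟩, h'⟩ heq
    simp only [e, Prod.mk.injEq, Fin.mk.injEq] at heq
    obtain ⟨⟨rfl, h1⟩, h2⟩ := heq
    have : v = v' := hinj u v v' h h' (by omega)
    subst this
    rfl
  let sw : Equiv.Perm {p : V × V // G.Adj p.1 p.2} :=
    ⟨fun d => ⟨(d.1.2, d.1.1), d.2.symm⟩, fun d => ⟨(d.1.2, d.1.1), d.2.symm⟩,
      fun _ => rfl, fun _ => rfl⟩
  let σ : Equiv.Perm ((V × Fin n) × Fin 3) := sw.extendDomain (Equiv.ofInjective e he)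
  have hσ : ∀ d, σ (e d) = e (sw d) := fun d =>
    Equiv.Perm.extendDomain_apply_image sw (Equiv.ofInjective e he) d
  have hfib : ∀ a : V × Fin n, ((Finset.univ : Finset ((V × Fin n) × Fin 3)).filter (fun x => x.1 = a)).card = 3 := by
    intro a
    have : (Finset.univ : Finset ((V × Fin n) × Fin 3)).filter (fun x => x.1 = a)
        = (Finset.univ : Finset (Fin 3)).image (fun j => (a, j)) := by
      ext ⟨b, j⟩
      simp only [Finset.mem_filter, Finset.mem_univ, true_and, Finset.mem_image, Prod.mk.injEq]
      exact ⟨fun h => ⟨j, h.symm, rfl⟩, fun ⟨_, h, _⟩ => h.symm⟩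
    rw [this, Finset.card_image_of_injective _ (fun i j h => (Prod.mk.inj h).2)]
    simp
  obtain ⟨c, hc, hcp⟩ := konig_aux (fun x : ((V × Fin n) × Fin 3) => x.1) (fun x : ((V × Fin n) × Fin 3) => (σ x).1) 3 Finset.univ hfib (by
    intro a
    refine Eq.trans ?_ (hfib a)
    apply Finset.card_bij (fun x _ => σ x)
    · intro x hx
      simpa using hx
    · intro x _ y _ h
      exact σ.injective h
    · intro y hy
      exact ⟨σ.symm y, by simpa using hy, by simp⟩)
  refine ⟨fun u v => if h : G.Adj u v then
    ⟨c (e ⟨(u, v), h⟩), hc _ (Finset.mem_univ _)⟩ else 0, ?_⟩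
  intro u α
  constructor
  · apply block_count _ _ (hδ u) (idx u)
    · intro v hv
      exact hlt u v (by simpa using (Finset.mem_filter.1 hv).1)
    · intro v hv w hw h
      obtain ⟨hv1, hv2⟩ := Finset.mem_filter.1 hv
      obtain ⟨hw1, hw2⟩ := Finset.mem_filter.1 hw
      have av : G.Adj u v := by simpa using hv1
      have aw : G.Adj u w := by simpa using hw1
      dsimp only at hv2 hw2
      rw [dif_pos av.symm] at hv2
      rw [dif_pos aw.symm, ← hv2] at hw2
      have h3 := Fin.mk.inj hw2
      have h4 := he (hcp _ (Finset.mem_univ _) _ (Finset.mem_univ _) h3.symm (Or.inr (by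
        simp only [hσ]
        simp only [e, sw, Equiv.coe_fn_mk, h])))
      exact congrArg (fun d => d.1.1) h4
  · apply block_count _ _ (hδ u) (idx u)
    · intro v hv
      exact hlt u v (by simpa using (Finset.mem_filter.1 hv).1)
    · intro v hv w hw h
      obtain ⟨hv1, hv2⟩ := Finset.mem_filter.1 hv
      obtain ⟨hw1, hw2⟩ := Finset.mem_filter.1 hw
      have av : G.Adj u v := by simpa using hv1
      have aw : G.Adj u w := by simpa using hw1
      dsimp only at hv2 hw2
      rw [dif_pos av] at hv2
      rw [dif_pos aw, ← hv2] at hw2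
      have h3 := Fin.mk.inj hw2
      have h4 := he (hcp _ (Finset.mem_univ _) _ (Finset.mem_univ _) h3.symm (Or.inl (by
        simp only [e, h])))
      exact congrArg (fun d => d.1.2) h4
end
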